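/- arXiv:1904.05269 — 2 statements merged into one kernel-verified Lean document; each statement's English description precedes it below -/
import Mathlib

section
/- Every graph G with Euler genus g satisfies π(G) ≤ 256·max{2g,3}. -/
/-- A colouring `φ` of (the vertices of) `G` is *nonrepetitive* if for no path of `G`
(with vertex sequence of even length `2k`) the sequence of colours on the first half
equals the sequence of colours on the second half. -/
def SimpleGraph.IsNonrepetitiveColouring {V α : Type*} (G : SimpleGraph V) (φ : V → α) : Prop :=
  ∀ ⦃u v : V⦄ (p : G.Walk u v), p.IsPath →
    ∀ k : ℕ, p.support.length = 2 * k →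
      (p.support.map φ).take k ≠ (p.support.map φ).drop k

/-- The *nonrepetitive chromatic number* `π(G)`: the least `n` such that `G` has a
nonrepetitive colouring with `n` colours. -/
noncomputable def SimpleGraph.nonrepChromNum {V : Type*} (G : SimpleGraph V) : ℕ :=
  sInf {n : ℕ | ∃ φ : V → Fin n, G.IsNonrepetitiveColouring φ}

/-- An *embedding scheme* for `G` (Mohar–Thomassen): a rotation system (a permutation of
the darts of `G` preserving tails, acting as a single cycle on the darts at each vertex)
together with a signature on the edges. Such schemes describe precisely the cellular
embeddings of `G` in (disjoint unions of) closed surfaces. -/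
structure SimpleGraph.EmbeddingScheme {V : Type*} (G : SimpleGraph V) where
  /-- the rotation: the cyclic order of the darts around each vertex -/
  rot : Equiv.Perm G.Dart
  rot_fixes_tail : ∀ d : G.Dart, (rot d).toProd.1 = d.toProd.1
  rot_single_cycle : ∀ d d' : G.Dart, d.toProd.1 = d'.toProd.1 → rot.SameCycle d d'
  /-- the signature: `true` on orientation-preserving edges -/
  sign : Sym2 V → Bool

/-- The face-tracing step on flags (darts with a side): traverse the dart, flip the side
on negative edges, and turn according to the rotation (by its inverse when on the
negative side). Orbits of this map trace the facial walks of the scheme, each face being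
traced once in each direction. -/
def SimpleGraph.EmbeddingScheme.next {V : Type*} {G : SimpleGraph V}
    (S : G.EmbeddingScheme) (x : G.Dart × Bool) : G.Dart × Bool :=
  let s' : Bool := Bool.xor x.2 (!(S.sign x.1.edge))
  (if s' then S.rot x.1.symm else S.rot.symm x.1.symm, s')

/-- Twice the number of faces of the embedding described by a scheme: the number of
orbits of the face-tracing map on flags. -/
noncomputable def SimpleGraph.EmbeddingScheme.flagFaceCount {V : Type*} {G : SimpleGraph V}
    (S : G.EmbeddingScheme) : ℕ :=
  Nat.card (Quot fun x y : G.Dart × Bool => S.next x = y)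

/-- The Euler genus `2c - (|V| - |E| + |F|)` of the embedding described by a scheme,
where `c` is the number of connected components and the faces are the orbits of the
face-tracing map (each face counted twice) together with one face for each isolated
vertex. -/
noncomputable def SimpleGraph.EmbeddingScheme.eulerGenusInt {V : Type*} {G : SimpleGraph V}
    (S : G.EmbeddingScheme) : ℤ :=
  2 * Nat.card G.ConnectedComponent -
    ((Nat.card V : ℤ) - Nat.card G.edgeSet +
      (S.flagFaceCount / 2 + Nat.card {v : V // ∀ w : V, ¬ G.Adj v w}))

/-- The *Euler genus* of a graph: the minimum Euler genus of an embedding scheme for it.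
(For the orientable surface with `h` handles this is `2h`; for the non-orientable surface
with `c` cross-caps it is `c`.) -/
noncomputable def SimpleGraph.eulerGenus {V : Type*} (G : SimpleGraph V) : ℕ :=
  sInf {g : ℕ | ∃ S : G.EmbeddingScheme, S.eulerGenusInt = (g : ℤ)}

namespace NonrepetitiveColouring

/-! ### A four-letter word controlling walks on a line -/

/-- The paperfolding word: the residue mod four of the odd part. -/
def paperfold (n : ℤ) : Bool :=
  if h : n = 0 then false
  else if n % 2 = 0 then paperfold (n / 2) else n % 4 == 1
termination_by n.natAbs
decreasing_by omega

theorem paperfold_two_mul (n : ℤ) : paperfold (2 * n) = paperfold n := by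
  by_cases h : n = 0
  · simp [h]
  · rw [paperfold, dif_neg (by omega), if_pos (by omega)]
    congr 1
    omega

theorem paperfold_odd {n : ℤ} (h : n % 2 = 1) : paperfold n = (n % 4 == 1) := by
  rw [paperfold, dif_neg (by omega), if_neg (by omega)]

theorem paperfold_no_even_square (q : ℕ) (hq : 0 < q) (hq2 : q % 2 = 0) (m : ℤ)
    (h : ∀ z, m ≤ z → z < m + q → paperfold z = paperfold (z + q)) : False := by
  induction q using Nat.strong_induction_on generalizing m with
  | _ q ih =>
    by_cases h4 : q % 4 = 0
    · refine ih (q / 2) (by omega) (by omega) (by omega) ((m + 1) / 2) fun z h1 h2 => ?_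
      have := h (2 * z) (by omega) (by omega)
      rw [paperfold_two_mul, show 2 * z + (q : ℤ) = 2 * (z + (q / 2 : ℕ)) by omega,
        paperfold_two_mul] at this
      exact this
    · have key : ∀ z : ℤ, z % 2 = 1 → paperfold z ≠ paperfold (z + q) := by
        intro z hz
        rw [paperfold_odd hz, paperfold_odd (by omega)]
        have : z % 4 = 1 ∨ z % 4 = 3 := by omega
        rcases this with h1 | h1
        · have : (z + q) % 4 = 3 := by omega
          simp [h1, this]
        · have : (z + q) % 4 = 1 := by omega
          simp [h1, this]
      by_cases hm : m % 2 = 1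
      · exact key m hm (h m le_rfl (by omega))
      · exact key (m + 1) (by omega) (h (m + 1) (by omega) (by omega))

/-- A letter of `{0, 1}` encoding a bit. -/
def bit (b : Bool) : Fin 4 := if b then 1 else 0

theorem bit_ne_not (b : Bool) : bit b ≠ bit (!b) := by cases b <;> decide

theorem bit_inj {a b : Bool} (h : bit a = bit b) : a = b := by
  revert h; cases a <;> cases b <;> decide

/-- A square-free bi-infinite word over four letters in which any three consecutive letters
are distinct. -/
def lineWord (n : ℤ) : Fin 4 :=
  if n % 9 = 0 ∨ n % 9 = 3 ∨ n % 9 = 6 then 2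
  else if n % 9 = 1 ∨ n % 9 = 5 then 3
  else if n % 9 = 2 then bit (paperfold (n / 9))
  else if n % 9 = 4 then bit (!paperfold (n / 9))
  else if n % 9 = 7 then bit (n / 9 % 2 == 0)
  else bit (!(n / 9 % 2 == 0))

theorem bit_ne_two (b : Bool) : bit b ≠ 2 := by cases b <;> decide

theorem bit_ne_three (b : Bool) : bit b ≠ 3 := by cases b <;> decide

theorem lineWord_eq_two {n : ℤ} : lineWord n = 2 ↔ n % 3 = 0 := by
  unfold lineWord
  split_ifs <;> simp [bit_ne_two] <;> omega

theorem lineWord_eq_three {n : ℤ} : lineWord n = 3 ↔ n % 9 = 1 ∨ n % 9 = 5 := by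
  unfold lineWord
  split_ifs <;> simp [bit_ne_three] <;> omega

theorem lineWord_of_two {n : ℤ} (h : n % 9 = 2) : lineWord n = bit (paperfold (n / 9)) := by
  unfold lineWord; split_ifs <;> first | rfl | omega

theorem lineWord_of_four {n : ℤ} (h : n % 9 = 4) : lineWord n = bit (!paperfold (n / 9)) := by
  unfold lineWord; split_ifs <;> first | rfl | omega

theorem lineWord_of_seven {n : ℤ} (h : n % 9 = 7) : lineWord n = bit (n / 9 % 2 == 0) := by
  unfold lineWord; split_ifs <;> first | rfl | omega

theorem lineWord_of_eight {n : ℤ} (h : n % 9 = 8) : lineWord n = bit (!(n / 9 % 2 == 0)) := by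
  unfold lineWord; split_ifs <;> first | rfl | omega

theorem lineWord_ne {n p : ℤ} (hp : p = 1 ∨ p = 2) : lineWord n ≠ lineWord (n + p) := by
  intro h
  have h2 := (lineWord_eq_two (n := n)).symm.trans (by rw [h, lineWord_eq_two])
  have h3 := (lineWord_eq_three (n := n)).symm.trans (by rw [h, lineWord_eq_three])
  have : (n % 9 = 2 ∧ p = 2) ∨ (n % 9 = 7 ∧ p = 1) := by omega
  rcases this with ⟨h1, rfl⟩ | ⟨h1, rfl⟩
  · rw [lineWord_of_two h1, lineWord_of_four (by omega), show (n + 2) / 9 = n / 9 by omega] at h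
    exact bit_ne_not _ h
  · rw [lineWord_of_seven h1, lineWord_of_eight (by omega), show (n + 1) / 9 = n / 9 by omega] at h
    exact bit_ne_not _ h

theorem lineWord_square_free (p : ℕ) (hp : 0 < p) (m : ℤ)
    (h : ∀ z, m ≤ z → z < m + p → lineWord z = lineWord (z + p)) : False := by
  have hm := h m le_rfl (by omega)
  have p1 : p ≠ 1 := by rintro rfl; exact lineWord_ne (Or.inl rfl) hm
  have p2 : p ≠ 2 := by rintro rfl; exact lineWord_ne (Or.inr rfl) hm
  have h2 : ∀ z, m ≤ z → z < m + p → (z % 3 = 0 ↔ (z + p) % 3 = 0) := fun z a b => by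
    rw [← lineWord_eq_two, h z a b, lineWord_eq_two]
  have h3 : ∀ z, m ≤ z → z < m + p →
      ((z % 9 = 1 ∨ z % 9 = 5) ↔ ((z + p) % 9 = 1 ∨ (z + p) % 9 = 5)) := fun z a b => by
    rw [← lineWord_eq_three, h z a b, lineWord_eq_three]
  have hp3 : p % 3 = 0 := by
    have := h2 ((m + 2) / 3 * 3) (by omega) (by omega)
    omega
  have hp9 : p % 9 = 0 := by
    have a0 := h3 m (by omega) (by omega)
    have a1 := h3 (m + 1) (by omega) (by omega)
    have a2 := h3 (m + 2) (by omega) (by omega)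
    omega
  obtain ⟨q, rfl⟩ : ∃ q, p = 9 * q := ⟨p / 9, by omega⟩
  have hq2 : q % 2 = 0 := by
    have hz := h ((m + 1) / 9 * 9 + 7) (by omega) (by omega)
    rw [lineWord_of_seven (by omega), lineWord_of_seven (by omega)] at hz
    have := bit_inj hz
    rw [Bool.eq_iff_iff] at this
    simp only [beq_iff_eq] at this
    omega
  refine paperfold_no_even_square q (by omega) hq2 ((m + 6) / 9) fun z a b => ?_
  have hz := h (9 * z + 2) (by omega) (by omega)
  rw [lineWord_of_two (by omega), lineWord_of_two (by omega)] at hz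
  have := bit_inj hz
  rwa [show (9 * z + 2) / 9 = z by omega,
    show (9 * z + 2 + ((9 * q : ℕ) : ℤ)) / 9 = z + q by omega] at this

theorem lineWord_inj_near {a b : ℤ} (h : lineWord a = lineWord b) (h1 : a ≤ b + 2)
    (h2 : b ≤ a + 2) : a = b := by
  by_contra hne
  rcases lt_or_gt_of_ne hne with hlt | hlt
  · exact lineWord_ne (n := a) (p := b - a) (by omega) (by rw [h]; congr 1; omega)
  · exact lineWord_ne (n := b) (p := a - b) (by omega) (by rw [← h]; congr 1; omega)

theorem exists_eq_of_between (t : ℕ) (x : ℕ → ℤ)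
    (hx : ∀ i, i + 1 < t → x (i + 1) ≤ x i + 1 ∧ x i ≤ x (i + 1) + 1) (i : ℕ) (hi : i < t)
    (z : ℤ) (hz : (x 0 ≤ z ∧ z ≤ x i) ∨ (x i ≤ z ∧ z ≤ x 0)) : ∃ j ≤ i, x j = z := by
  induction i with
  | zero => exact ⟨0, le_rfl, by omega⟩
  | succ i ih =>
    by_cases h : (x 0 ≤ z ∧ z ≤ x i) ∨ (x i ≤ z ∧ z ≤ x 0)
    · obtain ⟨j, hj, e⟩ := ih (by omega) h
      exact ⟨j, by omega, e⟩
    · have := hx i hi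
      exact ⟨i + 1, le_rfl, by omega⟩

/-- Two equally coloured lazy walks on the line are translates or reflections of each other. -/
theorem lineWord_rigid (t : ℕ) (x y : ℕ → ℤ)
    (hx : ∀ i, i + 1 < t → x (i + 1) ≤ x i + 1 ∧ x i ≤ x (i + 1) + 1)
    (hy : ∀ i, i + 1 < t → y (i + 1) ≤ y i + 1 ∧ y i ≤ y (i + 1) + 1)
    (hc : ∀ i < t, lineWord (x i) = lineWord (y i)) (i : ℕ) (hi : i < t) :
    (∀ j ≤ i, x j = x 0 ∧ y j = y 0) ∨
    ((∀ j ≤ i, y j = y 0 + (x j - x 0)) ∧ ∃ j ≤ i, x j = x i + 1 ∨ x j = x i - 1) ∨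
    ((∀ j ≤ i, y j = y 0 - (x j - x 0)) ∧ ∃ j ≤ i, x j = x i + 1 ∨ x j = x i - 1) := by
  induction i with
  | zero => exact Or.inl fun j hj => by obtain rfl : j = 0 := by omega
                                        simp
  | succ i ih =>
    have hxi := hx i hi
    have hyi := hy i hi
    have c0 := hc i (by omega)
    have c1 := hc (i + 1) hi
    have ext : ∀ {P : ℕ → Prop}, (∀ j ≤ i, P j) → P (i + 1) → ∀ j ≤ i + 1, P j := by
      intro P h1 h2 j hj
      rcases Nat.lt_or_ge i j with h | h
      · obtain rfl : j = i + 1 := by omega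
        exact h2
      · exact h1 j h
    have stat : x (i + 1) = x i ↔ y (i + 1) = y i := by
      constructor <;> intro h <;> rw [h] at c1
      · exact lineWord_inj_near (c1.symm.trans c0) (by omega) (by omega)
      · exact lineWord_inj_near (c1.trans c0.symm) (by omega) (by omega)
    rcases ih (by omega) with h | ⟨h, j, hj, hw⟩ | ⟨h, j, hj, hw⟩
    · have hi0 := h i le_rfl
      by_cases hs : x (i + 1) = x i
      · exact Or.inl (ext h (by omega))
      · have : y (i + 1) ≠ y i := fun e => hs (stat.2 e)
        have hd : y (i + 1) - y i = x (i + 1) - x i ∨ y (i + 1) - y i = - (x (i + 1) - x i) := by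
          omega
        rcases hd with hd | hd
        · refine Or.inr (Or.inl ⟨ext (fun j hj => ?_) (by omega), i, by omega, by omega⟩)
          have := h j hj
          omega
        · refine Or.inr (Or.inr ⟨ext (fun j hj => ?_) (by omega), i, by omega, by omega⟩)
          have := h j hj
          omega
    all_goals
      have hji := h j hj
      have hii := h i le_rfl
      have cj := hc j (by omega)
      have turn : x (i + 1) = x j ↔ y (i + 1) = y j := by
        constructor <;> intro h <;> rw [h] at c1
        · exact lineWord_inj_near (c1.symm.trans cj) (by omega) (by omega)
        · exact lineWord_inj_near (c1.trans cj.symm) (by omega) (by omega)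
    · refine Or.inr (Or.inl ⟨ext h (by omega), ?_⟩)
      by_cases hs : x (i + 1) = x i
      · exact ⟨j, by omega, by omega⟩
      · exact ⟨i, by omega, by omega⟩
    · refine Or.inr (Or.inr ⟨ext h (by omega), ?_⟩)
      by_cases hs : x (i + 1) = x i
      · exact ⟨j, by omega, by omega⟩
      · exact ⟨i, by omega, by omega⟩

/-- Every lazy walk on the line that is repetitively coloured by `lineWord` repeats itself. -/
theorem lineWord_boring (t : ℕ) (x y : ℕ → ℤ)
    (hx : ∀ i, i + 1 < t → x (i + 1) ≤ x i + 1 ∧ x i ≤ x (i + 1) + 1)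
    (hy : ∀ i, i + 1 < t → y (i + 1) ≤ y i + 1 ∧ y i ≤ y (i + 1) + 1)
    (hxy : y 0 ≤ x (t - 1) + 1 ∧ x (t - 1) ≤ y 0 + 1)
    (hc : ∀ i < t, lineWord (x i) = lineWord (y i)) (i : ℕ) (hi : i < t) : x i = y i := by
  have ht : t - 1 < t := by omega
  have c0 := hc 0 (by omega)
  have ivt := exists_eq_of_between t x hx (t - 1) ht
  rcases lineWord_rigid t x y hx hy hc (t - 1) ht with h | ⟨h, -⟩ | ⟨h, j, hj, hw⟩
  · have h1 := h i (by omega)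
    have h2 := h (t - 1) le_rfl
    have := lineWord_inj_near c0 (by omega) (by omega)
    omega
  · by_contra hne
    have hi' := h i (by omega)
    obtain ⟨p, hp | hp⟩ : ∃ p : ℕ, y 0 = x 0 + p ∨ y 0 = x 0 - p :=
      ⟨(y 0 - x 0).natAbs, by omega⟩
    · refine lineWord_square_free p (by omega) (x 0) fun z h1 h2 => ?_
      obtain ⟨k, hk, rfl⟩ := ivt z (by omega)
      rw [hc k (by omega), h k hk]
      congr 1
      omega
    · refine lineWord_square_free p (by omega) (x 0 - 2 * p + 1) fun z h1 h2 => ?_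
      obtain ⟨k, hk, hz⟩ := ivt (z + p) (by omega)
      rw [← hz, hc k (by omega), h k hk]
      congr 1
      omega
  · exfalso
    have refl : ∀ z z', z + z' = x 0 + y 0 → (∃ k ≤ t - 1, x k = z) →
        lineWord z = lineWord z' := by
      rintro z z' hzz ⟨k, hk, rfl⟩
      rw [hc k (by omega), h k hk]
      congr 1
      omega
    rcases Int.emod_two_eq_zero_or_one (x 0 + y 0) with he | he
    · obtain ⟨m, hm⟩ : ∃ m, x 0 + y 0 = 2 * m := ⟨(x 0 + y 0) / 2, by omega⟩
      obtain ⟨k, hk, hkm⟩ := ivt m (by omega)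
      obtain ⟨l, hl, hlm⟩ : ∃ l ≤ t - 1, x l ≠ m := by
        by_contra hcon
        push Not at hcon
        have := hcon j hj
        have := hcon (t - 1) le_rfl
        omega
      obtain ⟨n, hn, hnm⟩ : ∃ n ≤ t - 1, x n = m + 1 ∨ x n = m - 1 := by
        by_cases h0 : x 0 = m
        · rcases lt_or_gt_of_ne hlm with hlt | hlt
          · obtain ⟨n, hn, e⟩ := exists_eq_of_between t x hx l (by omega) (m - 1) (by omega)
            exact ⟨n, by omega, Or.inr e⟩
          · obtain ⟨n, hn, e⟩ := exists_eq_of_between t x hx l (by omega) (m + 1) (by omega)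
            exact ⟨n, by omega, Or.inl e⟩
        · rcases lt_or_gt_of_ne h0 with hlt | hlt
          · obtain ⟨n, hn, e⟩ := exists_eq_of_between t x hx k (by omega) (m - 1) (by omega)
            exact ⟨n, by omega, Or.inr e⟩
          · obtain ⟨n, hn, e⟩ := exists_eq_of_between t x hx k (by omega) (m + 1) (by omega)
            exact ⟨n, by omega, Or.inl e⟩
      rcases hnm with hnm | hnm
      · have := refl (m + 1) (m - 1) (by omega) ⟨n, hn, hnm⟩
        have := lineWord_inj_near this (by omega) (by omega)
        omega
      · have := refl (m - 1) (m + 1) (by omega) ⟨n, hn, hnm⟩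
        have := lineWord_inj_near this (by omega) (by omega)
        omega
    · obtain ⟨m, hm⟩ : ∃ m, x 0 + y 0 = 2 * m + 1 := ⟨(x 0 + y 0) / 2, by omega⟩
      have : ((x 0 ≤ m ∧ m ≤ x (t - 1)) ∨ (x (t - 1) ≤ m ∧ m ≤ x 0)) ∨
          ((x 0 ≤ m + 1 ∧ m + 1 ≤ x (t - 1)) ∨ (x (t - 1) ≤ m + 1 ∧ m + 1 ≤ x 0)) := by omega
      rcases this with hb | hb
      · have := lineWord_inj_near (refl m (m + 1) (by omega) (ivt m hb)) (by omega) (by omega)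
        omega
      · have := lineWord_inj_near (refl (m + 1) m (by omega) (ivt (m + 1) hb)) (by omega)
          (by omega)
        omega

theorem lineWord_boring_list {V : Type*} (lev : V → ℕ) (l : List (V × V))
    (hl : (l.map Prod.fst ++ l.map Prod.snd).IsChain
      fun a b => lev a ≤ lev b + 1 ∧ lev b ≤ lev a + 1)
    (hc : ∀ p ∈ l, lineWord (lev p.1) = lineWord (lev p.2)) : ∀ p ∈ l, lev p.1 = lev p.2 := by
  intro p hp
  obtain ⟨i, hi, rfl⟩ := List.getElem_of_mem hp
  rw [List.isChain_iff_getElem] at hl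
  have := lineWord_boring l.length (fun i => if h : i < l.length then (lev l[i].1 : ℤ) else 0)
    (fun i => if h : i < l.length then (lev l[i].2 : ℤ) else 0) ?_ ?_ ?_ ?_ i hi
  · simpa [hi] using this
  · intro j hj
    have := hl j (by simp; omega)
    rw [List.getElem_append_left (by simp; omega), List.getElem_append_left (by simpa using hj)]
      at this
    simp only [List.getElem_map] at this
    simp only [hj, show j < l.length by omega, dite_true]
    omega
  · intro j hj
    have := hl (l.length + j) (by simp; omega)
    rw [List.getElem_append_right (by simp), List.getElem_append_right (by simp; omega)] at this
    simp only [List.getElem_map, List.length_map, Nat.add_sub_cancel_left, Nat.add_assoc] at this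
    simp only [hj, show j < l.length by omega, dite_true]
    omega
  · have h0 : 0 < l.length := by omega
    have := hl (l.length - 1) (by simp; omega)
    rw [List.getElem_append_left (by simp; omega), List.getElem_append_right (by simp; omega)]
      at this
    simp only [List.getElem_map, List.length_map, show l.length - 1 + 1 - l.length = 0 by omega]
      at this
    simp only [h0, show l.length - 1 < l.length by omega, dite_true]
    omega
  · intro j hj
    simpa [hj] using hc _ (List.getElem_mem hj)

/-- Two vertices that are equal or adjacent. -/
def LazyAdj {V : Type*} (H : SimpleGraph V) (a b : V) : Prop := a = b ∨ H.Adj a b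

/-- A colouring is strongly nonrepetitive if every repetitively coloured lazy walk
`a₁, …, aₜ, b₁, …, bₜ` (given as the list of the pairs `(aᵢ, bᵢ)`) has `aᵢ = bᵢ` for some `i`. -/
def IsStronglyNonrepetitive {V α : Type*} (H : SimpleGraph V) (φ : V → α) : Prop :=
  ∀ l : List (V × V), l ≠ [] → (l.map Prod.fst ++ l.map Prod.snd).IsChain (LazyAdj H) →
    (∀ p ∈ l, φ p.1 = φ p.2) → ∃ p ∈ l, p.1 = p.2

/-- In the natural order, the earlier neighbours of every vertex form a clique of size
at most `k`. -/
structure HasWidth (H : SimpleGraph ℕ) (k : ℕ) : Prop where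
  card_le : ∀ v, {u | u < v ∧ H.Adj u v}.ncard ≤ k
  clique : ∀ {v u u'}, u < v → H.Adj u v → u' < v → H.Adj u' v → LazyAdj H u u'

open Classical in
/-- The level of a vertex in the breadth-first layering of an ordered graph. -/
noncomputable def orderLevel (H : SimpleGraph ℕ) (v : ℕ) : ℕ :=
  if ∃ u : Fin v, H.Adj u v then
    (⨅ u : {u : Fin v // H.Adj u v}, orderLevel H u.1) + 1 else 0
termination_by v
decreasing_by exact u.1.2

theorem exists_orderLevel_eq {H : SimpleGraph ℕ} {u v : ℕ} (huv : u < v) (h : H.Adj u v) :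
    ∃ w < v, H.Adj w v ∧ orderLevel H v = orderLevel H w + 1 ∧
      ∀ w' < v, H.Adj w' v → orderLevel H w ≤ orderLevel H w' := by
  have hex : ∃ u : Fin v, H.Adj u v := ⟨⟨u, huv⟩, h⟩
  have : Nonempty {u : Fin v // H.Adj u v} := ⟨⟨⟨u, huv⟩, h⟩⟩
  obtain ⟨w, hw⟩ := Nat.sInf_mem
    (Set.range_nonempty fun u : {u : Fin v // H.Adj u v} => orderLevel H u.1)
  refine ⟨w.1, w.1.2, w.2, ?_, fun w' hw' h' => ?_⟩
  · rw [orderLevel, if_pos hex]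
    exact congrArg (· + 1) hw.symm
  · exact hw.trans_le (Nat.sInf_le ⟨⟨⟨w', hw'⟩, h'⟩, rfl⟩)

theorem HasWidth.orderLevel_le {H : SimpleGraph ℕ} {k : ℕ} (hH : HasWidth H k) {u v : ℕ}
    (huv : u < v) (h : H.Adj u v) :
    orderLevel H u ≤ orderLevel H v ∧ orderLevel H v ≤ orderLevel H u + 1 := by
  induction v using Nat.strong_induction_on generalizing u with
  | _ v ih =>
    obtain ⟨w, hw, hwv, e, hmin⟩ := exists_orderLevel_eq huv h
    have h1 := hmin u huv h
    rcases hH.clique huv h hw hwv with rfl | hadj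
    · omega
    · rcases lt_or_gt_of_ne hadj.ne with hlt | hlt
      · have := ih w hw hlt hadj
        omega
      · have := ih u huv hlt hadj.symm
        omega

theorem HasWidth.lazyAdj_orderLevel {H : SimpleGraph ℕ} {k : ℕ} (hH : HasWidth H k) {u v : ℕ}
    (h : LazyAdj H u v) :
    orderLevel H u ≤ orderLevel H v + 1 ∧ orderLevel H v ≤ orderLevel H u + 1 := by
  rcases h with rfl | h
  · omega
  · rcases lt_or_gt_of_ne h.ne with hlt | hlt
    · have := hH.orderLevel_le hlt h
      omega
    · have := hH.orderLevel_le hlt h.symm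
      omega

/-- The graph consisting of the edges inside the levels. -/
def levelGraph (H : SimpleGraph ℕ) : SimpleGraph ℕ where
  Adj u v := H.Adj u v ∧ orderLevel H u = orderLevel H v
  symm := ⟨fun _ _ h => ⟨h.1.symm, h.2.symm⟩⟩
  loopless := ⟨fun _ h => h.1.ne rfl⟩

theorem HasWidth.levelGraph {H : SimpleGraph ℕ} {k : ℕ} (hH : HasWidth H (k + 1)) :
    HasWidth (levelGraph H) k where
  card_le v := by
    by_cases hv : ∃ u < v, H.Adj u v
    · obtain ⟨u, huv, h⟩ := hv
      obtain ⟨w, hw, hwv, e, -⟩ := exists_orderLevel_eq huv h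
      have hfin : {u | u < v ∧ H.Adj u v}.Finite := (Set.finite_lt_nat v).subset fun _ h => h.1
      have : {u | u < v ∧ (NonrepetitiveColouring.levelGraph H).Adj u v} ⊂
          {u | u < v ∧ H.Adj u v} := by
        refine ⟨fun x hx => ⟨hx.1, hx.2.1⟩, fun hsub => ?_⟩
        have := (hsub (show w ∈ _ from ⟨hw, hwv⟩)).2.2
        omega
      have := Set.ncard_lt_ncard this hfin
      have := hH.card_le v
      omega
    · have : {u | u < v ∧ (NonrepetitiveColouring.levelGraph H).Adj u v} = ∅ := by
        ext u
        simp only [Set.mem_ofPred_eq, Set.mem_empty_iff_false, iff_false]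
        exact fun h => hv ⟨u, h.1, h.2.1⟩
      simp [this]
  clique h1 h2 h3 h4 := (hH.clique h1 h2.1 h3 h4.1).imp id fun h => ⟨h, h2.2.trans h4.2.symm⟩

open Classical in
/-- The first vertex of the component of `v` among the vertices of level greater than `r`. -/
noncomputable def anchor (H : SimpleGraph ℕ) (r v : ℕ) : ℕ :=
  if h : ∃ u : Fin v, H.Adj u v ∧ r < orderLevel H u then anchor H r h.choose else v
termination_by v
decreasing_by exact h.choose.2

theorem HasWidth.anchor_eq {H : SimpleGraph ℕ} {k : ℕ} (hH : HasWidth H k) {r u v : ℕ}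
    (h : H.Adj u v) (hu : r < orderLevel H u) (hv : r < orderLevel H v) :
    anchor H r u = anchor H r v := by
  obtain ⟨m, hm⟩ : ∃ m, max u v = m := ⟨_, rfl⟩
  induction m using Nat.strong_induction_on generalizing u v with
  | _ m ih =>
    wlog huv : u < v generalizing u v
    · exact (this h.symm hv hu (by omega) (by have := h.ne; omega)).symm
    have hex : ∃ u : Fin v, H.Adj u v ∧ r < orderLevel H u := ⟨⟨u, huv⟩, h, hu⟩
    rw [anchor.eq_1 H r v, dif_pos hex]
    obtain ⟨h1, h2⟩ := hex.choose_spec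
    rcases hH.clique huv h hex.choose.2 h1 with e | hadj
    · rw [e]
    · exact ih _ (by have := hex.choose.2; omega) hadj hu h2 rfl

theorem HasWidth.adj_anchor {H : SimpleGraph ℕ} {k : ℕ} (hH : HasWidth H k) {r u v : ℕ}
    (h : H.Adj u v) (hu : orderLevel H u = r) (hv : r < orderLevel H v) :
    u < anchor H r v ∧ H.Adj u (anchor H r v) := by
  induction v using Nat.strong_induction_on with
  | _ v ih =>
    have huv : u < v := by
      by_contra hcon
      have := hH.orderLevel_le (by have := h.ne; omega) h.symm
      omega
    rw [anchor]
    split_ifs with hex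
    · obtain ⟨h1, h2⟩ := hex.choose_spec
      rcases hH.clique huv h hex.choose.2 h1 with e | hadj
      · rw [← e] at h2
        omega
      · exact ih _ hex.choose.2 hadj h2
    · exact ⟨huv, h⟩

theorem HasWidth.isChain_filter_aux {H : SimpleGraph ℕ} {k : ℕ} (hH : HasWidth H k) {r : ℕ}
    (l : List ℕ) (a : ℕ) (hl : (a :: l).IsChain (LazyAdj H))
    (hr : ∀ x ∈ a :: l, r ≤ orderLevel H x) :
    (orderLevel H a = r →
      (a :: l.filter (orderLevel H · = r)).IsChain
        (LazyAdj (NonrepetitiveColouring.levelGraph H))) ∧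
    (r < orderLevel H a →
      (l.filter (orderLevel H · = r)).IsChain (LazyAdj (NonrepetitiveColouring.levelGraph H)) ∧
      ∀ u, orderLevel H u = r → u < anchor H r a → H.Adj u (anchor H r a) →
        (u :: l.filter (orderLevel H · = r)).IsChain
          (LazyAdj (NonrepetitiveColouring.levelGraph H))) := by
  induction l generalizing a with
  | nil => simp
  | cons b l ih =>
    rw [List.isChain_cons_cons] at hl
    obtain ⟨hab, hl⟩ := hl
    have ihb := ih b hl fun x hx => hr x (List.mem_cons_of_mem _ hx)
    have hb := hr b (by simp)
    rcases hb.eq_or_lt with hb | hb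
    · rw [List.filter_cons_of_pos (by simpa using hb.symm)]
      refine ⟨fun ha => ?_, fun ha => ⟨ihb.1 hb.symm, fun u hu hua hadj => ?_⟩⟩
      · rw [List.isChain_cons_cons]
        exact ⟨hab.imp id fun h => ⟨h, ha.trans hb⟩, ihb.1 hb.symm⟩
      · rw [List.isChain_cons_cons]
        refine ⟨?_, ihb.1 hb.symm⟩
        have hba : H.Adj b a := by
          rcases hab with rfl | h
          · omega
          · exact h.symm
        obtain ⟨h1, h2⟩ := hH.adj_anchor hba hb.symm ha
        exact (hH.clique hua hadj h1 h2).imp id fun h => ⟨h, hu.trans hb⟩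
    · rw [List.filter_cons_of_neg (by simpa using hb.ne')]
      refine ⟨fun ha => ?_, fun ha => ⟨(ihb.2 hb).1, fun u hu hua hadj => ?_⟩⟩
      · have hadj : H.Adj a b := by
          rcases hab with rfl | h
          · omega
          · exact h
        obtain ⟨h1, h2⟩ := hH.adj_anchor hadj ha hb
        exact (ihb.2 hb).2 a ha h1 h2
      · have e : anchor H r a = anchor H r b := by
          rcases hab with rfl | h
          · rfl
          · exact hH.anchor_eq h ha hb
        rw [e] at hua hadj
        exact (ihb.2 hb).2 u hu hua hadj

theorem HasWidth.isChain_filter {H : SimpleGraph ℕ} {k : ℕ} (hH : HasWidth H k) {r : ℕ}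
    (l : List ℕ) (hl : l.IsChain (LazyAdj H)) (hr : ∀ x ∈ l, r ≤ orderLevel H x) :
    (l.filter (orderLevel H · = r)).IsChain
      (LazyAdj (NonrepetitiveColouring.levelGraph H)) := by
  cases l with
  | nil => simp
  | cons a l =>
    have h := hH.isChain_filter_aux l a hl hr
    rcases (hr a (by simp)).eq_or_lt with ha | ha
    · rw [List.filter_cons_of_pos (by simpa using ha.symm)]
      exact h.1 ha.symm
    · rw [List.filter_cons_of_neg (by simpa using ha.ne')]
      exact (h.2 ha).1

theorem isStronglyNonrepetitive_const {V α : Type*} {H : SimpleGraph V} {φ : V → α}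
    (hH : ∀ u v, ¬ H.Adj u v) : IsStronglyNonrepetitive H φ := by
  intro l hl hchain _
  obtain ⟨p, l, rfl⟩ := List.exists_cons_of_ne_nil hl
  refine ⟨p, by simp, ?_⟩
  have hchain' : (p.1 :: (l.map Prod.fst ++ p.2 :: l.map Prod.snd)).IsChain (· = ·) :=
    hchain.imp fun a b h => h.resolve_right (hH a b)
  exact (List.pairwise_cons.1 (List.isChain_iff_pairwise.1 hchain')).1 p.2 (by simp)

/-- An ordered graph of width `k` has a strongly nonrepetitive colouring with `4 ^ k` colours. -/
theorem HasWidth.exists_isStronglyNonrepetitive {H : SimpleGraph ℕ} {k : ℕ}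
    (hH : HasWidth H k) : ∃ φ : ℕ → Fin (4 ^ k), IsStronglyNonrepetitive H φ := by
  induction k generalizing H with
  | zero =>
    refine ⟨fun _ => 0, isStronglyNonrepetitive_const ?_⟩
    have key : ∀ u v, u < v → ¬ H.Adj u v := fun u v huv h => by
      have hfin : {u | u < v ∧ H.Adj u v}.Finite := (Set.finite_lt_nat v).subset fun _ h => h.1
      have := (Set.ncard_eq_zero hfin).1 (Nat.le_zero.1 (hH.card_le v))
      exact this.subset (show u ∈ _ from ⟨huv, h⟩)
    intro u v h
    rcases lt_or_gt_of_ne h.ne with hlt | hlt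
    · exact key u v hlt h
    · exact key v u hlt h.symm
  | succ k ih =>
    obtain ⟨φ, hφ⟩ := ih hH.levelGraph
    refine ⟨fun v =>
        Fin.cast (pow_succ 4 k).symm (finProdFinEquiv (φ v, lineWord (orderLevel H v))),
      fun l hl hchain hc => ?_⟩
    have hc' : ∀ p ∈ l, φ p.1 = φ p.2 ∧
        lineWord (orderLevel H p.1) = lineWord (orderLevel H p.2) := by
      intro p hp
      simpa using hc p hp
    have hlev := lineWord_boring_list (orderLevel H) l
      (hchain.imp fun a b h => hH.lazyAdj_orderLevel h) fun p hp => (hc' p hp).2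
    obtain ⟨q, hq, hmin⟩ : ∃ q ∈ l, ∀ p ∈ l, orderLevel H q.1 ≤ orderLevel H p.1 := by
      have : ∃ q ∈ l.toFinset, ∀ p ∈ l.toFinset, orderLevel H q.1 ≤ orderLevel H p.1 :=
        Finset.exists_min_image _ _ (by simpa using hl)
      simpa using this
    set r := orderLevel H q.1 with hr
    have hfil := hH.isChain_filter (r := r) _ hchain fun x hx => by
      rw [List.mem_append, List.mem_map, List.mem_map] at hx
      rcases hx with ⟨p, hp, rfl⟩ | ⟨p, hp, rfl⟩
      · exact hmin p hp
      · rw [← hlev p hp]; exact hmin p hp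
    obtain ⟨p, hp, e⟩ := hφ (l.filter fun p => orderLevel H p.1 = r)
      (List.ne_nil_of_mem (List.mem_filter.2 ⟨hq, by simp [hr]⟩)) (by
        convert hfil using 1
        rw [List.filter_append, List.filter_map, List.filter_map]
        congr 2
        exact List.filter_congr fun p hp => by simp [hlev p hp])
      fun p hp => (hc' p (List.mem_of_mem_filter hp)).1
    exact ⟨p, List.mem_of_mem_filter hp, e⟩

/-- A rooted forest, given by the depth and the parent of each node; roots are their own
parents. -/
structure RootedForest (α : Type*) where
  level : α → ℕ
  par : α → α
  par_eq_self : ∀ {u}, level u = 0 → par u = u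
  level_par : ∀ {u}, level u ≠ 0 → level (par u) + 1 = level u

namespace RootedForest

variable {α : Type*} (F : RootedForest α)

/-- The descendants of a node, including the node itself. -/
def desc (z : α) : Set α := {u | ∃ k, F.par^[k] u = z}

/-- A set of nodes that contains the ancestors of its members. -/
def AncClosed (A : Set α) : Prop := ∀ u ∈ A, F.par u ∈ A

variable {F} {u v w z : α} {A : Set α}

theorem mem_desc_self (u : α) : u ∈ F.desc u := ⟨0, rfl⟩

theorem mem_desc_of_par (h : F.par u ∈ F.desc z) : u ∈ F.desc z := by
  obtain ⟨k, hk⟩ := h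
  exact ⟨k + 1, hk⟩

theorem mem_desc_par (u : α) : u ∈ F.desc (F.par u) := ⟨1, rfl⟩

theorem eq_or_par_mem_desc (h : u ∈ F.desc z) : u = z ∨ F.par u ∈ F.desc z := by
  obtain ⟨_ | k, hk⟩ := h
  · exact Or.inl hk
  · exact Or.inr ⟨k, hk⟩

theorem desc_trans (h : u ∈ F.desc v) (h' : v ∈ F.desc w) : u ∈ F.desc w := by
  obtain ⟨k, rfl⟩ := h
  obtain ⟨l, rfl⟩ := h'
  exact ⟨l + k, Function.iterate_add_apply _ _ _ _⟩

theorem level_iterate (F : RootedForest α) (k : ℕ) (u : α) :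
    F.level (F.par^[k] u) = F.level u - k := by
  induction k generalizing u with
  | zero => rfl
  | succ k ih =>
    rw [Function.iterate_succ_apply, ih]
    by_cases h : F.level u = 0
    · rw [F.par_eq_self h, h, Nat.zero_sub, Nat.zero_sub]
    · have := F.level_par h
      omega

theorem iterate_eq_of_level_le (F : RootedForest α) {k : ℕ} (h : F.level u ≤ k) :
    F.par^[k] u = F.par^[F.level u] u := by
  obtain ⟨l, rfl⟩ := Nat.exists_eq_add_of_le' h
  rw [Function.iterate_add_apply]
  exact Function.iterate_fixed (F.par_eq_self (by simp [level_iterate])) l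

theorem mem_desc_iff : u ∈ F.desc z ↔ F.par^[F.level u - F.level z] u = z := by
  refine ⟨?_, fun h => ⟨_, h⟩⟩
  rintro ⟨k, rfl⟩
  rw [level_iterate]
  rcases le_total k (F.level u) with h | h
  · congr 2
    omega
  · rw [F.iterate_eq_of_level_le h, Nat.sub_eq_zero_of_le h, Nat.sub_zero]

theorem level_le_of_mem_desc (h : u ∈ F.desc z) : F.level z ≤ F.level u := by
  obtain ⟨k, rfl⟩ := h
  simp [level_iterate]

theorem eq_of_mem_desc (h : u ∈ F.desc z) (hl : F.level u ≤ F.level z) : u = z := by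
  rw [mem_desc_iff, Nat.sub_eq_zero_of_le hl] at h
  exact h

theorem desc_antisymm (h : u ∈ F.desc z) (h' : z ∈ F.desc u) : u = z :=
  eq_of_mem_desc h (level_le_of_mem_desc h')

theorem par_notMem_desc (h : F.level z ≠ 0) : F.par z ∉ F.desc z := fun h' => by
  have := level_le_of_mem_desc h'
  have := F.level_par h
  omega

theorem eq_of_mem_desc_of_mem_desc (h : u ∈ F.desc z) (h' : u ∈ F.desc w)
    (e : F.level z = F.level w) : z = w := by
  rw [mem_desc_iff] at h h'
  rw [← h, ← h', e]

/-- Two ancestors of the same node are comparable. -/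
theorem mem_desc_or_mem_desc (h : u ∈ F.desc z) (h' : u ∈ F.desc w) :
    z ∈ F.desc w ∨ w ∈ F.desc z := by
  obtain ⟨k, rfl⟩ := h
  obtain ⟨l, rfl⟩ := h'
  rcases le_total k l with h | h
  · obtain ⟨m, rfl⟩ := Nat.exists_eq_add_of_le' h
    exact Or.inl ⟨m, (Function.iterate_add_apply _ _ _ _).symm⟩
  · obtain ⟨m, rfl⟩ := Nat.exists_eq_add_of_le' h
    exact Or.inr ⟨m, (Function.iterate_add_apply _ _ _ _).symm⟩

theorem AncClosed.mem (hA : F.AncClosed A) (h : u ∈ F.desc z) (hu : u ∈ A) : z ∈ A := by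
  obtain ⟨k, rfl⟩ := h
  induction k generalizing u with
  | zero => exact hu
  | succ k ih => exact ih (hA u hu)

theorem AncClosed.union {B : Set α} (hA : F.AncClosed A) (hB : F.AncClosed B) :
    F.AncClosed (A ∪ B) := fun u hu => hu.imp (hA u) (hB u)

theorem ancClosed_setOf_mem_desc (F : RootedForest α) (u : α) :
    F.AncClosed {z | u ∈ F.desc z} := fun z hz => desc_trans hz (mem_desc_par z)

/-- Induction from a node to its descendants. -/
theorem desc_induction {p : α → Prop} {z : α} (h0 : p z)
    (h : ∀ u, u ∈ F.desc z → F.level u ≠ 0 → F.par u ∈ F.desc z → p (F.par u) → p u)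
    {u : α} (hu : u ∈ F.desc z) : p u := by
  obtain ⟨k, hk⟩ := hu
  induction k generalizing u with
  | zero => exact (show u = z from hk) ▸ h0
  | succ k ih =>
    by_cases hl : F.level u = 0
    · have := F.iterate_eq_of_level_le (k := k + 1) (u := u) (by omega)
      rw [hl, hk] at this
      exact (show u = z from this.symm) ▸ h0
    · exact h u ⟨_, hk⟩ hl ⟨k, hk⟩ (ih hk)

/-- Climbing from a node to an ancestor. -/
theorem climb_induction {p : α → Prop} {z u : α} (hu : u ∈ F.desc z) (h0 : p u)
    (h : ∀ v, v ∈ F.desc z → v ≠ z → u ∈ F.desc v → p v → p (F.par v)) : p z := by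
  obtain ⟨k, hk⟩ := hu
  have key : ∀ j ≤ k, p (F.par^[j] u) ∨ p z := by
    intro j hj
    induction j with
    | zero => exact Or.inl h0
    | succ j ih =>
      rcases ih (by omega) with ih | ih
      · by_cases e : F.par^[j] u = z
        · exact Or.inr (e ▸ ih)
        · rw [Function.iterate_succ_apply']
          refine Or.inl (h _ ⟨k - j, ?_⟩ e ⟨j, rfl⟩ ih)
          rw [← Function.iterate_add_apply, Nat.sub_add_cancel (by omega), hk]
      · exact Or.inr ih
  exact (key k le_rfl).elim (fun h => hk ▸ h) id

theorem AncClosed.top_unique (hA : F.AncClosed A) {x y : α} (hx : u ∈ F.desc x) (hy : u ∈ F.desc y)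
    (hxA : x ∉ A) (hyA : y ∉ A) (hx' : F.par x ∈ A) (hy' : F.par y ∈ A) : x = y := by
  have key : ∀ {x y : α}, x ∈ F.desc y → y ∉ A → F.par x ∈ A → x = y := by
    intro x y h hy hx
    rcases eq_or_par_mem_desc h with h | h
    · exact h
    · exact absurd (hA.mem h hx) hy
  rcases mem_desc_or_mem_desc hx hy with h | h
  · exact key h hyA hx'
  · exact (key h hxA hy').symm

end RootedForest

/-- A triangulated closed surface (possibly disconnected), given by its vertices `U`, its
triangles `Δ` and the sides `S` of its triangles; `mate` maps a side to the side to which it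
is glued. -/
structure TriComplex (U Δ S : Type*) where
  tri : S → Δ
  mate : S → S
  fst : S → U
  snd : S → U
  mate_mate : ∀ s, mate (mate s) = s
  mate_ne : ∀ s, mate s ≠ s
  fst_mate : ∀ s, fst (mate s) = fst s
  snd_mate : ∀ s, snd (mate s) = snd s
  exists_sides : ∀ t, ∃ s₁ s₂ s₃ x y z, s₁ ≠ s₂ ∧ s₁ ≠ s₃ ∧ s₂ ≠ s₃ ∧
    (∀ s, tri s = t ↔ s = s₁ ∨ s = s₂ ∨ s = s₃) ∧
    s(fst s₁, snd s₁) = s(x, y) ∧ s(fst s₂, snd s₂) = s(y, z) ∧ s(fst s₃, snd s₃) = s(x, z)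
  link : ∀ (u : U) (Q : Set Δ),
    (∀ s, (fst s = u ∨ snd s = u) → tri s ∈ Q → tri (mate s) ∈ Q) →
    ∀ s s', (fst s = u ∨ snd s = u) → (fst s' = u ∨ snd s' = u) → tri s ∈ Q → tri s' ∈ Q

namespace TriComplex

variable {U Δ S : Type*} (K : TriComplex U Δ S)

/-- Incidence of a vertex and a side. -/
def Inc (u : U) (s : S) : Prop := K.fst s = u ∨ K.snd s = u

/-- A side crosses a set of vertices if exactly one of its ends is in the set. -/
def Cross (W : Set U) (s : S) : Prop := ¬ (K.fst s ∈ W ↔ K.snd s ∈ W)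

/-- A side leaves a set of triangles if its triangle belongs to the set and the triangle of its
mate does not. -/
def Leaves (Q : Set Δ) (s : S) : Prop := K.tri s ∈ Q ∧ K.tri (K.mate s) ∉ Q

variable {K}

theorem inc_mate {u : U} {s : S} : K.Inc u (K.mate s) ↔ K.Inc u s := by
  simp [Inc, K.fst_mate, K.snd_mate]

theorem cross_mate {W : Set U} {s : S} : K.Cross W (K.mate s) ↔ K.Cross W s := by
  simp [Cross, K.fst_mate, K.snd_mate]

open Classical in
theorem card_cross_tri [Fintype S] (W : Set U) (t : Δ) :
    (Finset.univ.filter fun s => K.tri s = t ∧ K.Cross W s).card = 0 ∨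
    (Finset.univ.filter fun s => K.tri s = t ∧ K.Cross W s).card = 2 := by
  obtain ⟨s₁, s₂, s₃, x, y, z, h12, h13, h23, ht, e1, e2, e3⟩ := K.exists_sides t
  have e : (Finset.univ.filter fun s => K.tri s = t ∧ K.Cross W s) =
      ({s₁, s₂, s₃} : Finset S).filter fun s => K.Cross W s := by
    ext s
    simp [ht]
  have key : ∀ {s : S} {a b : U}, s(K.fst s, K.snd s) = s(a, b) →
      (K.Cross W s ↔ ¬ (a ∈ W ↔ b ∈ W)) := by
    intro s a b h
    rw [Sym2.eq_iff] at h
    rcases h with ⟨rfl, rfl⟩ | ⟨rfl, rfl⟩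
    · rfl
    · unfold Cross
      tauto
  rw [e, Finset.filter_insert, Finset.filter_insert, Finset.filter_singleton]
  simp only [key e1, key e2, key e3]
  by_cases hx : x ∈ W <;> by_cases hy : y ∈ W <;> by_cases hz : z ∈ W <;>
    simp [hx, hy, hz, h12, h13, h23]

open Classical in
theorem even_card_leaves_cross [Fintype S] (W : Set U) (Q : Set Δ) :
    Even (Finset.univ.filter fun s => K.Leaves Q s ∧ K.Cross W s).card := by
  have h1 : Even (Finset.univ.filter fun s => K.tri s ∈ Q ∧ K.Cross W s).card := by
    rw [Finset.card_eq_sum_card_image K.tri]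
    refine Finset.even_sum _ fun t ht => ?_
    have hQ : t ∈ Q := by
      obtain ⟨s, hs, rfl⟩ := Finset.mem_image.1 ht
      exact (Finset.mem_filter.1 hs).2.1
    have : (Finset.univ.filter fun s => K.tri s ∈ Q ∧ K.Cross W s).filter (fun s => K.tri s = t) =
        Finset.univ.filter fun s => K.tri s = t ∧ K.Cross W s := by
      ext s
      simp only [Finset.mem_filter, Finset.mem_univ, true_and]
      constructor
      · tauto
      · rintro ⟨rfl, h⟩
        exact ⟨⟨hQ, h⟩, rfl⟩
    rw [this]
    rcases K.card_cross_tri W t with h | h <;> simp [h]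
  have h2 : Even (Finset.univ.filter fun s =>
      (K.tri s ∈ Q ∧ K.tri (K.mate s) ∈ Q) ∧ K.Cross W s).card := by
    rw [← ZMod.natCast_eq_zero_iff_even, Finset.cast_card]
    refine Finset.sum_involution (fun s _ => K.mate s) (fun _ _ => by decide)
      (fun s _ _ => K.mate_ne s) (fun s hs => ?_) fun s _ => K.mate_mate s
    simp only [Finset.mem_filter, Finset.mem_univ, true_and, cross_mate, K.mate_mate] at hs ⊢
    exact ⟨hs.1.symm, hs.2⟩
  have h3 : (Finset.univ.filter fun s => K.tri s ∈ Q ∧ K.Cross W s).card =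
      (Finset.univ.filter fun s => K.Leaves Q s ∧ K.Cross W s).card +
      (Finset.univ.filter fun s =>
      (K.tri s ∈ Q ∧ K.tri (K.mate s) ∈ Q) ∧ K.Cross W s).card := by
    rw [← Finset.card_union_of_disjoint]
    · congr 1
      ext s
      simp only [Finset.mem_filter, Finset.mem_union, Finset.mem_univ, true_and]
      unfold Leaves
      by_cases h : K.tri (K.mate s) ∈ Q <;> simp [h]
    · rw [Finset.disjoint_filter]
      unfold Leaves
      tauto
  rw [h3, Nat.even_add] at h1
  exact h1.2 h2

end TriComplex

variable {U Δ S : Type*}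

/-- A rooted spanning forest of the vertices of a triangulated surface, in which the depths of
the ends of every side differ by at most one, together with a rooted forest of the triangles
joined across sides that are not in the first forest. -/
structure TreeCotree (K : TriComplex U Δ S) where
  primal : RootedForest U
  dual : RootedForest Δ
  treeSide : U → S
  dualSide : Δ → S
  ends_treeSide : ∀ {u}, primal.level u ≠ 0 →
    s(K.fst (treeSide u), K.snd (treeSide u)) = s(u, primal.par u)
  level_fst_le : ∀ s, primal.level (K.fst s) ≤ primal.level (K.snd s) + 1
  level_snd_le : ∀ s, primal.level (K.snd s) ≤ primal.level (K.fst s) + 1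
  tri_dualSide : ∀ {t}, dual.level t ≠ 0 → K.tri (dualSide t) = t
  tri_mate_dualSide : ∀ {t}, dual.level t ≠ 0 → K.tri (K.mate (dualSide t)) = dual.par t
  disjoint : ∀ {u t}, primal.level u ≠ 0 → dual.level t ≠ 0 →
    dualSide t ≠ treeSide u ∧ dualSide t ≠ K.mate (treeSide u)

namespace TreeCotree

variable {K : TriComplex U Δ S} (T : TreeCotree K)

/-- The sides of the edges of the primal forest. -/
def IsTreeSide (s : S) : Prop :=
  ∃ u, T.primal.level u ≠ 0 ∧ (s = T.treeSide u ∨ s = K.mate (T.treeSide u))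

/-- The sides crossed by the edges of the dual forest. -/
def IsDualSide (s : S) : Prop :=
  ∃ t, T.dual.level t ≠ 0 ∧ (s = T.dualSide t ∨ s = K.mate (T.dualSide t))

/-- A set of vertices that contains the roots of the primal forest, the ancestors of its
elements, and the ends of the sides in neither forest. -/
structure IsHub (A : Set U) : Prop where
  ancClosed : T.primal.AncClosed A
  root_mem : ∀ u, T.primal.level u = 0 → u ∈ A
  mem_of_inc : ∀ s, ¬ T.IsTreeSide s → ¬ T.IsDualSide s → ∀ u, K.Inc u s → u ∈ A

variable {T} {A : Set U} {Q : Set Δ} {s s' s₀ : S} {u v z : U} {t c : Δ}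

theorem IsTreeSide.mate (h : T.IsTreeSide s) : T.IsTreeSide (K.mate s) := by
  obtain ⟨u, hu, rfl | rfl⟩ := h
  · exact ⟨u, hu, Or.inr rfl⟩
  · exact ⟨u, hu, Or.inl (K.mate_mate _)⟩

theorem IsDualSide.mate (h : T.IsDualSide s) : T.IsDualSide (K.mate s) := by
  obtain ⟨u, hu, rfl | rfl⟩ := h
  · exact ⟨u, hu, Or.inr rfl⟩
  · exact ⟨u, hu, Or.inl (K.mate_mate _)⟩

theorem IsDualSide.not_isTreeSide (h : T.IsDualSide s) : ¬ T.IsTreeSide s := by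
  rintro ⟨u, hu, e⟩
  obtain ⟨t, ht, e'⟩ := h
  obtain ⟨h1, h2⟩ := T.disjoint hu ht
  rcases e with rfl | rfl <;> rcases e' with e' | e'
  · exact h1 e'.symm
  · exact h2 (by rw [e', K.mate_mate])
  · exact h2 e'.symm
  · exact h1 (by rw [← K.mate_mate (T.treeSide u), e', K.mate_mate])

theorem inc_treeSide (h : T.primal.level u ≠ 0) :
    K.Inc v (T.treeSide u) ↔ v = u ∨ v = T.primal.par u := by
  have := T.ends_treeSide h
  rw [Sym2.eq_iff] at this
  rcases this with ⟨h1, h2⟩ | ⟨h1, h2⟩ <;> (simp only [TriComplex.Inc, h1, h2]; tauto)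

theorem cross_treeSide {W : Set U} (h : T.primal.level u ≠ 0) :
    K.Cross W (T.treeSide u) ↔ ¬ (u ∈ W ↔ T.primal.par u ∈ W) := by
  have := T.ends_treeSide h
  rw [Sym2.eq_iff] at this
  rcases this with ⟨h1, h2⟩ | ⟨h1, h2⟩
  · simp only [TriComplex.Cross, h1, h2]
  · simp only [TriComplex.Cross, h1, h2]
    tauto

theorem cross_desc_treeSide (h : T.primal.level z ≠ 0) :
    K.Cross (T.primal.desc z) (T.treeSide z) := by
  rw [cross_treeSide h]
  exact fun h' => RootedForest.par_notMem_desc h (h'.1 (RootedForest.mem_desc_self z))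

theorem eq_of_cross_desc_treeSide (h : T.primal.level u ≠ 0)
    (hc : K.Cross (T.primal.desc z) (T.treeSide u)) : u = z := by
  rw [cross_treeSide h] at hc
  by_contra hne
  exact hc ⟨fun h => (RootedForest.eq_or_par_mem_desc h).resolve_left hne,
    RootedForest.mem_desc_of_par⟩

theorem IsTreeSide.eq_of_cross_desc (h : T.IsTreeSide s) (hc : K.Cross (T.primal.desc z) s) :
    s = T.treeSide z ∨ s = K.mate (T.treeSide z) := by
  obtain ⟨u, hu, rfl | rfl⟩ := h
  · rw [eq_of_cross_desc_treeSide hu hc]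
    exact Or.inl rfl
  · rw [TriComplex.cross_mate] at hc
    rw [eq_of_cross_desc_treeSide hu hc]
    exact Or.inr rfl

theorem IsDualSide.eq_of_leaves_desc (h : T.IsDualSide s) (hl : K.Leaves (T.dual.desc c) s) :
    s = T.dualSide c ∧ T.dual.level c ≠ 0 := by
  obtain ⟨t, ht, rfl | rfl⟩ := h
  · rw [TriComplex.Leaves, T.tri_dualSide ht, T.tri_mate_dualSide ht] at hl
    obtain rfl := (RootedForest.eq_or_par_mem_desc hl.1).resolve_right hl.2
    exact ⟨rfl, ht⟩
  · rw [TriComplex.Leaves, K.mate_mate, T.tri_dualSide ht, T.tri_mate_dualSide ht] at hl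
    exact absurd (RootedForest.mem_desc_of_par hl.1) hl.2

theorem IsHub.notMem_of_mem_desc (hA : T.IsHub A) (hz : z ∉ A) (h : u ∈ T.primal.desc z) :
    u ∉ A := fun hu => hz (hA.ancClosed.mem h hu)

theorem IsHub.level_ne_zero (hA : T.IsHub A) (hz : z ∉ A) : T.primal.level z ≠ 0 :=
  fun h => hz (hA.root_mem z h)

theorem IsHub.eq_of_leaves_cross (hA : T.IsHub A)
    (hQ : ∀ s, T.IsDualSide s → K.Leaves Q s → s ≠ s₀ → ∀ u, K.Inc u s → u ∈ A)
    (hz : z ∉ A) (hl : K.Leaves Q s) (hc : K.Cross (T.primal.desc z) s) (hs : s ≠ s₀) :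
    s = T.treeSide z ∨ s = K.mate (T.treeSide z) := by
  by_cases h : T.IsTreeSide s
  · exact h.eq_of_cross_desc hc
  · have key : ∀ u, K.Inc u s → u ∈ A := by
      by_cases h' : T.IsDualSide s
      · exact hQ s h' hl hs
      · exact hA.mem_of_inc s h h'
    have h1 : K.fst s ∉ T.primal.desc z := fun h' =>
      hA.notMem_of_mem_desc hz h' (key _ (Or.inl rfl))
    have h2 : K.snd s ∉ T.primal.desc z := fun h' =>
      hA.notMem_of_mem_desc hz h' (key _ (Or.inr rfl))
    exact absurd (iff_of_false h1 h2) hc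

theorem IsHub.treeSide_iff [Finite S] (hA : T.IsHub A)
    (hQ : ∀ s, T.IsDualSide s → K.Leaves Q s → ∀ u, K.Inc u s → u ∈ A) (hz : z ∉ A) :
    K.tri (T.treeSide z) ∈ Q ↔ K.tri (K.mate (T.treeSide z)) ∈ Q := by
  classical
  have := Fintype.ofFinite S
  by_contra hcon
  have hc := cross_desc_treeSide (hA.level_ne_zero hz)
  have key : ∀ s, K.Leaves Q s → K.Cross (T.primal.desc z) s →
      s = T.treeSide z ∨ s = K.mate (T.treeSide z) := by
    intro s hl hc
    by_cases h : s = K.mate (T.treeSide z)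
    · exact Or.inr h
    · exact hA.eq_of_leaves_cross (s₀ := K.mate (T.treeSide z))
        (fun s hs hl _ => hQ s hs hl) hz hl hc h
  have heven := K.even_card_leaves_cross (T.primal.desc z) Q
  obtain ⟨s₁, h1⟩ : ∃ s₁, (Finset.univ.filter fun s => K.Leaves Q s ∧
      K.Cross (T.primal.desc z) s) = {s₁} := by
    by_cases h : K.tri (T.treeSide z) ∈ Q
    · have h' : K.tri (K.mate (T.treeSide z)) ∉ Q := fun h' => hcon (iff_of_true h h')
      refine ⟨T.treeSide z, ?_⟩
      ext s
      simp only [Finset.mem_filter, Finset.mem_univ, true_and, Finset.mem_singleton]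
      refine ⟨fun ⟨hl, hc⟩ => (key s hl hc).resolve_right ?_, ?_⟩
      · rintro rfl
        exact h' hl.1
      · rintro rfl
        exact ⟨⟨h, h'⟩, hc⟩
    · have h' : K.tri (K.mate (T.treeSide z)) ∈ Q := by
        by_contra h'
        exact hcon (iff_of_false h h')
      refine ⟨K.mate (T.treeSide z), ?_⟩
      ext s
      simp only [Finset.mem_filter, Finset.mem_univ, true_and, Finset.mem_singleton]
      refine ⟨fun ⟨hl, hc⟩ => (key s hl hc).resolve_left ?_, ?_⟩
      · rintro rfl
        exact h hl.1
      · rintro rfl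
        exact ⟨⟨h', by rwa [K.mate_mate]⟩, TriComplex.cross_mate.2 hc⟩
  rw [h1, Finset.card_singleton] at heven
  exact absurd heven (by decide)

theorem IsHub.not_both_treeSide [Finite S] (hA : T.IsHub A)
    (hQ : ∀ s, T.IsDualSide s → K.Leaves Q s → s ≠ s₀ → ∀ u, K.Inc u s → u ∈ A)
    (hs₀ : T.IsDualSide s₀) (hl₀ : K.Leaves Q s₀) (hz : z ∉ A)
    (hc₀ : K.Cross (T.primal.desc z) s₀) :
    ¬ (K.tri (T.treeSide z) ∈ Q ∧ K.tri (K.mate (T.treeSide z)) ∈ Q) := by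
  classical
  have := Fintype.ofFinite S
  rintro ⟨h1, h2⟩
  have heven := K.even_card_leaves_cross (T.primal.desc z) Q
  have : (Finset.univ.filter fun s => K.Leaves Q s ∧ K.Cross (T.primal.desc z) s) = {s₀} := by
    ext s
    simp only [Finset.mem_filter, Finset.mem_univ, true_and, Finset.mem_singleton]
    refine ⟨fun ⟨hl, hc⟩ => ?_, ?_⟩
    · by_contra hs
      rcases hA.eq_of_leaves_cross hQ hz hl hc hs with rfl | rfl
      · exact hl.2 h2
      · exact hl.2 (by rwa [K.mate_mate])
    · rintro rfl
      exact ⟨hl₀, hc₀⟩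
  rw [this, Finset.card_singleton] at heven
  exact absurd heven (by decide)

theorem IsHub.tri_mem_iff [Finite S] (hA : T.IsHub A)
    (hQ : ∀ s, T.IsDualSide s → K.Leaves Q s → ∀ u, K.Inc u s → u ∈ A) (hz : z ∉ A)
    (h : K.Inc z s) (h' : K.Inc z s') : K.tri s ∈ Q ↔ K.tri s' ∈ Q := by
  have key : ∀ s, K.Inc z s → K.tri s ∈ Q → K.tri (K.mate s) ∈ Q := by
    intro s hs h
    by_cases hT : T.IsTreeSide s
    · obtain ⟨u, hu, hsu⟩ := hT
      have hi : K.Inc z (T.treeSide u) := by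
        rcases hsu with rfl | rfl
        · exact hs
        · exact TriComplex.inc_mate.1 hs
      have huA : u ∉ A := by
        rcases (inc_treeSide hu).1 hi with rfl | rfl
        · exact hz
        · exact fun h => hz (hA.ancClosed u h)
      have := hA.treeSide_iff hQ huA
      rcases hsu with rfl | rfl
      · exact this.1 h
      · rw [K.mate_mate]
        exact this.2 h
    · by_contra h'
      by_cases hD : T.IsDualSide s
      · exact hz (hQ s hD ⟨h, h'⟩ z hs)
      · exact hz (hA.mem_of_inc s hT hD z hs)
  exact ⟨K.link z Q key s s' h h', K.link z Q key s' s h' h⟩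

/-- If the sides leaving `Q` end in the hub, then the triangles around a vertex outside the hub
and those around any descendant of it are either all in `Q` or all outside `Q`. -/
theorem IsHub.tri_mem_iff_of_mem_desc [Finite S] (hA : T.IsHub A)
    (hQ : ∀ s, T.IsDualSide s → K.Leaves Q s → ∀ u, K.Inc u s → u ∈ A) (hz : z ∉ A)
    (hu : u ∈ T.primal.desc z) (h : K.Inc u s) (h' : K.Inc z s') :
    K.tri s ∈ Q ↔ K.tri s' ∈ Q := by
  refine RootedForest.desc_induction (F := T.primal)
    (p := fun u => ∀ s, K.Inc u s → (K.tri s ∈ Q ↔ K.tri s' ∈ Q)) ?_ ?_ hu s h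
  · exact fun s hs => hA.tri_mem_iff hQ hz hs h'
  · intro u hu hl _ ih s hs
    rw [hA.tri_mem_iff hQ (hA.notMem_of_mem_desc hz hu) hs ((inc_treeSide hl).2 (Or.inl rfl))]
    exact ih _ ((inc_treeSide hl).2 (Or.inr rfl))

end TreeCotree

theorem TriComplex.mem_iff_of_not_cross {K : TriComplex U Δ S} {W : Set U} {t : Δ}
    (h : ∀ s, K.tri s = t → ¬ K.Cross W s) {s s' : S} {u u' : U} (hs : K.tri s = t)
    (hs' : K.tri s' = t) (hu : K.Inc u s) (hu' : K.Inc u' s') : u ∈ W ↔ u' ∈ W := by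
  obtain ⟨s₁, s₂, s₃, x, y, z, -, -, -, ht, e1, e2, e3⟩ := K.exists_sides t
  have key : ∀ {s : S} {a b : U}, s(K.fst s, K.snd s) = s(a, b) →
      (K.Cross W s ↔ ¬ (a ∈ W ↔ b ∈ W)) ∧ ∀ u, K.Inc u s → u = a ∨ u = b := by
    intro s a b h
    rw [Sym2.eq_iff] at h
    unfold Cross Inc
    rcases h with ⟨rfl, rfl⟩ | ⟨rfl, rfl⟩
    · refine ⟨Iff.rfl, ?_⟩
      rintro u (rfl | rfl)
      exacts [Or.inl rfl, Or.inr rfl]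
    · refine ⟨by tauto, ?_⟩
      rintro u (rfl | rfl)
      exacts [Or.inr rfl, Or.inl rfl]
  have hxy := not_not.1 (mt (key e1).1.2 (h s₁ ((ht _).2 (by simp))))
  have hyz := not_not.1 (mt (key e2).1.2 (h s₂ ((ht _).2 (by simp))))
  have hall : ∀ s u, K.tri s = t → K.Inc u s → (u ∈ W ↔ y ∈ W) := by
    intro s u hs hu
    rcases (ht s).1 hs with rfl | rfl | rfl
    · rcases (key e1).2 u hu with rfl | rfl <;> tauto
    · rcases (key e2).2 u hu with rfl | rfl <;> tauto
    · rcases (key e3).2 u hu with rfl | rfl <;> tauto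
  rw [hall s u hs hu, hall s' u' hs' hu']

namespace TreeCotree

variable {K : TriComplex U Δ S} (T : TreeCotree K)

/-- A set of triangles that induces a subtree of the dual forest. -/
structure IsSubtree (R : Set Δ) (r : Δ) : Prop where
  top_mem : r ∈ R
  subset_desc : R ⊆ T.dual.desc r
  par_mem : ∀ t ∈ R, t ≠ r → T.dual.par t ∈ R

/-- The sides on the boundary of a region whose ends are in different parts. -/
def ends (part : U → ℕ) (R : Set Δ) : Set S :=
  {s | K.tri s ∈ R ∧ part (K.fst s) ≠ part (K.snd s) ∧
    ¬ (T.IsDualSide s ∧ K.tri (K.mate s) ∈ R)}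

variable {T} {R : Set Δ} {r : Δ} {part : U → ℕ}

theorem IsSubtree.exists_cross (hR : T.IsSubtree R r) {W : Set U} {s s' : S} {u u' : U}
    (hs : K.tri s ∈ R) (hs' : K.tri s' ∈ R) (hu : K.Inc u s) (hu' : K.Inc u' s') (huW : u ∈ W)
    (huW' : u' ∉ W) : ∃ s, K.tri s ∈ R ∧ K.Cross W s := by
  by_contra! hcon
  obtain ⟨s₀, _, _, _, _, _, _, _, _, hs₀, _⟩ := K.exists_sides r
  have hs₀ := (hs₀ s₀).2 (Or.inl rfl)
  have key : ∀ t ∈ R, ∀ s u, K.tri s = t → K.Inc u s → (u ∈ W ↔ K.fst s₀ ∈ W) := by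
    intro t ht
    have hbase : ∀ s u, K.tri s = r → K.Inc u s → (u ∈ W ↔ K.fst s₀ ∈ W) := fun s u hs hu =>
      TriComplex.mem_iff_of_not_cross (fun s h => hcon s (h ▸ hR.top_mem)) hs hs₀ hu (Or.inl rfl)
    refine RootedForest.desc_induction (F := T.dual) (z := r)
      (p := fun t => t ∈ R → ∀ s u, K.tri s = t → K.Inc u s → (u ∈ W ↔ K.fst s₀ ∈ W))
      (fun _ => hbase) ?_ (hR.subset_desc ht) ht
    intro t _ hl _ ih ht s u hs hu
    by_cases e : t = r
    · exact hbase s u (hs.trans e) hu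
    · rw [← ih (hR.par_mem t ht e) (K.mate (T.dualSide t)) (K.fst (T.dualSide t))
        (T.tri_mate_dualSide hl) (TriComplex.inc_mate.2 (Or.inl rfl))]
      exact TriComplex.mem_iff_of_not_cross (fun s h => hcon s (h ▸ ht)) hs (T.tri_dualSide hl) hu
        (Or.inl rfl)
  exact huW' ((key _ hs' s' u' rfl hu').2 ((key _ hs s u rfl hu).1 huW))

open Classical in
theorem two_le_card_leaves_cross [Fintype S] [Fintype Δ] {W : Set U}
    (h : ∃ s, K.tri s ∈ R ∧ K.Cross W s) :
    2 ≤ (Finset.univ.filter fun s => K.tri s ∈ R ∧ K.Cross W s ∧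
      ¬ (T.IsDualSide s ∧ K.tri (K.mate s) ∈ R)).card := by
  set N : Finset Δ := Finset.univ.filter fun t => t ∈ R ∧ ∃ s, K.tri s = t ∧ K.Cross W s with hN
  have hNne : N.Nonempty := by
    obtain ⟨s, h1, h2⟩ := h
    exact ⟨K.tri s, by simp [hN, h1]; exact ⟨s, rfl, h2⟩⟩
  obtain ⟨m, hm, hmin⟩ := N.exists_min_image T.dual.level hNne
  set C : Finset S := Finset.univ.filter fun s => K.tri s ∈ R ∧ K.Cross W s with hC
  have hCcard : C.card = 2 * N.card := by
    rw [Finset.card_eq_sum_card_fiberwise (f := K.tri) (t := N)]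
    · rw [Finset.sum_const_nat (m := 2), mul_comm]
      intro t ht
      obtain ⟨htR, s, hs, hc⟩ := (Finset.mem_filter.1 ht).2
      have e : C.filter (fun s => K.tri s = t) =
          Finset.univ.filter fun s => K.tri s = t ∧ K.Cross W s := by
        ext s
        simp only [hC, Finset.mem_filter, Finset.mem_univ, true_and]
        constructor
        · tauto
        · rintro ⟨rfl, h⟩
          exact ⟨⟨htR, h⟩, rfl⟩
      rw [e]
      refine (K.card_cross_tri W t).resolve_left fun h0 => ?_
      rw [Finset.card_eq_zero] at h0
      exact Finset.notMem_empty s (h0 ▸ Finset.mem_filter.2 ⟨Finset.mem_univ _, hs, hc⟩)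
    · intro s hs
      obtain ⟨h1, h2⟩ := (Finset.mem_filter.1 (Finset.mem_coe.1 hs)).2
      exact Finset.mem_coe.2 (Finset.mem_filter.2 ⟨Finset.mem_univ _, h1, s, rfl, h2⟩)
  have hI : (C.filter fun s => T.IsDualSide s ∧ K.tri (K.mate s) ∈ R).card ≤
      2 * (N.card - 1) := by
    have hsub : (C.filter fun s => T.IsDualSide s ∧ K.tri (K.mate s) ∈ R) ⊆
        (N.erase m).image T.dualSide ∪ (N.erase m).image fun t => K.mate (T.dualSide t) := by
      intro s hs
      simp only [hC, Finset.mem_filter, Finset.mem_univ, true_and] at hs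
      obtain ⟨⟨h1, h2⟩, ⟨t, ht, hst⟩, h3⟩ := hs
      have key : ∀ s, s = T.dualSide t → K.tri s ∈ R → K.tri (K.mate s) ∈ R → K.Cross W s →
          t ∈ N.erase m := by
        rintro s rfl h1 h3 h2
        rw [T.tri_dualSide ht] at h1
        refine Finset.mem_erase.2 ⟨?_, Finset.mem_filter.2
          ⟨Finset.mem_univ _, h1, _, T.tri_dualSide ht, h2⟩⟩
        rintro rfl
        have := hmin (T.dual.par t) (Finset.mem_filter.2 ⟨Finset.mem_univ _,
          by rwa [← T.tri_mate_dualSide ht], _, T.tri_mate_dualSide ht,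
          TriComplex.cross_mate.2 h2⟩)
        have := T.dual.level_par ht
        omega
      rw [Finset.mem_union, Finset.mem_image, Finset.mem_image]
      rcases hst with rfl | rfl
      · exact Or.inl ⟨t, key _ rfl h1 h3 h2, rfl⟩
      · rw [K.mate_mate] at h3
        exact Or.inr ⟨t, key _ rfl h3 h1 (TriComplex.cross_mate.1 h2), rfl⟩
    refine (Finset.card_le_card hsub).trans ((Finset.card_union_le _ _).trans ?_)
    have := (Finset.card_image_le (s := N.erase m) (f := T.dualSide))
    have := (Finset.card_image_le (s := N.erase m) (f := fun t => K.mate (T.dualSide t)))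
    rw [Finset.card_erase_of_mem hm] at *
    omega
  have hsum := Finset.card_filter_add_card_filter_not (s := C)
    (fun s => T.IsDualSide s ∧ K.tri (K.mate s) ∈ R)
  have e : (C.filter fun s => ¬ (T.IsDualSide s ∧ K.tri (K.mate s) ∈ R)) =
      Finset.univ.filter fun s => K.tri s ∈ R ∧ K.Cross W s ∧
      ¬ (T.IsDualSide s ∧ K.tri (K.mate s) ∈ R) := by
    rw [hC, Finset.filter_filter]
    simp only [and_assoc]
  rw [e] at hsum
  have := hNne.card_pos
  omega

/-- The parts that occur at the vertices of a set of triangles. -/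
def labels (K : TriComplex U Δ S) (part : U → ℕ) (R : Set Δ) : Set ℕ :=
  {c | ∃ s u, K.tri s ∈ R ∧ K.Inc u s ∧ part u = c}

theorem finite_labels [Finite S] : (labels K part R).Finite := by
  refine ((Set.finite_range fun s => part (K.fst s)).union
    (Set.finite_range fun s => part (K.snd s))).subset ?_
  rintro c ⟨s, u, -, rfl | rfl, rfl⟩
  · exact Or.inl ⟨s, rfl⟩
  · exact Or.inr ⟨s, rfl⟩

theorem IsSubtree.ncard_labels_le [Finite S] [Finite Δ] (hR : T.IsSubtree R r) {k : ℕ}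
    (hk : 1 ≤ k) (h : (T.ends part R).ncard ≤ k) : (labels K part R).ncard ≤ k := by
  classical
  have := Fintype.ofFinite S
  have := Fintype.ofFinite Δ
  have hfin : (labels K part R).Finite := finite_labels
  by_cases hsub : (labels K part R).Subsingleton
  · exact ((Set.ncard_le_one hfin).2 fun _ ha _ hb => hsub ha hb).trans hk
  rw [Set.not_subsingleton_iff] at hsub
  rw [Set.ncard_eq_toFinset_card _ hfin]
  rw [Set.ncard_eq_toFinset_card _ (Set.toFinite _)] at h
  have := Finset.card_mul_le_card_mul (fun (c : ℕ) (s : S) => K.Cross (part ⁻¹' {c}) s)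
    (s := hfin.toFinset) (t := (Set.toFinite (T.ends part R)).toFinset) (m := 2) (n := 2)
    ?_ ?_
  · omega
  · intro c hc
    rw [Set.Finite.mem_toFinset] at hc
    obtain ⟨c', hc', hne⟩ := hsub.exists_ne c
    obtain ⟨s, u, hs, hu, rfl⟩ := hc
    obtain ⟨s', u', hs', hu', rfl⟩ := hc'
    refine (two_le_card_leaves_cross (T := T) (hR.exists_cross (W := part ⁻¹' {part u})
      hs hs' hu hu' rfl hne)).trans (Finset.card_le_card ?_)
    intro s hs
    simp only [Finset.mem_filter, Finset.mem_univ, true_and] at hs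
    rw [Finset.mem_bipartiteAbove, Set.Finite.mem_toFinset]
    refine ⟨⟨hs.1, fun e => hs.2.1 ?_, hs.2.2⟩, hs.2.1⟩
    rw [Set.mem_preimage, Set.mem_preimage, e]
  · intro s _
    refine (Finset.card_le_card (t := {part (K.fst s), part (K.snd s)}) ?_).trans
      Finset.card_le_two
    intro c hc
    have := ((Finset.mem_bipartiteBelow _).1 hc).2
    rw [Finset.mem_insert, Finset.mem_singleton]
    by_contra! hcon
    exact this (iff_of_false (fun h => hcon.1 h.symm) fun h => hcon.2 h.symm)

end TreeCotree

theorem RootedForest.exists_child {α : Type*} {F : RootedForest α} {u z : α}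
    (h : u ∈ F.desc z) (hne : u ≠ z) : ∃ c, F.level c ≠ 0 ∧ F.par c = z ∧ u ∈ F.desc c := by
  refine (desc_induction (F := F)
    (p := fun u => u = z ∨ ∃ c, F.level c ≠ 0 ∧ F.par c = z ∧ u ∈ F.desc c)
    (Or.inl rfl) ?_ h).resolve_left hne
  rintro u - hl - (h | ⟨c, h1, h2, h3⟩)
  · exact Or.inr ⟨u, hl, h, mem_desc_self u⟩
  · exact Or.inr ⟨c, h1, h2, mem_desc_of_par h3⟩

/-- The graph obtained by joining the vertex `n` to all vertices in `P`. -/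
def joinVertex (H : SimpleGraph ℕ) (n : ℕ) (P : Set ℕ) : SimpleGraph ℕ :=
  H ⊔ SimpleGraph.fromRel fun a b => a = n ∧ b ∈ P

theorem joinVertex_adj {H : SimpleGraph ℕ} {n : ℕ} {P : Set ℕ} {a b : ℕ} :
    (joinVertex H n P).Adj a b ↔ H.Adj a b ∨ a ≠ b ∧ (a = n ∧ b ∈ P ∨ b = n ∧ a ∈ P) := by
  simp [joinVertex]

theorem LazyAdj.joinVertex {H : SimpleGraph ℕ} {n : ℕ} {P : Set ℕ} {a b : ℕ}
    (h : LazyAdj H a b) : LazyAdj (joinVertex H n P) a b :=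
  h.imp id fun h => joinVertex_adj.2 (Or.inl h)

theorem LazyAdj.symm {V : Type*} {H : SimpleGraph V} {a b : V} (h : LazyAdj H a b) :
    LazyAdj H b a := h.imp Eq.symm SimpleGraph.Adj.symm

theorem lazyAdj_joinVertex {H : SimpleGraph ℕ} {n : ℕ} {P : Set ℕ} {a : ℕ} (h : a ∈ P) :
    LazyAdj (joinVertex H n P) n a := by
  by_cases e : n = a
  · exact Or.inl e
  · exact Or.inr (joinVertex_adj.2 (Or.inr ⟨e, Or.inl ⟨rfl, h⟩⟩))

theorem HasWidth.joinVertex {H : SimpleGraph ℕ} {k n : ℕ} {P : Set ℕ} (hH : HasWidth H k)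
    (hn : ∀ a b, H.Adj a b → a < n) (hPn : ∀ a ∈ P, a < n) (hP : P.ncard ≤ k)
    (hclique : ∀ a ∈ P, ∀ b ∈ P, LazyAdj H a b) : HasWidth (joinVertex H n P) k := by
  have key : ∀ u v, u < v → ((NonrepetitiveColouring.joinVertex H n P).Adj u v ↔
      (v ≠ n ∧ H.Adj u v) ∨ (v = n ∧ u ∈ P)) := by
    intro u v huv
    rw [joinVertex_adj]
    constructor
    · rintro (h | ⟨-, ⟨rfl, h⟩ | h⟩)
      · exact Or.inl ⟨(hn _ _ h.symm).ne, h⟩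
      · have := hPn _ h
        omega
      · exact Or.inr h
    · rintro (h | h)
      · exact Or.inl h.2
      · exact Or.inr ⟨huv.ne, Or.inr h⟩
  refine ⟨fun v => ?_, fun {v u u'} hu h hu' h' => ?_⟩
  · by_cases hv : v = n
    · refine (Set.ncard_le_ncard (t := P) (fun u hu => ?_)
        ((Set.finite_lt_nat n).subset hPn)).trans hP
      exact (((key u v hu.1).1 hu.2).resolve_left fun h => h.1 hv).2
    · refine (Set.ncard_le_ncard (fun u hu => ?_)
        ((Set.finite_lt_nat v).subset fun _ h => h.1)).trans (hH.card_le v)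
      exact ⟨hu.1, (((key u v hu.1).1 hu.2).resolve_right fun h => hv h.1).2⟩
  · rw [key _ _ hu] at h
    rw [key _ _ hu'] at h'
    rcases h with h | h <;> rcases h' with h' | h'
    · exact (hH.clique hu h.2 hu' h'.2).joinVertex
    · exact absurd h'.1 h.1
    · exact absurd h.1 h'.1
    · exact (hclique _ h.2 _ h'.2).joinVertex

namespace TreeCotree

variable {K : TriComplex U Δ S} {T : TreeCotree K}

/-- The subtrees into which the node `f` splits a subtree. -/
def pieces (T : TreeCotree K) (R : Set Δ) (f : Δ) : Set (Set Δ) :=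
  {Q | Q.Nonempty ∧ (Q = R \ T.dual.desc f ∨
    ∃ c, T.dual.level c ≠ 0 ∧ T.dual.par c = f ∧ Q = R ∩ T.dual.desc c)}

variable {R Q Q' : Set Δ} {r f t c : Δ} {s s' : S}

theorem IsSubtree.mem_of_mem_desc (hR : T.IsSubtree R r) (ht : t ∈ R) (h : t ∈ T.dual.desc c)
    (hc : c ∈ T.dual.desc r) : c ∈ R := by
  refine RootedForest.climb_induction (F := T.dual) (p := fun c => c ∈ R) h ht ?_
  intro v hv hne _ hvR
  refine hR.par_mem v hvR ?_
  rintro rfl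
  exact hne (RootedForest.desc_antisymm hv hc)

theorem IsSubtree.child_mem (hR : T.IsSubtree R r) (hf : f ∈ R) (hc : T.dual.par c = f)
    (ht : t ∈ R) (h : t ∈ T.dual.desc c) : c ∈ R := by
  refine hR.mem_of_mem_desc ht h (RootedForest.mem_desc_of_par ?_)
  rw [hc]
  exact hR.subset_desc hf

theorem notMem_of_mem_pieces (hQ : Q ∈ T.pieces R f) : f ∉ Q := by
  rcases hQ with ⟨-, rfl | ⟨c, hl, rfl, rfl⟩⟩
  · exact fun h => h.2 (RootedForest.mem_desc_self f)
  · exact fun h => RootedForest.par_notMem_desc hl h.2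

theorem subset_of_mem_pieces (hQ : Q ∈ T.pieces R f) : Q ⊆ R := by
  rcases hQ with ⟨-, rfl | ⟨c, hl, rfl, rfl⟩⟩
  · exact Set.sdiff_subset
  · exact Set.inter_subset_left

theorem IsSubtree.pieces (hR : T.IsSubtree R r) (hf : f ∈ R) (hQ : Q ∈ T.pieces R f) :
    ∃ q, T.IsSubtree Q q := by
  rcases hQ with ⟨⟨t, ht⟩, rfl | ⟨c, hl, hc, rfl⟩⟩
  · refine ⟨r, ⟨hR.top_mem, fun h => ?_⟩, fun t ht => hR.subset_desc ht.1, fun t ht hne =>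
      ⟨hR.par_mem t ht.1 hne, fun h => ht.2 (RootedForest.mem_desc_of_par h)⟩⟩
    exact ht.2 (RootedForest.desc_trans (hR.subset_desc ht.1) h)
  · have hcR := hR.child_mem hf hc ht.1 ht.2
    refine ⟨c, ⟨hcR, RootedForest.mem_desc_self c⟩, Set.inter_subset_right, fun t ht hne =>
      ⟨hR.par_mem t ht.1 ?_, (RootedForest.eq_or_par_mem_desc ht.2).resolve_left hne⟩⟩
    rintro rfl
    exact hne (RootedForest.desc_antisymm ht.2 (hR.subset_desc hcR))

theorem exists_mem_pieces (ht : t ∈ R) (hne : t ≠ f) : ∃ Q ∈ T.pieces R f, t ∈ Q := by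
  by_cases h : t ∈ T.dual.desc f
  · obtain ⟨c, hl, hc, h⟩ := RootedForest.exists_child h hne
    have : t ∈ R ∩ T.dual.desc c := ⟨ht, h⟩
    exact ⟨_, ⟨⟨t, this⟩, Or.inr ⟨c, hl, hc, rfl⟩⟩, this⟩
  · have : t ∈ R \ T.dual.desc f := ⟨ht, h⟩
    exact ⟨_, ⟨⟨t, this⟩, Or.inl rfl⟩, this⟩

theorem eq_of_mem_pieces (hQ : Q ∈ T.pieces R f) (hQ' : Q' ∈ T.pieces R f) (h : t ∈ Q)
    (h' : t ∈ Q') : Q = Q' := by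
  have hd : ∀ {c}, T.dual.par c = f → t ∈ T.dual.desc c → t ∈ T.dual.desc f := by
    rintro c rfl h
    exact RootedForest.desc_trans h (RootedForest.mem_desc_par c)
  rcases hQ with ⟨-, rfl | ⟨c, hl, hc, rfl⟩⟩ <;> rcases hQ' with ⟨-, rfl | ⟨c', hl', hc', rfl⟩⟩
  · rfl
  · exact absurd (hd hc' h'.2) h.2
  · exact absurd (hd hc h.2) h'.2
  · rw [RootedForest.eq_of_mem_desc_of_mem_desc h.2 h'.2]
    have := T.dual.level_par hl
    have := T.dual.level_par hl'
    rw [hc] at *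
    rw [hc'] at *
    omega

/-- At most one side leaves a piece inside the subtree, and it leads to the removed node. -/
theorem exists_gate (hQ : Q ∈ T.pieces R f) :
    ∃ s₀, ∀ s, T.IsDualSide s → K.Leaves Q s → K.tri (K.mate s) ∈ R →
      s = s₀ ∧ K.tri (K.mate s) = f := by
  rcases hQ with ⟨-, rfl | ⟨c, hl, hc, rfl⟩⟩
  · refine ⟨K.mate (T.dualSide f), fun s hs h hR => ?_⟩
    have h' : K.Leaves (T.dual.desc f) (K.mate s) := by
      refine ⟨by_contra fun h' => h.2 ⟨hR, h'⟩, ?_⟩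
      rw [K.mate_mate]
      exact h.1.2
    obtain ⟨e, hl⟩ := hs.mate.eq_of_leaves_desc h'
    refine ⟨by rw [← e, K.mate_mate], by rw [e, T.tri_dualSide hl]⟩
  · refine ⟨T.dualSide c, fun s hs h hR => ?_⟩
    obtain ⟨rfl, -⟩ := hs.eq_of_leaves_desc (c := c) ⟨h.1.2, fun h' => h.2 ⟨hR, h'⟩⟩
    exact ⟨rfl, by rw [T.tri_mate_dualSide hl, hc]⟩

/-- A set of at most three sides can be separated by removing a node. -/
theorem IsSubtree.exists_split [Finite S] [Finite Δ] (hR : T.IsSubtree R r) {E : Set S}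
    (hE : E.ncard ≤ 3) (hER : ∀ s ∈ E, K.tri s ∈ R) :
    ∃ f ∈ R, ∀ Q ∈ T.pieces R f, (E ∩ K.tri ⁻¹' Q).ncard ≤ 1 := by
  have hfin : {f | f ∈ R ∧ (E \ K.tri ⁻¹' T.dual.desc f).ncard ≤ 1}.Finite := Set.toFinite _
  obtain ⟨f, ⟨hf, hcard⟩, hmax⟩ := Set.exists_max_image _ T.dual.level hfin
    ⟨r, hR.top_mem, by
      have : E \ K.tri ⁻¹' T.dual.desc r = ∅ :=
        Set.sdiff_eq_empty.2 fun s hs => hR.subset_desc (hER s hs)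
      rw [this, Set.ncard_empty]
      exact Nat.zero_le _⟩
  refine ⟨f, hf, fun Q hQ => ?_⟩
  rcases hQ with ⟨⟨t, ht⟩, rfl | ⟨c, hl, hc, rfl⟩⟩
  · refine (Set.ncard_le_ncard ?_ (Set.toFinite _)).trans hcard
    exact fun s hs => ⟨hs.1, hs.2.2⟩
  · by_contra! hcon
    have h1 : E.ncard = (E ∩ K.tri ⁻¹' T.dual.desc c).ncard +
        (E \ K.tri ⁻¹' T.dual.desc c).ncard := (Set.ncard_inter_add_ncard_sdiff_eq_ncard _ _).symm
    have h2 : (E ∩ K.tri ⁻¹' (R ∩ T.dual.desc c)).ncard ≤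
        (E ∩ K.tri ⁻¹' T.dual.desc c).ncard :=
      Set.ncard_le_ncard (fun s hs => ⟨hs.1, hs.2.2⟩) (Set.toFinite _)
    have := hmax c ⟨hR.child_mem hf hc ht.1 ht.2, by omega⟩
    have := T.dual.level_par hl
    rw [hc] at this
    omega

end TreeCotree

variable {C : Type*}

namespace TreeCotree

variable {K : TriComplex U Δ S}

/-- A stage in the construction of a partition into tripods. The vertices in `A` have been
assigned to their parts, and the part of any other vertex is that of its first ancestor in `A`;
the triangles in `B` have been processed, and the set `regions` partitions the other ones. -/
structure IsStage (T : TreeCotree K) (comp : U → C) (m : ℕ) (A : Set U) (part : U → ℕ) (n : ℕ)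
    (H : SimpleGraph ℕ) (B : Set Δ) (regions : Set (Set Δ)) : Prop where
  hub : T.IsHub A
  part_par : ∀ u ∉ A, part u = part (T.primal.par u)
  part_lt : ∀ u, part u < n
  lt_of_adj : ∀ a b, H.Adj a b → a < n
  width : HasWidth H 3
  lazyAdj : ∀ s, K.fst s ∈ A → K.snd s ∈ A → LazyAdj H (part (K.fst s)) (part (K.snd s))
  mem_of_inc : ∀ s u, K.tri s ∈ B → K.Inc u s → u ∈ A
  card_le : ∀ p k c, {u | u ∈ A ∧ part u = p ∧ T.primal.level u = k ∧ comp u = c}.ncard ≤ m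
  subtree : ∀ R ∈ regions, ∃ r, T.IsSubtree R r
  disj : ∀ R ∈ regions, ∀ t ∈ R, t ∉ B
  cover : ∀ t ∉ B, ∃ R ∈ regions, t ∈ R
  unique : ∀ R ∈ regions, ∀ R' ∈ regions, ∀ t ∈ R, t ∈ R' → R = R'
  closed : ∀ R ∈ regions, ∀ s, T.IsDualSide s → K.Leaves R s → K.tri (K.mate s) ∈ B
  labels : ∀ R ∈ regions, ∀ a ∈ labels K part R, ∀ b ∈ TreeCotree.labels K part R, LazyAdj H a b
  ends : ∀ R ∈ regions, (T.ends part R).ncard ≤ 3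

variable (T : TreeCotree K)

/-- The vertices outside `A` on the paths from the corners of `f` to the roots. -/
def legs (A : Set U) (f : Δ) : Set U :=
  {y | y ∉ A ∧ ∃ s v, K.tri s = f ∧ K.Inc v s ∧ v ∈ T.primal.desc y}

open Classical in
/-- The new part function: the descendants of the vertices in `L` get the label `n`. -/
noncomputable def reassign (part : U → ℕ) (n : ℕ) (L : Set U) (u : U) : ℕ :=
  if ∃ y ∈ L, u ∈ T.primal.desc y then n else part u

variable {T}
variable {A L : Set U} {part : U → ℕ} {n : ℕ} {R Q : Set Δ} {f : Δ} {u v x y : U} {s s₀ : S}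

theorem comp_fst_eq_iff {α : Type*} (hx : T.primal.level x ≠ 0)
    (hs : s = T.treeSide x ∨ s = K.mate (T.treeSide x)) (g : U → α) :
    g (K.fst s) = g (K.snd s) ↔ g x = g (T.primal.par x) := by
  have e : s(K.fst s, K.snd s) = s(x, T.primal.par x) := by
    rw [← T.ends_treeSide hx]
    rcases hs with rfl | rfl
    · rfl
    · rw [K.fst_mate, K.snd_mate]
  rw [Sym2.eq_iff] at e
  rcases e with ⟨h1, h2⟩ | ⟨h1, h2⟩ <;> rw [h1, h2]
  exact eq_comm

theorem reassign_of_mem_desc (hy : y ∈ L) (h : u ∈ T.primal.desc y) :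
    T.reassign part n L u = n := if_pos ⟨y, hy, h⟩

theorem reassign_of_mem (hu : u ∈ L) : T.reassign part n L u = n :=
  reassign_of_mem_desc hu (RootedForest.mem_desc_self u)

theorem reassign_of_notMem (h : ∀ y ∈ L, u ∉ T.primal.desc y) :
    T.reassign part n L u = part u := if_neg fun ⟨y, hy, h'⟩ => h y hy h'

theorem IsHub.reassign_legs_of_mem (hA : T.IsHub A) (hu : u ∈ A) :
    T.reassign part n (T.legs A f) u = part u :=
  reassign_of_notMem fun _ hy h => hy.1 (hA.ancClosed.mem h hu)

theorem IsHub.union_legs (hA : T.IsHub A) : T.IsHub (A ∪ T.legs A f) where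
  ancClosed := by
    rintro u (hu | ⟨hu, s, v, hs, hv, h⟩)
    · exact Or.inl (hA.ancClosed u hu)
    · by_cases h' : T.primal.par u ∈ A
      · exact Or.inl h'
      · exact Or.inr ⟨h', s, v, hs, hv, RootedForest.desc_trans h (RootedForest.mem_desc_par u)⟩
  root_mem u hu := Or.inl (hA.root_mem u hu)
  mem_of_inc s h h' u hu := Or.inl (hA.mem_of_inc s h h' u hu)

theorem mem_union_legs {v : U} (hs : K.tri s = f) (hv : K.Inc v s) : v ∈ A ∪ T.legs A f := by
  by_cases h : v ∈ A
  · exact Or.inl h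
  · exact Or.inr ⟨h, s, v, hs, hv, RootedForest.mem_desc_self v⟩

theorem ncard_legs_level_le [Finite U] (k : ℕ) :
    {u | u ∈ T.legs A f ∧ T.primal.level u = k}.ncard ≤ 3 := by
  obtain ⟨s₁, s₂, s₃, x, y, z, -, -, -, ht, e1, e2, e3⟩ := K.exists_sides f
  have hx : ∀ s v, K.tri s = f → K.Inc v s → v = x ∨ v = y ∨ v = z := by
    have key : ∀ {s : S} {a b : U}, s(K.fst s, K.snd s) = s(a, b) →
        ∀ u, K.Inc u s → u = a ∨ u = b := by
      intro s a b h
      rw [Sym2.eq_iff] at h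
      rintro u (rfl | rfl) <;> tauto
    intro s v hs hv
    rcases (ht s).1 hs with rfl | rfl | rfl
    · have := key e1 v hv
      tauto
    · have := key e2 v hv
      tauto
    · have := key e3 v hv
      tauto
  let g : U → U := fun v => T.primal.par^[T.primal.level v - k] v
  have hsub : {u | u ∈ T.legs A f ∧ T.primal.level u = k} ⊆ {g x, g y, g z} := by
    rintro u ⟨⟨-, s, v, hs, hv, h⟩, rfl⟩
    rw [RootedForest.mem_desc_iff] at h
    rcases hx s v hs hv with rfl | rfl | rfl
    · exact Or.inl h.symm
    · exact Or.inr (Or.inl h.symm)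
    · exact Or.inr (Or.inr h.symm)
  refine (Set.ncard_le_ncard hsub (Set.toFinite _)).trans ?_
  refine (Set.ncard_insert_le _ _).trans ?_
  have := Set.ncard_insert_le (g y) {g z}
  rw [Set.ncard_singleton] at this
  omega

namespace IsStage

variable {comp : U → C} {m : ℕ} {H : SimpleGraph ℕ} {B : Set Δ} {regions : Set (Set Δ)}
  {R' : Set Δ}

theorem inc_mem (h : T.IsStage comp m A part n H B regions) (hR : R ∈ regions) :
    ∀ s, T.IsDualSide s → K.Leaves R s → ∀ u, K.Inc u s → u ∈ A := fun s hs hl u hu =>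
  h.mem_of_inc (K.mate s) u (h.closed R hR s hs hl) (TriComplex.inc_mate.2 hu)

theorem mem_ends_reassign (h : T.IsStage comp m A part n H B regions) (hR : R ∈ regions)
    (hQR : Q ⊆ R) (hs : s ∈ T.ends (T.reassign part n (T.legs A f)) Q) :
    s ∈ T.ends part R ∨
    (T.IsDualSide s ∧ K.Leaves Q s ∧ K.tri (K.mate s) ∈ R) ∨
    ∃ x ∈ T.legs A f, T.primal.par x ∈ A ∧ (s = T.treeSide x ∨ s = K.mate (T.treeSide x)) := by
  obtain ⟨hsQ, hne, hinter⟩ := hs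
  by_cases hgate : T.IsDualSide s ∧ K.Leaves Q s ∧ K.tri (K.mate s) ∈ R
  · exact Or.inr (Or.inl hgate)
  have hA : ¬ T.IsTreeSide s → (K.fst s ∈ A ∧ K.snd s ∈ A) := by
    intro hT
    have : ∀ u, K.Inc u s → u ∈ A := by
      by_cases hD : T.IsDualSide s
      · have hl : K.tri (K.mate s) ∉ Q := fun h' => hinter ⟨hD, h'⟩
        have hl' : K.tri (K.mate s) ∉ R := fun h' => hgate ⟨hD, ⟨hsQ, hl⟩, h'⟩
        exact h.inc_mem hR s hD ⟨hQR hsQ, hl'⟩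
      · exact h.hub.mem_of_inc s hT hD
    exact ⟨this _ (Or.inl rfl), this _ (Or.inr rfl)⟩
  by_cases hpart : part (K.fst s) = part (K.snd s)
  · right; right
    by_cases hT : T.IsTreeSide s
    · obtain ⟨x, hx, hsx⟩ := hT
      have hne' := mt (comp_fst_eq_iff hx hsx (T.reassign part n (T.legs A f))).2 hne
      have hpart' := (comp_fst_eq_iff hx hsx part).1 hpart
      by_cases hpar : ∃ y ∈ T.legs A f, T.primal.par x ∈ T.primal.desc y
      · obtain ⟨y, hy, hd⟩ := hpar
        exact absurd ((reassign_of_mem_desc hy (RootedForest.mem_desc_of_par hd)).trans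
          (reassign_of_mem_desc hy hd).symm) hne'
      push Not at hpar
      by_cases hx' : ∃ y ∈ T.legs A f, x ∈ T.primal.desc y
      · obtain ⟨y, hy, hd⟩ := hx'
        obtain rfl := (RootedForest.eq_or_par_mem_desc hd).resolve_right (hpar y hy)
        refine ⟨x, hy, ?_, hsx⟩
        exact (h.hub.union_legs.ancClosed x (Or.inr hy)).resolve_right
          fun h' => hpar _ h' (RootedForest.mem_desc_self _)
      · push Not at hx'
        rw [reassign_of_notMem hpar, reassign_of_notMem hx'] at hne'
        exact absurd hpart' hne'
    · rw [h.hub.reassign_legs_of_mem (hA hT).1, h.hub.reassign_legs_of_mem (hA hT).2] at hne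
      exact absurd hpart hne
  · refine Or.inl ⟨hQR hsQ, hpart, fun ⟨hD, h'⟩ => ?_⟩
    by_cases hl : K.tri (K.mate s) ∈ Q
    · exact hinter ⟨hD, hl⟩
    · exact hgate ⟨hD, ⟨hsQ, hl⟩, h'⟩

variable [Finite S]

/-- All triangles at a descendant of a leg are in the region of `f`. -/
theorem tri_mem (h : T.IsStage comp m A part n H B regions) (hR : R ∈ regions) (hf : f ∈ R)
    (hy : y ∈ T.legs A f) (hu : u ∈ T.primal.desc y) (hs : K.Inc u s) : K.tri s ∈ R := by
  obtain ⟨hyA, s', v, hs', hv, hvy⟩ := hy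
  have hi : K.Inc y (T.treeSide y) :=
    (inc_treeSide (h.hub.level_ne_zero hyA)).2 (Or.inl rfl)
  rw [h.hub.tri_mem_iff_of_mem_desc (h.inc_mem hR) hyA hu hs hi,
    ← h.hub.tri_mem_iff_of_mem_desc (h.inc_mem hR) hyA hvy hv hi, hs']
  exact hf

theorem reassign_of_mem_region (h : T.IsStage comp m A part n H B regions) (hR : R ∈ regions)
    (hf : f ∈ R) (hR' : R' ∈ regions) (hne : R' ≠ R) (hs : K.tri s ∈ R') (hu : K.Inc u s) :
    T.reassign part n (T.legs A f) u = part u :=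
  reassign_of_notMem fun _ hy hd =>
    hne (h.unique R' hR' R hR _ hs (h.tri_mem hR hf hy hd hu))

theorem lazyAdj_reassign (h : T.IsStage comp m A part n H B regions) (hR : R ∈ regions)
    (hf : f ∈ R) (hu : u ∈ A ∪ T.legs A f) (hv : v ∈ A ∪ T.legs A f)
    (hs : (K.fst s = u ∧ K.snd s = v) ∨ (K.snd s = u ∧ K.fst s = v)) :
    LazyAdj (joinVertex H n (TreeCotree.labels K part R))
      (T.reassign part n (T.legs A f) u) (T.reassign part n (T.legs A f) v) := by
  have key : ∀ {u v}, u ∈ T.legs A f → v ∈ A → K.Inc u s → K.Inc v s →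
      LazyAdj (joinVertex H n (TreeCotree.labels K part R))
      (T.reassign part n (T.legs A f) u) (T.reassign part n (T.legs A f) v) := by
    intro u v hu hv hus hvs
    rw [reassign_of_mem hu, h.hub.reassign_legs_of_mem hv]
    exact lazyAdj_joinVertex ⟨s, v, h.tri_mem hR hf hu (RootedForest.mem_desc_self u) hus, hvs, rfl⟩
  have hus : K.Inc u s := by unfold TriComplex.Inc; tauto
  have hvs : K.Inc v s := by unfold TriComplex.Inc; tauto
  rcases hu with hu | hu <;> rcases hv with hv | hv
  · rw [h.hub.reassign_legs_of_mem hu, h.hub.reassign_legs_of_mem hv]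
    rcases hs with ⟨rfl, rfl⟩ | ⟨rfl, rfl⟩
    · exact (h.lazyAdj s hu hv).joinVertex
    · exact (h.lazyAdj s hv hu).symm.joinVertex
  · exact (key hv hu hvs hus).symm
  · exact key hu hv hus hvs
  · rw [reassign_of_mem hu, reassign_of_mem hv]
    exact Or.inl rfl

/-- If no exit from a piece to `f` lies below the top vertex of a leg, then the triangles at the
edge above that vertex are not in the piece. -/
theorem tri_treeSide_notMem (h : T.IsStage comp m A part n H B regions) {A' : Set U}
    (hA' : T.IsHub A') (hQ : ∀ s, T.IsDualSide s → K.Leaves Q s → ∀ u, K.Inc u s → u ∈ A')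
    (hf : f ∉ Q) (hx : x ∈ T.legs A f) (hxA' : x ∉ A')
    (hs : s = T.treeSide x ∨ s = K.mate (T.treeSide x)) : K.tri s ∉ Q := by
  obtain ⟨hxA, s', v, rfl, hv, hvx⟩ := hx
  have hi : K.Inc x (T.treeSide x) :=
    (inc_treeSide (h.hub.level_ne_zero hxA)).2 (Or.inl rfl)
  have hi' : K.Inc x s := by
    rcases hs with rfl | rfl
    · exact hi
    · exact TriComplex.inc_mate.2 hi
  rwa [← hA'.tri_mem_iff_of_mem_desc hQ hxA' hvx hv hi']

/-- The number of ends of a piece increases by at most two when the legs of `f` are added. -/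
theorem exists_new_ends (h : T.IsStage comp m A part n H B regions) (hR : R ∈ regions)
    (hQ : Q ∈ T.pieces R f) :
    ∃ a b, ∀ s ∈ T.ends (T.reassign part n (T.legs A f)) Q,
      s ∈ T.ends part R ∨ s = a ∨ s = b := by
  have hf := notMem_of_mem_pieces hQ
  have hQR := subset_of_mem_pieces hQ
  have hmem := fun s => h.mem_ends_reassign (f := f) (s := s) hR hQR
  have hlegs : ∀ {u}, u ∈ T.legs A f → u ∉ A := fun hu => hu.1
  by_cases hgate : ∃ s, T.IsDualSide s ∧ K.Leaves Q s ∧ K.tri (K.mate s) ∈ R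
  · obtain ⟨s₀, hD₀, hl₀, hR₀⟩ := hgate
    obtain ⟨hgate, hf₀⟩ : (∀ s, T.IsDualSide s → K.Leaves Q s → K.tri (K.mate s) ∈ R → s = s₀) ∧
        K.tri (K.mate s₀) = f := by
      obtain ⟨s₁, h1⟩ := exists_gate hQ
      refine ⟨fun s h1' h2 h3 => ?_, (h1 s₀ hD₀ hl₀ hR₀).2⟩
      rw [(h1 s h1' h2 h3).1, (h1 s₀ hD₀ hl₀ hR₀).1]
    have hQA : ∀ s, T.IsDualSide s → K.Leaves Q s → s ≠ s₀ → ∀ u, K.Inc u s → u ∈ A := by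
      intro s hD hl hne
      have hl' : K.tri (K.mate s) ∉ R := fun h' => hne (hgate s hD hl h')
      exact h.inc_mem hR s hD ⟨hQR hl.1, hl'⟩
    set u := K.fst s₀ with hu
    set w := K.snd s₀ with hw
    have hleg : ∀ {v}, K.Inc v s₀ → v ∉ A → v ∈ T.legs A f := fun hv hvA =>
      ⟨hvA, _, _, hf₀, TriComplex.inc_mate.2 hv, RootedForest.mem_desc_self _⟩
    have habove : ∀ x ∈ T.legs A f, ∀ s, (s = T.treeSide x ∨ s = K.mate (T.treeSide x)) →
        K.tri s ∈ Q → u ∈ T.primal.desc x ∨ w ∈ T.primal.desc x := by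
      intro x hx s hs hsQ
      by_contra! hcon
      refine h.tri_treeSide_notMem (A' := A ∪ ({z | u ∈ T.primal.desc z} ∪
        {z | w ∈ T.primal.desc z})) ⟨?_, ?_, ?_⟩ ?_ hf hx ?_ hs hsQ
      · exact h.hub.ancClosed.union
          ((T.primal.ancClosed_setOf_mem_desc u).union (T.primal.ancClosed_setOf_mem_desc w))
      · exact fun z hz => Or.inl (h.hub.root_mem z hz)
      · exact fun s h1 h2 z hz => Or.inl (h.hub.mem_of_inc s h1 h2 z hz)
      · intro s hD hl z hz
        by_cases e : s = s₀
        · subst e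
          rcases hz with rfl | rfl
          · exact Or.inr (Or.inl (RootedForest.mem_desc_self _))
          · exact Or.inr (Or.inr (RootedForest.mem_desc_self _))
        · exact Or.inl (hQA s hD hl e z hz)
      · rintro (h' | h' | h')
        · exact hlegs hx h'
        · exact hcon.1 h'
        · exact hcon.2 h'
    have hpick : ∀ v, ∃ a, ∀ x ∈ T.legs A f, T.primal.par x ∈ A → v ∈ T.primal.desc x →
        ¬ (u ∈ T.primal.desc x ↔ w ∈ T.primal.desc x) →
        ∀ s, (s = T.treeSide x ∨ s = K.mate (T.treeSide x)) → K.tri s ∈ Q → s = a := by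
      intro v
      by_cases hex : ∃ x ∈ T.legs A f, T.primal.par x ∈ A ∧ v ∈ T.primal.desc x ∧
        ¬ (u ∈ T.primal.desc x ↔ w ∈ T.primal.desc x) ∧
        ∃ s, (s = T.treeSide x ∨ s = K.mate (T.treeSide x)) ∧ K.tri s ∈ Q
      · obtain ⟨x, hx, hxA, hv, hc, a, ha, haQ⟩ := hex
        refine ⟨a, fun x' hx' hxA' hv' _ s hs hsQ => ?_⟩
        obtain rfl := h.hub.ancClosed.top_unique hv' hv (hlegs hx') (hlegs hx) hxA' hxA
        have := h.hub.not_both_treeSide hQA hD₀ hl₀ (hlegs hx) hc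
        rcases hs with rfl | rfl <;> rcases ha with rfl | rfl
        · rfl
        · exact absurd ⟨hsQ, haQ⟩ this
        · exact absurd ⟨haQ, hsQ⟩ this
        · rfl
      · exact ⟨s₀, fun x hx hxA hv hc s hs hsQ =>
          absurd ⟨x, hx, hxA, hv, hc, s, hs, hsQ⟩ hex⟩
    have hmono : u ∉ A → w ∉ A → s₀ ∉ T.ends (T.reassign part n (T.legs A f)) Q := by
      intro hu' hw' hs
      refine hs.2.1 ?_
      rw [reassign_of_mem (hleg (Or.inl rfl) hu'), reassign_of_mem (hleg (Or.inr rfl) hw')]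
    by_cases hboth : ∃ x ∈ T.legs A f, T.primal.par x ∈ A ∧ u ∈ T.primal.desc x ∧
        w ∈ T.primal.desc x
    · obtain ⟨x, hx, hxA, hux, hwx⟩ := hboth
      refine ⟨T.treeSide x, K.mate (T.treeSide x), fun s hs => (hmem s hs).imp id ?_⟩
      rintro (⟨h1, h2, h3⟩ | ⟨y, hy, hyA, hsy⟩)
      · obtain rfl := hgate s h1 h2 h3
        exact absurd hs (hmono (h.hub.notMem_of_mem_desc (hlegs hx) hux)
          (h.hub.notMem_of_mem_desc (hlegs hx) hwx))
      · obtain rfl : x = y := by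
          rcases habove y hy s hsy hs.1 with h' | h'
          · exact h.hub.ancClosed.top_unique hux h' (hlegs hx) (hlegs hy) hxA hyA
          · exact h.hub.ancClosed.top_unique hwx h' (hlegs hx) (hlegs hy) hxA hyA
        exact hsy
    · have hone : ∀ x ∈ T.legs A f, T.primal.par x ∈ A → ∀ s,
          (s = T.treeSide x ∨ s = K.mate (T.treeSide x)) → K.tri s ∈ Q →
          (u ∈ T.primal.desc x ∧ ¬ (u ∈ T.primal.desc x ↔ w ∈ T.primal.desc x)) ∨
          (w ∈ T.primal.desc x ∧ ¬ (u ∈ T.primal.desc x ↔ w ∈ T.primal.desc x)) := by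
        intro x hx hxA s hs hsQ
        have hb : ¬ (u ∈ T.primal.desc x ∧ w ∈ T.primal.desc x) := fun h' =>
          hboth ⟨x, hx, hxA, h'⟩
        rcases habove x hx s hs hsQ with h' | h'
        · exact Or.inl ⟨h', fun e => hb ⟨h', e.1 h'⟩⟩
        · exact Or.inr ⟨h', fun e => hb ⟨e.2 h', h'⟩⟩
      obtain ⟨a, ha⟩ := hpick u
      obtain ⟨b, hb⟩ := hpick w
      have hAdesc : ∀ {v x}, v ∈ A → x ∈ T.legs A f → v ∉ T.primal.desc x := fun hv hx hd =>
        h.hub.notMem_of_mem_desc (hlegs hx) hd hv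
      by_cases huA : u ∈ A
      · refine ⟨s₀, b, fun s hs => (hmem s hs).imp id ?_⟩
        rintro (⟨h1, h2, h3⟩ | ⟨x, hx, hxA, hsx⟩)
        · exact Or.inl (hgate s h1 h2 h3)
        · rcases hone x hx hxA s hsx hs.1 with ⟨h', -⟩ | ⟨h', hc⟩
          · exact absurd h' (hAdesc huA hx)
          · exact Or.inr (hb x hx hxA h' hc s hsx hs.1)
      by_cases hwA : w ∈ A
      · refine ⟨a, s₀, fun s hs => (hmem s hs).imp id ?_⟩
        rintro (⟨h1, h2, h3⟩ | ⟨x, hx, hxA, hsx⟩)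
        · exact Or.inr (hgate s h1 h2 h3)
        · rcases hone x hx hxA s hsx hs.1 with ⟨h', hc⟩ | ⟨h', -⟩
          · exact Or.inl (ha x hx hxA h' hc s hsx hs.1)
          · exact absurd h' (hAdesc hwA hx)
      · refine ⟨a, b, fun s hs => (hmem s hs).imp id ?_⟩
        rintro (⟨h1, h2, h3⟩ | ⟨x, hx, hxA, hsx⟩)
        · obtain rfl := hgate s h1 h2 h3
          exact absurd hs (hmono huA hwA)
        · rcases hone x hx hxA s hsx hs.1 with ⟨h', hc⟩ | ⟨h', hc⟩
          · exact Or.inl (ha x hx hxA h' hc s hsx hs.1)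
          · exact Or.inr (hb x hx hxA h' hc s hsx hs.1)
  · obtain ⟨s₁, -⟩ := K.exists_sides f
    refine ⟨s₁, s₁, fun s hs => Or.inl ?_⟩
    rcases hmem s hs with h' | h' | ⟨x, hx, -, hsx⟩
    · exact h'
    · exact absurd ⟨s, h'⟩ hgate
    · refine absurd hs.1 (h.tri_treeSide_notMem h.hub (fun s hD hl => ?_) hf hx (hlegs hx) hsx)
      have hl' : K.tri (K.mate s) ∉ R := fun h' => hgate ⟨s, hD, hl, h'⟩
      exact h.inc_mem hR s hD ⟨hQR hl.1, hl'⟩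

end IsStage

end TreeCotree

namespace TreeCotree

variable {K : TriComplex U Δ S} {T : TreeCotree K} {A : Set U} {part : U → ℕ} {n : ℕ}
  {R Q : Set Δ} {f : Δ} {comp : U → C} {m : ℕ} {H : SimpleGraph ℕ} {B : Set Δ}
  {regions : Set (Set Δ)}

theorem labels_congr {part' : U → ℕ} (h : ∀ s u, K.tri s ∈ R → K.Inc u s → part' u = part u) :
    TreeCotree.labels K part' R = TreeCotree.labels K part R := by
  ext c
  constructor
  · rintro ⟨s, u, hs, hu, rfl⟩
    exact ⟨s, u, hs, hu, (h s u hs hu).symm⟩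
  · rintro ⟨s, u, hs, hu, rfl⟩
    exact ⟨s, u, hs, hu, h s u hs hu⟩

theorem ends_congr {part' : U → ℕ} (h : ∀ s u, K.tri s ∈ R → K.Inc u s → part' u = part u) :
    T.ends part' R = T.ends part R := by
  ext s
  refine and_congr_right fun hs => ?_
  rw [h s _ hs (Or.inl rfl), h s _ hs (Or.inr rfl)]

namespace IsStage

/-- Processing one more triangle. -/
theorem exists_step [Finite U] [Finite Δ] [Finite S]
    (h : T.IsStage comp m A part n H B regions) (hm : 3 ≤ m) (hR : R ∈ regions) :
    ∃ f ∈ R, T.IsStage comp m (A ∪ T.legs A f) (T.reassign part n (T.legs A f)) (n + 1)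
      (joinVertex H n (TreeCotree.labels K part R)) (insert f B)
      (regions \ {R} ∪ T.pieces R f) := by
  obtain ⟨r, hr⟩ := h.subtree R hR
  obtain ⟨f, hf, hsplit⟩ := hr.exists_split (h.ends R hR) fun s hs => hs.1
  have hold : ∀ R' ∈ regions \ {R}, ∀ s u, K.tri s ∈ R' → K.Inc u s →
      T.reassign part n (T.legs A f) u = part u := fun R' hR' s u hs hu =>
    h.reassign_of_mem_region hR hf hR'.1 hR'.2 hs hu
  have hlab : ∀ a ∈ TreeCotree.labels K part R, a < n := by
    rintro _ ⟨s, u, -, -, rfl⟩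
    exact h.part_lt u
  have hQlab : ∀ Q ∈ T.pieces R f, ∀ a ∈ TreeCotree.labels K (T.reassign part n (T.legs A f)) Q,
      a = n ∨ a ∈ TreeCotree.labels K part R := by
    rintro Q hQ _ ⟨s, u, hs, hu, rfl⟩
    by_cases hex : ∃ y ∈ T.legs A f, u ∈ T.primal.desc y
    · obtain ⟨y, hy, hd⟩ := hex
      exact Or.inl (reassign_of_mem_desc hy hd)
    · push Not at hex
      rw [reassign_of_notMem hex]
      exact Or.inr ⟨s, u, subset_of_mem_pieces hQ hs, hu, rfl⟩
  refine ⟨f, hf, ⟨h.hub.union_legs, ?_, ?_, ?_, ?_, ?_, ?_, ?_, ?_, ?_, ?_, ?_, ?_, ?_, ?_⟩⟩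
  · intro u hu
    rw [Set.mem_union, not_or] at hu
    by_cases hex : ∃ y ∈ T.legs A f, T.primal.par u ∈ T.primal.desc y
    · obtain ⟨y, hy, hd⟩ := hex
      rw [reassign_of_mem_desc hy hd, reassign_of_mem_desc hy (RootedForest.mem_desc_of_par hd)]
    · push Not at hex
      rw [reassign_of_notMem hex, reassign_of_notMem, h.part_par u hu.1]
      intro y hy hd
      rcases RootedForest.eq_or_par_mem_desc hd with rfl | hd
      · exact hu.2 hy
      · exact hex y hy hd
  · intro u
    unfold reassign
    split_ifs
    · exact Nat.lt_succ_self n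
    · exact (h.part_lt u).trans (Nat.lt_succ_self n)
  · intro a b hab
    rw [joinVertex_adj] at hab
    rcases hab with hab | ⟨-, ⟨rfl, -⟩ | ⟨-, ha⟩⟩
    · exact (h.lt_of_adj a b hab).trans (Nat.lt_succ_self n)
    · exact Nat.lt_succ_self _
    · exact (hlab a ha).trans (Nat.lt_succ_self n)
  · exact h.width.joinVertex h.lt_of_adj hlab (hr.ncard_labels_le (by norm_num) (h.ends R hR))
      (h.labels R hR)
  · exact fun s h1 h2 => h.lazyAdj_reassign (s := s) hR hf h1 h2 (Or.inl ⟨rfl, rfl⟩)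
  · intro s u hs hu
    rcases hs with hs | hs
    · exact mem_union_legs hs hu
    · exact Or.inl (h.mem_of_inc s u hs hu)
  · intro p k c
    by_cases hp : p = n
    · refine (Set.ncard_le_ncard ?_ (Set.toFinite _)).trans
        ((ncard_legs_level_le (T := T) (A := A) (f := f) k).trans hm)
      rintro u ⟨hu, hpu, hk, -⟩
      refine ⟨hu.resolve_left fun hu => ?_, hk⟩
      rw [h.hub.reassign_legs_of_mem hu] at hpu
      have := h.part_lt u
      omega
    · refine (Set.ncard_le_ncard ?_ (Set.toFinite _)).trans (h.card_le p k c)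
      rintro u ⟨hu, hpu, hk⟩
      rcases hu with hu | hu
      · rw [h.hub.reassign_legs_of_mem hu] at hpu
        exact ⟨hu, hpu, hk⟩
      · rw [reassign_of_mem hu] at hpu
        exact absurd hpu.symm hp
  · rintro Q (hQ | hQ)
    · exact h.subtree Q hQ.1
    · exact hr.pieces hf hQ
  · rintro Q (hQ | hQ) t ht
    · rintro (rfl | htB)
      · exact hQ.2 (h.unique Q hQ.1 R hR t ht hf)
      · exact h.disj Q hQ.1 t ht htB
    · rintro (rfl | htB)
      · exact notMem_of_mem_pieces hQ ht
      · exact h.disj R hR t (subset_of_mem_pieces hQ ht) htB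
  · intro t ht
    rw [Set.mem_insert_iff, not_or] at ht
    obtain ⟨R', hR', htR'⟩ := h.cover t ht.2
    by_cases e : R' = R
    · subst e
      obtain ⟨Q, hQ, htQ⟩ := exists_mem_pieces (T := T) htR' ht.1
      exact ⟨Q, Or.inr hQ, htQ⟩
    · exact ⟨R', Or.inl ⟨hR', e⟩, htR'⟩
  · have key : ∀ Q ∈ regions \ {R}, ∀ Q' ∈ T.pieces R f, ∀ t ∈ Q, t ∉ Q' :=
      fun Q hQ Q' hQ' t ht ht' =>
        hQ.2 (h.unique Q hQ.1 R hR t ht (subset_of_mem_pieces hQ' ht'))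
    rintro Q (hQ | hQ) Q' (hQ' | hQ') t ht ht'
    · exact h.unique Q hQ.1 Q' hQ'.1 t ht ht'
    · exact absurd ht' (key Q hQ Q' hQ' t ht)
    · exact absurd ht (key Q' hQ' Q hQ t ht')
    · exact eq_of_mem_pieces hQ hQ' ht ht'
  · rintro Q (hQ | hQ) s hs hl
    · exact Or.inr (h.closed Q hQ.1 s hs hl)
    · by_cases hR' : K.tri (K.mate s) ∈ R
      · obtain ⟨s₀, h0⟩ := exists_gate hQ
        exact Or.inl (h0 s hs hl hR').2
      · exact Or.inr (h.closed R hR s hs ⟨subset_of_mem_pieces hQ hl.1, hR'⟩)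
  · rintro Q (hQ | hQ) a ha b hb
    · rw [labels_congr (hold Q hQ)] at ha hb
      exact (h.labels Q hQ.1 a ha b hb).joinVertex
    · rcases hQlab Q hQ a ha with hn | ha' <;> rcases hQlab Q hQ b hb with hn' | hb'
      · exact Or.inl (hn.trans hn'.symm)
      · exact hn ▸ lazyAdj_joinVertex hb'
      · exact hn' ▸ (lazyAdj_joinVertex ha').symm
      · exact (h.labels R hR a ha' b hb').joinVertex
  · rintro Q (hQ | hQ)
    · rw [ends_congr (hold Q hQ)]
      exact h.ends Q hQ.1
    · obtain ⟨a, b, hab⟩ := h.exists_new_ends hR hQ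
      have hsub : T.ends (T.reassign part n (T.legs A f)) Q ⊆
          (T.ends part R ∩ K.tri ⁻¹' Q) ∪ {a, b} := by
        intro s hs
        rcases hab s hs with h' | h'
        · exact Or.inl ⟨h', hs.1⟩
        · exact Or.inr h'
      have h1 := Set.ncard_le_ncard hsub (Set.toFinite _)
      have h2 := Set.ncard_union_le (T.ends part R ∩ K.tri ⁻¹' Q) {a, b}
      have h3 := hsplit Q hQ
      have h4 := Set.ncard_insert_le a {b}
      rw [Set.ncard_singleton] at h4
      omega

theorem exists_final [Finite U] [Finite Δ] [Finite S]
    (h : T.IsStage comp m A part n H B regions) (hm : 3 ≤ m) :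
    ∃ A part n H regions, T.IsStage comp m A part n H Set.univ regions := by
  obtain ⟨k, hk⟩ : ∃ k, Bᶜ.ncard = k := ⟨_, rfl⟩
  induction k using Nat.strong_induction_on generalizing A part n H B regions with
  | _ k ih =>
    by_cases hB : B = Set.univ
    · exact ⟨A, part, n, H, regions, hB ▸ h⟩
    · obtain ⟨t, ht⟩ := (Set.ne_univ_iff_exists_notMem B).1 hB
      obtain ⟨R, hR, -⟩ := h.cover t ht
      obtain ⟨f, hf, h'⟩ := h.exists_step hm hR
      refine ih _ ?_ h' rfl
      rw [← hk]
      refine Set.ncard_lt_ncard ⟨fun x hx hxB => hx (Or.inr hxB), fun hsub => ?_⟩ (Set.toFinite _)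
      exact hsub (h.disj R hR f hf) (Or.inl rfl)

end IsStage

/-- The initial stage, in which all vertices belong to one part. -/
theorem IsHub.isStage {A : Set U} (hA : T.IsHub A)
    (hcard : ∀ k c, {u | u ∈ A ∧ T.primal.level u = k ∧ comp u = c}.ncard ≤ m) :
    T.IsStage comp m A (fun _ => 0) 1 ⊥ ∅ {R | ∃ r, T.dual.level r = 0 ∧ R = T.dual.desc r} where
  hub := hA
  part_par _ _ := rfl
  part_lt _ := Nat.one_pos
  lt_of_adj _ _ h := absurd h (by simp)
  width := ⟨fun v => by simp, fun _ h => absurd h (by simp)⟩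
  lazyAdj _ _ _ := Or.inl rfl
  mem_of_inc s u h := absurd h (Set.notMem_empty _)
  card_le p k c := by
    by_cases hp : p = 0
    · refine le_of_eq_of_le ?_ (hcard k c)
      congr 1
      ext u
      simp [hp]
    · have : {u | u ∈ A ∧ 0 = p ∧ T.primal.level u = k ∧ comp u = c} = ∅ :=
        Set.eq_empty_of_forall_notMem fun u hu => hp hu.2.1.symm
      rw [this, Set.ncard_empty]
      exact Nat.zero_le _
  subtree := by
    rintro _ ⟨r, -, rfl⟩
    exact ⟨r, RootedForest.mem_desc_self r, subset_rfl,
      fun t ht hne => (RootedForest.eq_or_par_mem_desc ht).resolve_left hne⟩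
  disj _ _ t _ := Set.notMem_empty t
  cover t _ := ⟨_, ⟨T.dual.par^[T.dual.level t] t, by simp [RootedForest.level_iterate], rfl⟩,
    ⟨_, rfl⟩⟩
  unique := by
    rintro _ ⟨r, hr, rfl⟩ _ ⟨r', hr', rfl⟩ t ht ht'
    rw [RootedForest.eq_of_mem_desc_of_mem_desc ht ht' (hr.trans hr'.symm)]
  closed := by
    rintro _ ⟨r, hr, rfl⟩ s hs hl
    exact absurd hr (hs.eq_of_leaves_desc hl).2
  labels := by
    rintro _ - _ ⟨-, -, -, -, rfl⟩ _ ⟨-, -, -, -, rfl⟩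
    exact Or.inl rfl
  ends R _ := by
    have : T.ends (fun _ => 0) R = ∅ :=
      Set.eq_empty_of_forall_notMem fun s hs => hs.2.1 rfl
    rw [this, Set.ncard_empty]
    exact Nat.zero_le _

/-- The vertices of a triangulated surface have a partition into parts that have few vertices on
each level, such that the quotient has an ordering of width at most three. -/
theorem IsHub.exists_partition [Finite U] [Finite Δ] [Finite S] {A : Set U} (hA : T.IsHub A)
    (hm : 3 ≤ m) (hcard : ∀ k c, {u | u ∈ A ∧ T.primal.level u = k ∧ comp u = c}.ncard ≤ m) :
    ∃ (part : U → ℕ) (H : SimpleGraph ℕ), HasWidth H 3 ∧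
      (∀ s, LazyAdj H (part (K.fst s)) (part (K.snd s))) ∧
      ∀ p k c, {u | (∃ s, K.Inc u s) ∧ part u = p ∧ T.primal.level u = k ∧ comp u = c}.ncard ≤
        m := by
  obtain ⟨A, part, n, H, regions, h⟩ := (hA.isStage hcard).exists_final hm
  have hmem : ∀ s u, K.Inc u s → u ∈ A := fun s u => h.mem_of_inc s u (Set.mem_univ _)
  refine ⟨part, H, h.width, fun s => h.lazyAdj s (hmem s _ (Or.inl rfl)) (hmem s _ (Or.inr rfl)),
    fun p k c => (Set.ncard_le_ncard ?_ (Set.toFinite _)).trans (h.card_le p k c)⟩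
  rintro u ⟨⟨s, hs⟩, hu⟩
  exact ⟨hmem s u hs, hu⟩

end TreeCotree

end NonrepetitiveColouring

namespace NonrepetitiveColouring

theorem exists_adj_dist_add_one_eq {α : Type*} {Γ : SimpleGraph α} {r u : α}
    (h : Γ.dist r u ≠ 0) : ∃ v, Γ.Adj u v ∧ Γ.dist r v + 1 = Γ.dist r u := by
  obtain ⟨p, hp⟩ := (SimpleGraph.Reachable.of_dist_ne_zero h).symm.exists_walk_length_eq_dist
  rw [SimpleGraph.dist_comm] at hp
  cases p with
  | nil => exact absurd hp.symm h
  | @cons _ v _ hv q =>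
    refine ⟨v, hv, ?_⟩
    have h1 := SimpleGraph.dist_le q.reverse
    have h2 := hv.symm.reachable.dist_triangle_right r
    rw [SimpleGraph.dist_eq_one_iff_adj.2 hv.symm] at h2
    rw [SimpleGraph.Walk.length_cons] at hp
    rw [SimpleGraph.Walk.length_reverse] at h1
    omega

/-- Every graph has a breadth-first spanning forest. -/
theorem RootedForest.exists_bfs {α : Type*} (Γ : SimpleGraph α) :
    ∃ F : RootedForest α, (∀ u, F.level u = 0 ↔ u = (Γ.connectedComponentMk u).out) ∧
      (∀ u, F.level u ≠ 0 → Γ.Adj u (F.par u)) ∧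
      ∀ u v, Γ.Adj u v → F.level u ≤ F.level v + 1 := by
  classical
  set root : α → α := fun u => (Γ.connectedComponentMk u).out
  have hreach : ∀ u, Γ.Reachable (root u) u := fun u =>
    SimpleGraph.ConnectedComponent.exact (Quot.out_eq (Γ.connectedComponentMk u))
  have hadj : ∀ {u v}, Γ.Adj u v → root u = root v := fun h =>
    congrArg Quot.out (SimpleGraph.ConnectedComponent.sound h.reachable)
  have hpar : ∀ u, Γ.dist (root u) u ≠ 0 →
      ∃ v, Γ.Adj u v ∧ Γ.dist (root v) v + 1 = Γ.dist (root u) u := by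
    intro u hu
    obtain ⟨v, hv, h⟩ := exists_adj_dist_add_one_eq hu
    exact ⟨v, hv, hadj hv ▸ h⟩
  choose! par hpar using hpar
  refine ⟨⟨fun u => Γ.dist (root u) u, fun u => if Γ.dist (root u) u = 0 then u else par u,
    fun h => if_pos h, fun {u} h => ?_⟩, fun u => ?_, fun u h => ?_, fun u v h => ?_⟩
  · rw [if_neg h]
    exact (hpar u h).2
  · exact (hreach u).dist_eq_zero_iff.trans eq_comm
  · dsimp only at h ⊢
    rw [if_neg h]
    exact (hpar u h).1
  · have := h.symm.reachable.dist_triangle_right (root v)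
    rw [SimpleGraph.dist_eq_one_iff_adj.2 h.symm] at this
    dsimp only
    rwa [hadj h]

theorem ncard_setOf_eq_out {α : Type*} [Finite α] (Γ : SimpleGraph α) :
    {u | u = (Γ.connectedComponentMk u).out}.ncard = Nat.card Γ.ConnectedComponent := by
  have : {u | u = (Γ.connectedComponentMk u).out} =
      Set.range fun c : Γ.ConnectedComponent => c.out := by
    ext u
    refine ⟨fun h => ⟨_, Eq.symm h⟩, ?_⟩
    rintro ⟨c, rfl⟩
    exact congrArg Quot.out (Quot.out_eq c).symm
  rw [this, ← Set.image_univ, Set.ncard_image_of_injective, Set.ncard_univ]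
  exact fun c c' h => by rw [← Quot.out_eq c, ← Quot.out_eq c']; exact congrArg _ h

theorem RootedForest.ncard_level_ne_zero_add {α : Type*} [Finite α] {F : RootedForest α}
    {Γ : SimpleGraph α} (h : ∀ u, F.level u = 0 ↔ u = (Γ.connectedComponentMk u).out) :
    {u | F.level u ≠ 0}.ncard + Nat.card Γ.ConnectedComponent = Nat.card α := by
  rw [← ncard_setOf_eq_out, ← Set.ncard_add_ncard_compl {u | F.level u ≠ 0}]
  congr 2
  ext u
  simp [← h]

namespace TriComplex

variable {U Δ S : Type*} (K : TriComplex U Δ S)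

/-- The graph of the vertices and edges of a triangulated surface. -/
def graph : SimpleGraph U where
  Adj u v := u ≠ v ∧ ∃ s, s(K.fst s, K.snd s) = s(u, v)
  symm := ⟨fun _ _ h => ⟨h.1.symm, h.2.imp fun _ e => e.trans Sym2.eq_swap⟩⟩
  loopless := ⟨fun _ h => h.1 rfl⟩

/-- The graph of triangles that are adjacent across sides outside a given set. -/
def dualGraph (P : Set S) : SimpleGraph Δ :=
  SimpleGraph.fromRel fun t t' => ∃ s ∉ P, K.tri s = t ∧ K.tri (K.mate s) = t'

variable {K}

theorem lazyAdj_graph (s : S) : LazyAdj K.graph (K.fst s) (K.snd s) :=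
  or_iff_not_imp_left.2 fun h => ⟨h, s, rfl⟩

theorem connectedComponentMk_fst (s : S) :
    K.graph.connectedComponentMk (K.fst s) = K.graph.connectedComponentMk (K.snd s) := by
  rcases K.lazyAdj_graph s with h | h
  · rw [h]
  · exact SimpleGraph.ConnectedComponent.sound h.reachable

/-- A set of triangles closed under moving to adjacent triangles contains all triangles in a
component. -/
theorem mem_of_closed {Q : Set Δ} (hQ : ∀ s, K.tri s ∈ Q → K.tri (K.mate s) ∈ Q) {s s' : S}
    (h : K.graph.Reachable (K.fst s) (K.fst s')) (hs : K.tri s ∈ Q) : K.tri s' ∈ Q := by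
  suffices H : ∀ s, K.Inc (K.fst s') s → K.tri s ∈ Q from H s' (Or.inl rfl)
  have hlink : ∀ u s s', K.Inc u s → K.Inc u s' → K.tri s ∈ Q → K.tri s' ∈ Q :=
    fun u => K.link u Q fun s _ => hQ s
  have key : ∀ {u v} (p : K.graph.Walk u v), (∀ s, K.Inc u s → K.tri s ∈ Q) →
      ∀ s, K.Inc v s → K.tri s ∈ Q := by
    intro u v p
    induction p with
    | nil => exact id
    | @cons u w _ huw q ih =>
      intro hu
      obtain ⟨-, r, hr⟩ := huw
      rw [Sym2.eq_iff] at hr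
      refine ih fun s' h' => hlink w r s' ?_ h' (hu r ?_)
      · exact hr.elim (fun h => Or.inr h.2) fun h => Or.inl h.1
      · exact hr.elim (fun h => Or.inl h.1) fun h => Or.inr h.2
  exact h.elim fun p => key p fun s'' h'' => hlink _ s s'' (Or.inl rfl) h'' hs

/-- If the edges of a forest are removed from a component of the surface, then the remaining
surface is connected. -/
theorem reachable_dualGraph [Finite S] {F : RootedForest U} {side : U → S}
    (hside : ∀ {u}, F.level u ≠ 0 → s(K.fst (side u), K.snd (side u)) = s(u, F.par u)) {s s' : S}
    (h : K.graph.Reachable (K.fst s) (K.fst s')) :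
    (K.dualGraph {s | ∃ u, F.level u ≠ 0 ∧ (s = side u ∨ s = K.mate (side u))}).Reachable
      (K.tri s) (K.tri s') := by
  classical
  have := Fintype.ofFinite S
  set P := {s | ∃ u, F.level u ≠ 0 ∧ (s = side u ∨ s = K.mate (side u))}
  set D := K.dualGraph P
  set Q := {t | D.Reachable (K.tri s) t}
  have hcross : ∀ {W : Set U} {u}, F.level u ≠ 0 →
      (K.Cross W (side u) ↔ ¬ (u ∈ W ↔ F.par u ∈ W)) := by
    intro W u hu
    have := hside hu
    rw [Sym2.eq_iff] at this
    rcases this with ⟨h1, h2⟩ | ⟨h1, h2⟩ <;> simp only [TriComplex.Cross, h1, h2]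
    tauto
  have hP : ∀ r, K.Leaves Q r → r ∈ P := by
    rintro r ⟨h1, h2⟩
    by_contra hr
    refine h2 (SimpleGraph.Reachable.trans h1 ?_)
    by_cases he : K.tri r = K.tri (K.mate r)
    · rw [← he]
    · exact SimpleGraph.Adj.reachable ((SimpleGraph.fromRel_adj _ _ _).2
        ⟨he, Or.inl ⟨r, hr, rfl, rfl⟩⟩)
  refine K.mem_of_closed (Q := Q) (fun r hr => ?_) h (SimpleGraph.Reachable.refl _)
  by_contra hr'
  have hl : K.Leaves Q r := ⟨hr, hr'⟩
  obtain ⟨u, hu, hru⟩ := hP r hl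
  have heq : (Finset.univ.filter fun r' => K.Leaves Q r' ∧ K.Cross (F.desc u) r') = {r} := by
    ext r'
    simp only [Finset.mem_filter, Finset.mem_univ, true_and, Finset.mem_singleton]
    constructor
    · rintro ⟨hl', hc'⟩
      obtain ⟨u', hu', hru'⟩ := hP r' hl'
      have : K.Cross (F.desc u) (side u') := by
        rcases hru' with rfl | rfl
        · exact hc'
        · exact cross_mate.1 hc'
      rw [hcross hu'] at this
      obtain rfl : u' = u := by
        by_contra hne
        exact this ⟨fun h => (RootedForest.eq_or_par_mem_desc h).resolve_left hne,
          RootedForest.mem_desc_of_par⟩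
      rcases hru with rfl | rfl <;> rcases hru' with rfl | rfl
      · rfl
      · exact absurd hl'.1 hl.2
      · exact absurd hl.1 hl'.2
      · rfl
    · rintro rfl
      refine ⟨hl, ?_⟩
      have : K.Cross (F.desc u) (side u) := by
        rw [hcross hu]
        exact fun h' => RootedForest.par_notMem_desc hu (h'.1 (RootedForest.mem_desc_self u))
      rcases hru with rfl | rfl
      · exact this
      · exact cross_mate.2 this
  have := K.even_card_leaves_cross (F.desc u) Q
  rw [heq, Finset.card_singleton] at this
  exact absurd this (by decide)

end TriComplex

end NonrepetitiveColouring

namespace NonrepetitiveColouring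

variable {U Δ S : Type*} {K : TriComplex U Δ S}

namespace TriComplex

theorem card_side [Finite Δ] [Finite S] (K : TriComplex U Δ S) :
    Nat.card S = 3 * Nat.card Δ := by
  classical
  have := Fintype.ofFinite S
  have := Fintype.ofFinite Δ
  rw [Nat.card_eq_fintype_card, Nat.card_eq_fintype_card, ← Finset.card_univ,
    Finset.card_eq_sum_card_fiberwise (f := K.tri) (t := Finset.univ) fun _ _ => by simp,
    Finset.sum_const_nat (m := 3), Finset.card_univ, mul_comm]
  intro t _
  obtain ⟨s₁, s₂, s₃, -, -, -, h12, h13, h23, ht, -⟩ := K.exists_sides t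
  have : (Finset.univ.filter fun s => K.tri s = t) = {s₁, s₂, s₃} := by
    ext s
    simp [ht]
  rw [this, Finset.card_eq_three]
  exact ⟨_, _, _, h12, h13, h23, rfl⟩

/-- Every triangulated surface has a breadth-first spanning forest together with a spanning forest
of the complementary dual graph. -/
theorem exists_treeCotree [Finite S] [Nonempty S] (K : TriComplex U Δ S) :
    ∃ (T : TreeCotree K) (D : SimpleGraph Δ),
      (∀ u, T.primal.level u = 0 ↔ u = (K.graph.connectedComponentMk u).out) ∧
      (∀ t, T.dual.level t = 0 ↔ t = (D.connectedComponentMk t).out) ∧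
      ∀ s s', K.graph.Reachable (K.fst s) (K.fst s') → D.Reachable (K.tri s) (K.tri s') := by
  obtain ⟨F, hF0, hFadj, hFle⟩ := RootedForest.exists_bfs K.graph
  have hside : ∀ u, F.level u ≠ 0 → ∃ s, s(K.fst s, K.snd s) = s(u, F.par u) := fun u hu =>
    (hFadj u hu).2
  choose! side hside using hside
  set P := {s | ∃ u, F.level u ≠ 0 ∧ (s = side u ∨ s = K.mate (side u))}
  have hP : ∀ s, K.mate s ∈ P → s ∈ P := by
    rintro s ⟨u, hu, h | h⟩
    · exact ⟨u, hu, Or.inr (by rw [← h, K.mate_mate])⟩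
    · exact ⟨u, hu, Or.inl (by rw [← K.mate_mate s, h, K.mate_mate])⟩
  obtain ⟨F', hF'0, hF'adj, -⟩ := RootedForest.exists_bfs (K.dualGraph P)
  have hdual : ∀ t, F'.level t ≠ 0 → ∃ s, s ∉ P ∧ K.tri s = t ∧ K.tri (K.mate s) = F'.par t := by
    intro t ht
    obtain ⟨-, ⟨s, hs, h1, h2⟩ | ⟨s, hs, h1, h2⟩⟩ := (SimpleGraph.fromRel_adj _ _ _).1 (hF'adj t ht)
    · exact ⟨s, hs, h1, h2⟩
    · exact ⟨K.mate s, fun h => hs (hP s h), h2, by rw [K.mate_mate, h1]⟩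
  choose! dside hdual using hdual
  have hle : ∀ u v, LazyAdj K.graph u v → F.level u ≤ F.level v + 1 := by
    rintro u v (rfl | h)
    · exact Nat.le_succ _
    · exact hFle u v h
  exact ⟨{
    primal := F
    dual := F'
    treeSide := side
    dualSide := dside
    ends_treeSide := hside _
    level_fst_le := fun s => hle _ _ (K.lazyAdj_graph s)
    level_snd_le := fun s => hle _ _ (K.lazyAdj_graph s).symm
    tri_dualSide := fun h => (hdual _ h).2.1
    tri_mate_dualSide := fun h => (hdual _ h).2.2
    disjoint := fun {u t} hu ht => ⟨fun h => (hdual t ht).1 ⟨u, hu, Or.inl h⟩,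
      fun h => (hdual t ht).1 ⟨u, hu, Or.inr h⟩⟩ }, K.dualGraph P, hF0, hF'0,
    fun s s' h => K.reachable_dualGraph (hside _) h⟩

end TriComplex

namespace TreeCotree

variable {T : TreeCotree K}

theorem ncard_setOf_eq_or_eq_mate {α : Type*} {f : α → S} {L : Set α}
    (h : ∀ a ∈ L, ∀ b ∈ L, f a ≠ K.mate (f b)) (hf : Set.InjOn f L) [Finite S] :
    {s | ∃ a ∈ L, s = f a ∨ s = K.mate (f a)}.ncard = 2 * L.ncard := by
  have hinj : Function.Injective K.mate := fun a b h => by rw [← K.mate_mate a, h, K.mate_mate]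
  have : {s | ∃ a ∈ L, s = f a ∨ s = K.mate (f a)} = f '' L ∪ (K.mate ∘ f) '' L := by
    ext s
    simp only [Set.mem_ofPred_eq, Set.mem_union, Set.mem_image, Function.comp]
    constructor
    · rintro ⟨a, ha, rfl | rfl⟩
      · exact Or.inl ⟨a, ha, rfl⟩
      · exact Or.inr ⟨a, ha, rfl⟩
    · rintro (⟨a, ha, rfl⟩ | ⟨a, ha, rfl⟩)
      · exact ⟨a, ha, Or.inl rfl⟩
      · exact ⟨a, ha, Or.inr rfl⟩
  rw [this, Set.ncard_union_eq _ (Set.toFinite _) (Set.toFinite _), hf.ncard_image,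
    (hinj.injOn.comp hf fun _ _ => Set.mem_univ _).ncard_image, two_mul]
  rw [Set.disjoint_left]
  rintro _ ⟨a, ha, rfl⟩ ⟨b, hb, e⟩
  exact h a ha b hb e.symm

/-- The hub consisting of the roots and the ancestors of the ends of the sides in neither
forest. -/
theorem isHub (T : TreeCotree K) :
    T.IsHub ({u | T.primal.level u = 0} ∪ {u | ∃ x s, ¬ T.IsTreeSide s ∧ ¬ T.IsDualSide s ∧
      K.Inc x s ∧ x ∈ T.primal.desc u}) where
  ancClosed := by
    rintro u (h | ⟨x, s, h1, h2, h3, h4⟩)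
    · exact Or.inl ((T.primal.par_eq_self h).symm ▸ h)
    · exact Or.inr ⟨x, s, h1, h2, h3, RootedForest.desc_trans h4 (RootedForest.mem_desc_par u)⟩
  root_mem _ h := Or.inl h
  mem_of_inc s h1 h2 u hu := Or.inr ⟨u, s, h1, h2, hu, RootedForest.mem_desc_self u⟩

variable [Finite S]

theorem ncard_isTreeSide (T : TreeCotree K) :
    {s | T.IsTreeSide s}.ncard = 2 * {u | T.primal.level u ≠ 0}.ncard := by
  have key : ∀ u, T.primal.level u ≠ 0 → ∀ v, T.primal.level v ≠ 0 →
      s(K.fst (T.treeSide u), K.snd (T.treeSide u)) =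
        s(K.fst (T.treeSide v), K.snd (T.treeSide v)) → u = v := by
    intro u hu v hv h
    rw [T.ends_treeSide hu, T.ends_treeSide hv, Sym2.eq_iff] at h
    rcases h with h | ⟨h1, h2⟩
    · exact h.1
    · have h3 := T.primal.level_par hu
      have h4 := T.primal.level_par hv
      rw [h2] at h3
      rw [← h1] at h4
      omega
  refine ncard_setOf_eq_or_eq_mate (K := K) (L := {u | T.primal.level u ≠ 0})
    (fun u hu v hv e => ?_) fun u hu v hv e => key u hu v hv (by rw [e])
  obtain rfl := key u hu v hv (by rw [e, K.fst_mate, K.snd_mate])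
  exact K.mate_ne _ e.symm

theorem ncard_isDualSide (T : TreeCotree K) :
    {s | T.IsDualSide s}.ncard = 2 * {t | T.dual.level t ≠ 0}.ncard := by
  refine ncard_setOf_eq_or_eq_mate (K := K) (L := {t | T.dual.level t ≠ 0})
    (fun t ht t' ht' e => ?_) fun t ht t' ht' e => by
      rw [← T.tri_dualSide ht, e, T.tri_dualSide ht']
  have h1 := T.tri_dualSide ht
  have h2 := T.tri_mate_dualSide ht
  rw [e, T.tri_mate_dualSide ht'] at h1
  rw [e, K.mate_mate, T.tri_dualSide ht'] at h2
  have h3 := T.dual.level_par ht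
  have h4 := T.dual.level_par ht'
  rw [← h2] at h3
  rw [h1] at h4
  omega

/-- The number of sides in neither forest. -/
theorem ncard_extra_add [Finite Δ] (T : TreeCotree K) :
    {s | ¬ T.IsTreeSide s ∧ ¬ T.IsDualSide s}.ncard + 2 * {u | T.primal.level u ≠ 0}.ncard +
      2 * {t | T.dual.level t ≠ 0}.ncard = 3 * Nat.card Δ := by
  rw [← K.card_side, ← ncard_isTreeSide, ← ncard_isDualSide, ← Set.ncard_union_eq,
    ← Set.ncard_union_eq, ← Set.ncard_univ]
  · congr 1
    ext s
    simp only [Set.mem_union, Set.mem_ofPred_eq, Set.mem_univ, iff_true]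
    tauto
  · rw [Set.disjoint_left]
    rintro s (h | h) h'
    · exact h.2 h'
    · exact h'.not_isTreeSide h
  · rw [Set.disjoint_left]
    exact fun s h h' => h.1 h'

/-- The ends of the sides in neither forest. -/
theorem ncard_ends_extra_le [Finite U] (T : TreeCotree K) :
    {u | ∃ s, ¬ T.IsTreeSide s ∧ ¬ T.IsDualSide s ∧ K.Inc u s}.ncard ≤
      {s | ¬ T.IsTreeSide s ∧ ¬ T.IsDualSide s}.ncard := by
  classical
  set X := {s | ¬ T.IsTreeSide s ∧ ¬ T.IsDualSide s}
  have hX : ∀ s, s ∈ X → K.mate s ∈ X := fun s h =>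
    ⟨fun h' => h.1 (K.mate_mate s ▸ h'.mate), fun h' => h.2 (K.mate_mate s ▸ h'.mate)⟩
  have hfin : X.Finite := Set.toFinite X
  let e : S → Sym2 U := fun s => s(K.fst s, K.snd s)
  have h1 : 2 * (hfin.toFinset.image e).card ≤ hfin.toFinset.card := by
    refine Finset.mul_card_image_le_card _ 2 fun z hz => ?_
    obtain ⟨s, hs, rfl⟩ := Finset.mem_image.1 hz
    rw [Set.Finite.mem_toFinset] at hs
    refine Finset.one_lt_card.2 ⟨s, ?_, K.mate s, ?_, (K.mate_ne s).symm⟩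
    · simpa using hs
    · simpa [e, K.fst_mate, K.snd_mate] using hX s hs
  have h2 : ((hfin.toFinset.image e).biUnion Sym2.toFinset).card ≤
      (hfin.toFinset.image e).card * 2 :=
    Finset.card_biUnion_le_card_mul _ _ _ fun z _ => by
      rw [Sym2.card_toFinset]
      split_ifs <;> omega
  rw [Set.ncard_eq_toFinset_card X hfin]
  refine le_trans ?_ (h2.trans (by omega))
  rw [← Set.ncard_coe_finset]
  refine Set.ncard_le_ncard ?_ (Set.toFinite _)
  rintro u ⟨s, h, h', hs⟩
  simp only [Finset.coe_biUnion, Set.mem_iUnion]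
  refine ⟨e s, ?_, ?_⟩
  · simpa using ⟨s, ⟨h, h'⟩, rfl⟩
  · simpa [e, TriComplex.Inc, eq_comm] using hs

theorem ncard_hub_level_le [Finite U] (T : TreeCotree K)
    (hT : ∀ u, T.primal.level u = 0 ↔ u = (K.graph.connectedComponentMk u).out) {m : ℕ}
    (hm : 1 ≤ m) (hX : {s | ¬ T.IsTreeSide s ∧ ¬ T.IsDualSide s}.ncard ≤ m) (k : ℕ)
    (c : K.graph.ConnectedComponent) :
    {u | u ∈ {u | T.primal.level u = 0} ∪ {u | ∃ x s, ¬ T.IsTreeSide s ∧ ¬ T.IsDualSide s ∧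
      K.Inc x s ∧ x ∈ T.primal.desc u} ∧ T.primal.level u = k ∧
      K.graph.connectedComponentMk u = c}.ncard ≤ m := by
  by_cases hk : k = 0
  · refine (Set.ncard_le_ncard (t := {c.out}) ?_ (Set.toFinite _)).trans
      ((Set.ncard_singleton _).trans_le hm)
    rintro u ⟨-, h, rfl⟩
    exact (hT u).1 (h.trans hk)
  · refine (Set.ncard_le_ncard ?_ (Set.toFinite _)).trans
      ((Set.ncard_image_le (f := fun x => T.primal.par^[T.primal.level x - k] x)
        (Set.toFinite _)).trans (T.ncard_ends_extra_le.trans hX))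
    rintro u ⟨h | ⟨x, s, h1, h2, h3, h4⟩, rfl, -⟩
    · exact absurd h hk
    · exact ⟨x, ⟨s, h1, h2, h3⟩, RootedForest.mem_desc_iff.1 h4⟩

end TreeCotree

namespace TriComplex

theorem eq_of_reachable {u v : U} (hu : ∀ s, ¬ K.Inc u s) (h : K.graph.Reachable u v) :
    u = v := by
  obtain ⟨p⟩ := h
  cases p with
  | nil => rfl
  | cons h q =>
    obtain ⟨-, s, hs⟩ := h
    rw [Sym2.eq_iff] at hs
    exact absurd (hs.elim (fun h => Or.inl h.1) fun h => Or.inr h.2) (hu s)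

theorem card_component_add_ncard_le [Finite U] {I : Set U} (hI : ∀ u ∈ I, ∀ s, ¬ K.Inc u s)
    {D : SimpleGraph Δ}
    (hD : ∀ s s', K.graph.Reachable (K.fst s) (K.fst s') → D.Reachable (K.tri s) (K.tri s')) :
    Nat.card D.ConnectedComponent + I.ncard ≤ Nat.card K.graph.ConnectedComponent := by
  have hside : ∀ t, ∃ s, K.tri s = t := fun t => by
    obtain ⟨s₁, s₂, s₃, -, -, -, -, -, -, ht, -⟩ := K.exists_sides t
    exact ⟨s₁, (ht s₁).2 (Or.inl rfl)⟩
  choose side hside using hside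
  let f : D.ConnectedComponent ⊕ I → K.graph.ConnectedComponent :=
    Sum.elim (fun c => K.graph.connectedComponentMk (K.fst (side c.out)))
      fun u => K.graph.connectedComponentMk u
  have hiso : ∀ (u : I) s, K.graph.connectedComponentMk u ≠
      K.graph.connectedComponentMk (K.fst s) := fun u s h =>
    hI u u.2 s (Or.inl (eq_of_reachable (hI u u.2) (SimpleGraph.ConnectedComponent.exact h)).symm)
  have hf : Function.Injective f := by
    rintro (c | u) (c' | u') h
    · have := hD _ _ (SimpleGraph.ConnectedComponent.exact h)
      rw [hside, hside] at this
      rw [← Quot.out_eq c, ← Quot.out_eq c']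
      exact congrArg _ (SimpleGraph.ConnectedComponent.sound this)
    · exact absurd h.symm (hiso _ _)
    · exact absurd h (hiso _ _)
    · exact congrArg _ (Subtype.ext
        (eq_of_reachable (hI u u.2) (SimpleGraph.ConnectedComponent.exact h)))
  have := Finite.of_injective f hf
  have : Finite D.ConnectedComponent := Finite.of_injective _ (hf.comp Sum.inl_injective)
  have h := Nat.card_le_card_of_injective f hf
  rwa [Nat.card_sum, Nat.card_coe_set_eq] at h

/-- The vertices of a triangulated surface can be layered and partitioned such that the layering
does not jump along edges, the quotient has an ordering of width at most three, and every part has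
few vertices in each layer of a component. The bound is given by Euler's formula. -/
theorem exists_layered_partition [Finite U] [Finite Δ] [Finite S] [Nonempty S]
    (K : TriComplex U Δ S) {I : Set U} (hI : ∀ u ∈ I, ∀ s, ¬ K.Inc u s) :
    2 * Nat.card U + 2 * I.ncard ≤ Nat.card Δ + 4 * Nat.card K.graph.ConnectedComponent ∧
    ∀ m, 3 ≤ m → Nat.card Δ + 4 * Nat.card K.graph.ConnectedComponent ≤
      m + 2 * Nat.card U + 2 * I.ncard →
    ∃ (level part : U → ℕ) (H : SimpleGraph ℕ), HasWidth H 3 ∧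
      (∀ s, level (K.fst s) ≤ level (K.snd s) + 1 ∧ level (K.snd s) ≤ level (K.fst s) + 1) ∧
      (∀ s, LazyAdj H (part (K.fst s)) (part (K.snd s))) ∧
      ∀ p k c, {u | (∃ s, K.Inc u s) ∧ part u = p ∧ level u = k ∧
        K.graph.connectedComponentMk u = c}.ncard ≤ m := by
  obtain ⟨T, D, hT, hT', hD⟩ := K.exists_treeCotree
  have h1 := RootedForest.ncard_level_ne_zero_add hT
  have h2 := RootedForest.ncard_level_ne_zero_add hT'
  have h3 := T.ncard_extra_add
  have h4 := card_component_add_ncard_le hI hD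
  refine ⟨by omega, fun m hm h => ?_⟩
  obtain ⟨part, H, hH, hadj, hcard⟩ := T.isHub.exists_partition hm
    (T.ncard_hub_level_le hT (by omega) (by omega))
  exact ⟨T.primal.level, part, H, hH, fun s => ⟨T.level_fst_le s, T.level_snd_le s⟩, hadj, hcard⟩

end TriComplex

section Involution

variable {α : Type*} {f : α → α}

theorem quot_mk_eq_iff_of_involutive (hf : Function.Involutive f) {a b : α} :
    Quot.mk (fun a b => f a = b) a = Quot.mk _ b ↔ a = b ∨ f a = b := by
  constructor
  · intro h
    have key := Quot.eqvGen_exact h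
    clear h
    induction key with
    | rel _ _ h => exact Or.inr h
    | refl _ => exact Or.inl rfl
    | symm _ _ _ ih => exact ih.imp Eq.symm fun h => by rw [← h, hf]
    | trans _ _ _ _ _ ih ih' =>
      rcases ih with rfl | rfl
      · exact ih'
      · rcases ih' with rfl | rfl
        · exact Or.inr rfl
        · exact Or.inl (hf _).symm
  · rintro (rfl | h)
    · rfl
    · exact Quot.sound h

theorem two_mul_card_quot_of_involutive [Finite α] (hf : Function.Involutive f)
    (hne : ∀ a, f a ≠ a) : 2 * Nat.card (Quot fun a b => f a = b) = Nat.card α := by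
  classical
  have := Fintype.ofFinite α
  have := Fintype.ofFinite (Quot fun a b => f a = b)
  rw [Nat.card_eq_fintype_card, Nat.card_eq_fintype_card, ← Finset.card_univ (α := α),
    Finset.card_eq_sum_card_fiberwise (f := Quot.mk fun a b => f a = b) (t := Finset.univ)
      fun _ _ => by simp, Finset.sum_const_nat (m := 2), Finset.card_univ, mul_comm]
  rintro ⟨a⟩ -
  have : (Finset.univ.filter fun b => Quot.mk (fun a b => f a = b) b = Quot.mk _ a) =
      {a, f a} := by
    ext b
    simp only [Finset.mem_filter, Finset.mem_univ, true_and, Finset.mem_insert,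
      Finset.mem_singleton]
    rw [quot_mk_eq_iff_of_involutive hf]
    exact or_congr_right ⟨fun h => by rw [← h, hf], fun h => by rw [h, hf]⟩
  exact this ▸ Finset.card_pair (hne a).symm

end Involution

variable {V : Type*} {G : SimpleGraph V}

/-- The flag on the other side of the same dart. -/
def flipSide (x : G.Dart × Bool) : G.Dart × Bool := (x.1, !x.2)

/-- The flag at the other end of the same side of an edge. -/
def flipEnd (E : G.EmbeddingScheme) (x : G.Dart × Bool) : G.Dart × Bool :=
  (x.1.symm, !(Bool.xor x.2 (!(E.sign x.1.edge))))

/-- The other flag of the same corner. -/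
def flipCorner (E : G.EmbeddingScheme) (x : G.Dart × Bool) : G.Dart × Bool :=
  (if x.2 then E.rot.symm x.1 else E.rot x.1, !x.2)

theorem flipSide_flipSide (x : G.Dart × Bool) : flipSide (flipSide x) = x := by
  simp [flipSide]

theorem flipEnd_flipEnd (E : G.EmbeddingScheme) : Function.Involutive (flipEnd E) := by
  rintro ⟨d, s⟩
  simp [flipEnd]

theorem flipCorner_flipCorner (E : G.EmbeddingScheme) : Function.Involutive (flipCorner E) := by
  rintro ⟨d, s⟩
  cases s <;> simp [flipCorner]

theorem flipEnd_ne (E : G.EmbeddingScheme) (x : G.Dart × Bool) : flipEnd E x ≠ x := fun h =>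
  x.1.symm_ne (congrArg Prod.fst h)

theorem flipCorner_ne (E : G.EmbeddingScheme) (x : G.Dart × Bool) : flipCorner E x ≠ x := fun h =>
  Bool.not_ne_self _ (congrArg Prod.snd h)

theorem flipEnd_flipSide (E : G.EmbeddingScheme) (x : G.Dart × Bool) :
    flipEnd E (flipSide x) = flipSide (flipEnd E x) := by
  obtain ⟨d, s⟩ := x
  simp [flipEnd, flipSide]

theorem next_eq (E : G.EmbeddingScheme) (x : G.Dart × Bool) :
    E.next x = flipCorner E (flipEnd E x) := by
  obtain ⟨d, s⟩ := x
  cases s <;> cases h : E.sign d.edge <;>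
    simp [SimpleGraph.EmbeddingScheme.next, flipEnd, flipCorner, h]

theorem fst_flipCorner (E : G.EmbeddingScheme) (x : G.Dart × Bool) :
    (flipCorner E x).1.fst = x.1.fst := by
  obtain ⟨d, s⟩ := x
  cases s
  · exact E.rot_fixes_tail d
  · have := E.rot_fixes_tail (E.rot.symm d)
    rw [Equiv.apply_symm_apply] at this
    exact this.symm

/-- The faces of an embedding. -/
def Face (E : G.EmbeddingScheme) : Type _ :=
  Quot fun x y : G.Dart × Bool => flipEnd E x = y ∨ flipCorner E x = y

/-- The triangles of the triangulation obtained from an embedding by adding a vertex in every face,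
one for each side of each edge. -/
def Triangle (E : G.EmbeddingScheme) : Type _ :=
  Quot fun x y : G.Dart × Bool => flipEnd E x = y

instance [Finite V] : Finite G.Dart := Finite.of_injective _ SimpleGraph.Dart.toProd_injective

instance [Finite V] (E : G.EmbeddingScheme) : Finite (Face E) :=
  inferInstanceAs (Finite (Quot _))

instance [Finite V] (E : G.EmbeddingScheme) : Finite (Triangle E) :=
  inferInstanceAs (Finite (Quot _))

variable {E : G.EmbeddingScheme}

/-- The face of a flag. -/
def Face.mk (x : G.Dart × Bool) : Face E := Quot.mk _ x

/-- The triangle of a flag. -/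
def Triangle.mk (x : G.Dart × Bool) : Triangle E := Quot.mk _ x

/-- The edge of the graph on the boundary of a triangle. -/
def Triangle.edge : Triangle E → Sym2 V :=
  Quot.lift (fun x => x.1.edge) fun x _ h => by
    rw [← h]
    exact (SimpleGraph.Dart.edge_symm _).symm

/-- The triangle on the other side of the same edge. -/
def Triangle.flip : Triangle E → Triangle E :=
  Quot.map flipSide fun x _ h => by
    rw [← h]
    exact flipEnd_flipSide E x

theorem Triangle.mk_eq_iff {x y : G.Dart × Bool} :
    (Triangle.mk x : Triangle E) = Triangle.mk y ↔ x = y ∨ flipEnd E x = y :=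
  quot_mk_eq_iff_of_involutive (flipEnd_flipEnd E)

theorem Triangle.exists_mk_of_mem_edge {t : Triangle E} {v : V} (h : v ∈ t.edge) :
    ∃ x : G.Dart × Bool, x.1.fst = v ∧ t = Triangle.mk x := by
  obtain ⟨x⟩ := t
  rcases Sym2.mem_iff.1 (show v ∈ s(x.1.fst, x.1.snd) from h) with rfl | rfl
  · exact ⟨x, rfl, rfl⟩
  · exact ⟨flipEnd E x, rfl, Triangle.mk_eq_iff.2 (Or.inr rfl)⟩

theorem Triangle.flip_flip (t : Triangle E) : t.flip.flip = t := by
  obtain ⟨x⟩ := t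
  exact congrArg Triangle.mk (flipSide_flipSide x)

theorem Triangle.edge_flip (t : Triangle E) : t.flip.edge = t.edge := by
  obtain ⟨x⟩ := t
  rfl

theorem Triangle.flip_ne (t : Triangle E) : t.flip ≠ t := by
  obtain ⟨x⟩ := t
  intro h
  rcases Triangle.mk_eq_iff.1 h with h | h
  · exact Bool.not_ne_self _ (congrArg Prod.snd h)
  · exact SimpleGraph.Dart.symm_ne _ (congrArg Prod.fst h)

theorem Face.mk_flipEnd (x : G.Dart × Bool) :
    (Face.mk (flipEnd E x) : Face E) = Face.mk x :=
  Eq.symm (Quot.sound (Or.inl rfl : flipEnd E x = _ ∨ flipCorner E x = _))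

theorem Face.mk_flipCorner (x : G.Dart × Bool) :
    (Face.mk (flipCorner E x) : Face E) = Face.mk x :=
  Eq.symm (Quot.sound (Or.inr rfl : flipEnd E x = _ ∨ flipCorner E x = _))

theorem Triangle.mk_flipEnd (x : G.Dart × Bool) :
    (Triangle.mk (flipEnd E x) : Triangle E) = Triangle.mk x :=
  Eq.symm (Quot.sound (rfl : flipEnd E x = _))

theorem mk_mem_of_face_eq {Q : Set (Triangle E)} {f : Face E}
    (h : ∀ x, Face.mk x = f → Triangle.mk x ∈ Q → Triangle.mk (flipCorner E x) ∈ Q)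
    {x y : G.Dart × Bool} (hx : Face.mk x = f) (hy : Face.mk y = f) (hxQ : Triangle.mk x ∈ Q) :
    Triangle.mk y ∈ Q := by
  have key := Quot.eqvGen_exact (show Quot.mk _ x = Quot.mk _ y from hx.trans hy.symm)
  suffices H : (Face.mk x = f → (Triangle.mk x ∈ Q ↔ Triangle.mk y ∈ Q)) from (H hx).1 hxQ
  clear hx hy hxQ
  induction key with
  | rel x y hr =>
    intro hx
    rcases hr with rfl | rfl
    · rw [Triangle.mk_flipEnd]
    · refine ⟨h x hx, fun h' => ?_⟩
      have := h _ ((Face.mk_flipCorner x).trans hx) h'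
      rwa [flipCorner_flipCorner] at this
  | refl x => exact fun _ => Iff.rfl
  | symm x y hr ih =>
    intro hy
    have : (Face.mk x : Face E) = Face.mk y := Quot.eqvGen_sound hr
    exact (ih (this.trans hy)).symm
  | trans x y z hr _ ih ih' =>
    intro hx
    have : (Face.mk x : Face E) = Face.mk y := Quot.eqvGen_sound hr
    exact (ih hx).trans (ih' (this.symm.trans hx))

theorem mk_mem_of_fst_eq {Q : Set (Triangle E)} {v : V}
    (h : ∀ x : G.Dart × Bool, x.1.fst = v → Triangle.mk x ∈ Q → Triangle.mk (flipCorner E x) ∈ Q)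
    (h' : ∀ x : G.Dart × Bool, x.1.fst = v → Triangle.mk x ∈ Q → Triangle.mk (flipSide x) ∈ Q)
    {x y : G.Dart × Bool} (hx : x.1.fst = v) (hy : y.1.fst = v) (hxQ : Triangle.mk x ∈ Q) :
    Triangle.mk y ∈ Q := by
  have hside : ∀ (d : G.Dart) (a b : Bool), d.fst = v → Triangle.mk (d, a) ∈ Q →
      Triangle.mk (d, b) ∈ Q := by
    intro d a b hd ha
    cases a <;> cases b
    exacts [ha, h' (d, false) hd ha, h' (d, true) hd ha, ha]
  have hrot : ∀ (i : ℤ) (d : G.Dart), d.fst = v → Triangle.mk (d, true) ∈ Q →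
      Triangle.mk ((E.rot ^ i) d, true) ∈ Q := by
    intro i
    induction i with
    | zero => exact fun d _ h => h
    | succ i ih =>
      intro d hd hdQ
      rw [zpow_add_one, Equiv.Perm.mul_apply]
      exact ih _ ((E.rot_fixes_tail d).trans hd) (h (d, false) hd (hside d _ _ hd hdQ))
    | pred i ih =>
      intro d hd hdQ
      rw [zpow_sub_one, Equiv.Perm.mul_apply]
      have := (fst_flipCorner E (d, true)).trans hd
      exact ih _ this (hside _ _ _ this (h (d, true) hd hdQ))
  obtain ⟨i, hi⟩ := E.rot_single_cycle x.1 y.1 (hx.trans hy.symm)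
  exact hside _ _ _ hy (hi ▸ hrot i x.1 hx (hside _ _ _ hx hxQ))

/-- The triangulation obtained from an embedding by adding a vertex in every face. -/
noncomputable def triangulation (E : G.EmbeddingScheme) :
    TriComplex (V ⊕ Face E) (Triangle E) ((G.Dart × Bool) ⊕ Triangle E) where
  tri := Sum.elim Triangle.mk id
  mate := Sum.map (flipCorner E) Triangle.flip
  fst := Sum.elim (fun x => Sum.inl x.1.fst) fun t => Sum.inl (Quot.out t.edge).1
  snd := Sum.elim (fun x => Sum.inr (Face.mk x)) fun t => Sum.inl (Quot.out t.edge).2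
  mate_mate := by
    rintro (x | t)
    · exact congrArg Sum.inl (flipCorner_flipCorner E x)
    · exact congrArg Sum.inr t.flip_flip
  mate_ne := by
    rintro (x | t) h
    · exact flipCorner_ne E x (Sum.inl_injective h)
    · exact t.flip_ne (Sum.inr_injective h)
  fst_mate := by
    rintro (x | t)
    · exact congrArg Sum.inl (fst_flipCorner E x)
    · exact congrArg (fun z => Sum.inl (Quot.out z).1) t.edge_flip
  snd_mate := by
    rintro (x | t)
    · exact congrArg Sum.inr (Face.mk_flipCorner x)
    · exact congrArg (fun z => Sum.inl (Quot.out z).2) t.edge_flip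
  exists_sides := by
    rintro ⟨x⟩
    refine ⟨Sum.inl x, Sum.inl (flipEnd E x), Sum.inr (Triangle.mk x), Sum.inl x.1.fst,
      Sum.inr (Face.mk x), Sum.inl x.1.snd, fun h => flipEnd_ne E x (Sum.inl_injective h).symm,
      Sum.inl_ne_inr, Sum.inl_ne_inr, ?_, rfl, ?_, ?_⟩
    · rintro (y | t)
      · refine (eq_comm.trans Triangle.mk_eq_iff).trans ?_
        simp [eq_comm]
      · simp only [Sum.elim_inr, id, reduceCtorEq, false_or, Sum.inr.injEq]
        rfl
    · exact Sym2.eq_iff.2 (Or.inr ⟨rfl, congrArg Sum.inr (Face.mk_flipEnd x)⟩)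
    · have := congrArg (Sym2.map (Sum.inl : V → V ⊕ Face E)) (Quot.out_eq x.1.edge)
      exact this
  link := by
    rintro (v | f) Q h s s' hs hs' hsQ
    · have hflag : ∀ s : (G.Dart × Bool) ⊕ Triangle E,
          (Sum.elim (fun x => Sum.inl x.1.fst) (fun t => Sum.inl (Quot.out t.edge).1) s =
            (Sum.inl v : V ⊕ Face E) ∨
          Sum.elim (fun x => Sum.inr (Face.mk x)) (fun t => Sum.inl (Quot.out t.edge).2) s =
            (Sum.inl v : V ⊕ Face E)) →
          ∃ x : G.Dart × Bool, x.1.fst = v ∧ Sum.elim Triangle.mk id s = Triangle.mk x := by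
        rintro (x | t) (h | h)
        · exact ⟨x, Sum.inl_injective h, rfl⟩
        · exact absurd h Sum.inr_ne_inl
        · exact Triangle.exists_mk_of_mem_edge (Sum.inl_injective h ▸ Sym2.out_fst_mem _)
        · exact Triangle.exists_mk_of_mem_edge (Sum.inl_injective h ▸ Sym2.out_snd_mem _)
      obtain ⟨x, hx, hsx⟩ := hflag s hs
      obtain ⟨y, hy, hsy⟩ := hflag s' hs'
      rw [hsy]
      rw [hsx] at hsQ
      refine mk_mem_of_fst_eq (fun z hz => h (Sum.inl z) (Or.inl (congrArg Sum.inl hz)))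
        (fun z hz => h (Sum.inr (Triangle.mk z)) ?_) hx hy hsQ
      have : v ∈ s((Quot.out z.1.edge).1, (Quot.out z.1.edge).2) := by
        rw [show s((Quot.out z.1.edge).1, (Quot.out z.1.edge).2) = z.1.edge from Quot.out_eq _]
        exact hz ▸ Sym2.mem_mk_left _ _
      exact (Sym2.mem_iff.1 this).imp (fun h => congrArg Sum.inl h.symm)
        fun h => congrArg Sum.inl h.symm
    · have hflag : ∀ s : (G.Dart × Bool) ⊕ Triangle E,
          (Sum.elim (fun x => Sum.inl x.1.fst) (fun t => Sum.inl (Quot.out t.edge).1) s =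
            (Sum.inr f : V ⊕ Face E) ∨
          Sum.elim (fun x => Sum.inr (Face.mk x)) (fun t => Sum.inl (Quot.out t.edge).2) s =
            (Sum.inr f : V ⊕ Face E)) →
          ∃ x : G.Dart × Bool, Face.mk x = f ∧ Sum.elim Triangle.mk id s = Triangle.mk x := by
        rintro (x | t) (h | h)
        · exact absurd h Sum.inl_ne_inr
        · exact ⟨x, Sum.inr_injective h, rfl⟩
        · exact absurd h Sum.inl_ne_inr
        · exact absurd h Sum.inl_ne_inr
      obtain ⟨x, hx, hsx⟩ := hflag s hs
      obtain ⟨y, hy, hsy⟩ := hflag s' hs'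
      rw [hsy]
      rw [hsx] at hsQ
      exact mk_mem_of_face_eq (fun z hz => h (Sum.inl z) (Or.inr (congrArg Sum.inr hz))) hx hy hsQ

end NonrepetitiveColouring

namespace NonrepetitiveColouring

variable {V : Type*} {G : SimpleGraph V}

theorem nonempty_embeddingScheme [Finite V] (G : SimpleGraph V) : Nonempty G.EmbeddingScheme := by
  classical
  have := Fintype.ofFinite G.Dart
  have hex : ∀ v : V, ∃ f : Equiv.Perm G.Dart, f.IsCycleOn {d | d.fst = v} := fun v => by
    obtain ⟨f, hf, -⟩ := Finset.exists_cycleOn (Finset.univ.filter fun d : G.Dart => d.fst = v)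
    exact ⟨f, by simpa using hf⟩
  choose f hf using hex
  have hfst : ∀ d, (f d.fst d).fst = d.fst := fun d => (hf d.fst).1.mapsTo rfl
  have hfst' : ∀ d, ((f d.fst).symm d).fst = d.fst := fun d =>
    (hf d.fst).apply_mem_iff.1 (by simp)
  let rot : Equiv.Perm G.Dart :=
    { toFun := fun d => f d.fst d
      invFun := fun d => (f d.fst).symm d
      left_inv := fun d => by simp only [hfst, Equiv.symm_apply_apply]
      right_inv := fun d => by simp only [hfst', Equiv.apply_symm_apply] }
  have hpow : ∀ (n : ℕ) (d : G.Dart), (rot ^ n) d = (f d.fst ^ n) d := by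
    intro n
    induction n with
    | zero => exact fun _ => rfl
    | succ n ih =>
      intro d
      rw [pow_succ, pow_succ, Equiv.Perm.mul_apply, Equiv.Perm.mul_apply, ih,
        show rot d = f d.fst d from rfl, hfst]
  refine ⟨⟨rot, hfst, fun d d' h => ?_, fun _ => true⟩⟩
  have hd := (hf d.fst).2 (show d ∈ {e : G.Dart | e.fst = d.fst} from rfl)
    (show d' ∈ {e : G.Dart | e.fst = d.fst} from h.symm)
  obtain ⟨n, -, hn⟩ := hd.exists_pow_eq'
  exact ⟨n, by rw [zpow_natCast, hpow, hn]⟩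

theorem exists_side_of_adj {E : G.EmbeddingScheme} {u v : V} (h : G.Adj u v) :
    ∃ s, s((triangulation E).fst s, (triangulation E).snd s) = s(Sum.inl u, Sum.inl v) := by
  let d : G.Dart := ⟨(u, v), h⟩
  exact ⟨Sum.inr (Triangle.mk (d, true)), congrArg (Sym2.map Sum.inl) (Quot.out_eq d.edge)⟩

theorem exists_inc_triangulation {E : G.EmbeddingScheme} {u v : V} (h : G.Adj u v) :
    ∃ s, (triangulation E).Inc (Sum.inl u) s :=
  ⟨Sum.inl (⟨(u, v), h⟩, true), Or.inl rfl⟩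

theorem connectedComponentMk_triangulation {E : G.EmbeddingScheme} {u v : V}
    (h : G.Reachable u v) :
    (triangulation E).graph.connectedComponentMk (Sum.inl u) =
      (triangulation E).graph.connectedComponentMk (Sum.inl v) := by
  obtain ⟨p⟩ := h
  induction p with
  | nil => rfl
  | cons h _ ih =>
    have hadj : (triangulation E).graph.Adj (Sum.inl _) (Sum.inl _) :=
      ⟨fun e => h.ne (Sum.inl_injective e), exists_side_of_adj h⟩
    exact (SimpleGraph.ConnectedComponent.sound hadj.reachable).trans ih

theorem not_inc_triangulation {E : G.EmbeddingScheme} {v : V} (hv : ∀ w, ¬ G.Adj v w)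
    (s : (G.Dart × Bool) ⊕ Triangle E) : ¬ (triangulation E).Inc (Sum.inl v) s := by
  have hx : ∀ x : G.Dart × Bool, x.1.fst ≠ v := by
    rintro x rfl
    exact hv _ x.1.adj
  rcases s with x | t
  · rintro (h | h)
    · exact hx x (Sum.inl_injective h)
    · exact Sum.inr_ne_inl h
  · intro h
    have : v ∈ t.edge := h.elim (fun h => Sum.inl_injective h ▸ Sym2.out_fst_mem _)
      fun h => Sum.inl_injective h ▸ Sym2.out_snd_mem _
    obtain ⟨x, h, -⟩ := Triangle.exists_mk_of_mem_edge this
    exact hx x h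

variable [Finite V]

theorem card_triangle (E : G.EmbeddingScheme) :
    Nat.card (Triangle E) = 2 * Nat.card G.edgeSet := by
  classical
  have := Fintype.ofFinite V
  have h1 := two_mul_card_quot_of_involutive (flipEnd_flipEnd E) (flipEnd_ne E)
  have h2 := G.dart_card_eq_twice_card_edges
  rw [Nat.card_prod, Nat.card_eq_fintype_card (α := G.Dart), h2, Nat.card_eq_fintype_card
    (α := Bool), Fintype.card_bool] at h1
  rw [Nat.card_eq_fintype_card (α := G.edgeSet), ← SimpleGraph.edgeFinset_card]
  unfold Triangle
  omega

theorem flagFaceCount_le (E : G.EmbeddingScheme) : E.flagFaceCount ≤ 2 * Nat.card (Face E) := by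
  let next : G.Dart × Bool → Quot fun x y => E.next x = y := Quot.mk _
  have hnext : ∀ x, next (flipCorner E (flipEnd E x)) = next x := fun x =>
    Eq.symm (Quot.sound (next_eq E x : E.next x = _))
  let orbits : Face E → Set (Quot fun x y => E.next x = y) :=
    Quot.lift (fun x => {next x, next (flipEnd E x)}) <| by
      rintro x _ (rfl | rfl)
      · rw [flipEnd_flipEnd]
        exact Set.pair_comm _ _
      · have h1 := hnext (flipEnd E x)
        have h2 := hnext (flipEnd E (flipCorner E x))
        rw [flipEnd_flipEnd] at h1
        rw [flipEnd_flipEnd, flipCorner_flipCorner] at h2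
        rw [h1, ← h2]
        exact Set.pair_comm _ _
  let f : Face E × Bool → Quot fun x y => E.next x = y := fun p =>
    if p.2 then next (Quot.out p.1) else next (flipEnd E (Quot.out p.1))
  have hf : Function.Surjective f := by
    rintro ⟨x⟩
    have hx : next x ∈ orbits (Face.mk (Quot.out (Face.mk x : Face E))) := by
      rw [show (Face.mk (Quot.out (Face.mk x : Face E)) : Face E) = Face.mk x from Quot.out_eq _]
      exact Or.inl rfl
    rcases hx with h | h
    · exact ⟨(Face.mk x, true), h.symm⟩
    · exact ⟨(Face.mk x, false), h.symm⟩
  have := Nat.card_le_card_of_surjective f hf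
  rwa [Nat.card_prod, Nat.card_eq_fintype_card (α := Bool), Fintype.card_bool, mul_comm] at this

theorem card_component_triangulation_le (E : G.EmbeddingScheme) :
    Nat.card (triangulation E).graph.ConnectedComponent ≤ Nat.card G.ConnectedComponent := by
  refine Nat.card_le_card_of_surjective
    (SimpleGraph.ConnectedComponent.lift
      (fun v => (triangulation E).graph.connectedComponentMk (Sum.inl v))
      fun u v p _ => connectedComponentMk_triangulation p.reachable) ?_
  rintro ⟨v | f⟩
  · exact ⟨G.connectedComponentMk v, rfl⟩
  · obtain ⟨x, rfl⟩ : ∃ x, Face.mk x = f := Quot.exists_rep f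
    exact ⟨G.connectedComponentMk x.1.fst,
      (triangulation E).connectedComponentMk_fst (Sum.inl x)⟩

/-- A graph with an embedding of small Euler genus has a layered partition with few vertices in
each layer of each part. -/
theorem exists_layered_partition [Nonempty G.Dart] (E : G.EmbeddingScheme) :
    0 ≤ E.eulerGenusInt ∧ ∀ m : ℕ, 3 ≤ m → 2 * E.eulerGenusInt ≤ m →
    ∃ (level part : V → ℕ) (H : SimpleGraph ℕ), HasWidth H 3 ∧
      (∀ u v, G.Adj u v → level u ≤ level v + 1 ∧ LazyAdj H (part u) (part v)) ∧
      ∀ u, {v | G.Reachable u v ∧ (∃ w, G.Adj v w) ∧ part v = part u ∧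
        level v = level u}.ncard ≤ m := by
  have hI : ∀ u ∈ (Sum.inl '' {v | ∀ w, ¬ G.Adj v w} : Set (V ⊕ Face E)), ∀ s,
      ¬ (triangulation E).Inc u s := by
    rintro _ ⟨v, hv, rfl⟩
    exact not_inc_triangulation hv
  obtain ⟨h0, h1⟩ := (triangulation E).exists_layered_partition hI
  have hc := card_component_triangulation_le E
  have hF := flagFaceCount_le E
  rw [Set.ncard_image_of_injective _ Sum.inl_injective, Nat.card_sum, card_triangle] at h0 h1
  have hg : E.eulerGenusInt = 2 * Nat.card G.ConnectedComponent -
      ((Nat.card V : ℤ) - Nat.card G.edgeSet +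
        (E.flagFaceCount / 2 + {v | ∀ w : V, ¬ G.Adj v w}.ncard)) := rfl
  refine ⟨by omega, fun m hm h => ?_⟩
  obtain ⟨level, part, H, hH, hlevel, hadj, hcard⟩ := h1 m hm (by omega)
  refine ⟨fun v => level (Sum.inl v), fun v => part (Sum.inl v), H, hH, fun u v h => ?_,
    fun u => ?_⟩
  · obtain ⟨s, hs⟩ := exists_side_of_adj (E := E) h
    have h1 := hlevel s
    have h2 := hadj s
    rcases Sym2.eq_iff.1 hs with ⟨e, e'⟩ | ⟨e, e'⟩ <;> rw [e, e'] at h1 h2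
    · exact ⟨h1.1, h2⟩
    · exact ⟨h1.2, h2.symm⟩
  · refine le_trans ?_ (hcard (part (Sum.inl u)) (level (Sum.inl u))
      ((triangulation E).graph.connectedComponentMk (Sum.inl u)))
    rw [← Set.ncard_image_of_injective _ (Sum.inl_injective : Function.Injective
      (Sum.inl : V → V ⊕ Face E))]
    refine Set.ncard_le_ncard ?_ (Set.toFinite _)
    rintro _ ⟨v, ⟨hr, ⟨w, hw⟩, hp, hl⟩, rfl⟩
    exact ⟨exists_inc_triangulation hw, hp, hl, (connectedComponentMk_triangulation hr).symm⟩

theorem exists_embeddingScheme_eq_eulerGenus [Nonempty G.Dart] :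
    ∃ E : G.EmbeddingScheme, E.eulerGenusInt = (G.eulerGenus : ℤ) := by
  obtain ⟨E⟩ := nonempty_embeddingScheme G
  exact Nat.sInf_mem (s := {g : ℕ | ∃ S : G.EmbeddingScheme, S.eulerGenusInt = (g : ℤ)})
    ⟨_, E, (Int.toNat_of_nonneg (exists_layered_partition E).1).symm⟩

theorem exists_injOn_fin {V : Type*} {s : Set V} (hs : s.Finite) {m : ℕ} (hm : 0 < m)
    (h : s.ncard ≤ m) : ∃ f : V → Fin m, s.InjOn f := by
  have : Nonempty (Fin m) := ⟨⟨0, hm⟩⟩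
  obtain ⟨f, -, hf⟩ := hs.exists_injOn_of_encard_le (t := (Set.univ : Set (Fin m))) (by
    rw [← hs.cast_ncard_eq, Set.encard_univ, ENat.card_eq_coe_fintype_card, Fintype.card_fin]
    exact_mod_cast h)
  exact ⟨f, hf⟩

variable {V : Type*} {G : SimpleGraph V}

/-- Vertices in the same class can be distinguished by an index below the class size bound. -/
theorem exists_index [Finite V] {level part : V → ℕ} {m : ℕ} (hm : 0 < m)
    (h : ∀ u, {v | G.Reachable u v ∧ (∃ w, G.Adj v w) ∧ part v = part u ∧
      level v = level u}.ncard ≤ m) :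
    ∃ index : V → Fin m, ∀ u v, G.Reachable u v → part u = part v → level u = level v →
      index u = index v → u = v := by
  let key : V → G.ConnectedComponent × ℕ × ℕ :=
    fun v => (G.connectedComponentMk v, part v, level v)
  have hex : ∀ c, ∃ f : V → Fin m, {v | (∃ w, G.Adj v w) ∧ key v = c}.InjOn f := fun c => by
    refine exists_injOn_fin (Set.toFinite _) hm ?_
    rcases Set.eq_empty_or_nonempty {v | (∃ w, G.Adj v w) ∧ key v = c} with h0 | ⟨u, -, hu⟩
    · simp [h0]
    · refine (Set.ncard_le_ncard ?_ (Set.toFinite _)).trans (h u)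
      rintro v ⟨hv, hvc⟩
      have huv := hvc.trans hu.symm
      simp only [key, Prod.mk.injEq, SimpleGraph.ConnectedComponent.eq] at huv
      exact ⟨huv.1.symm, hv, huv.2⟩
  choose f hf using hex
  refine ⟨fun v => f (key v) v, fun u v hr hp hl hi => ?_⟩
  by_contra hne
  have hk : key v = key u := by
    simp only [key, Prod.mk.injEq, SimpleGraph.ConnectedComponent.eq]
    exact ⟨hr.symm, hp.symm, hl.symm⟩
  have hadj : ∀ {a b : V}, G.Reachable a b → a ≠ b → ∃ w, G.Adj a w := by
    rintro a b ⟨_ | ⟨h, -⟩⟩ hab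
    exacts [absurd rfl hab, ⟨_, h⟩]
  refine hne (hf (key u) ⟨hadj hr hne, rfl⟩ ⟨hadj hr.symm (Ne.symm hne), hk⟩ ?_)
  simpa only [hk] using hi

theorem isNonrepetitiveColouring_of_layered {level part : V → ℕ} {H : SimpleGraph ℕ}
    (hadj : ∀ u v, G.Adj u v → level u ≤ level v + 1 ∧ LazyAdj H (part u) (part v))
    {α β : Type*} {φ : ℕ → α} (hφ : IsStronglyNonrepetitive H φ) {index : V → β}
    (hindex : ∀ u v, G.Reachable u v → part u = part v → level u = level v →
      index u = index v → u = v) :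
    G.IsNonrepetitiveColouring
      fun v => (φ (part v), lineWord (level v), index v) := by
  intro u v p hp k hk heq
  have hk0 : k ≠ 0 := by
    rintro rfl
    simp at hk
  obtain ⟨l, hl⟩ : ∃ l, l = (p.support.take k).zip (p.support.drop k) := ⟨_, rfl⟩
  have hlen : (p.support.take k).length = (p.support.drop k).length := by
    simp only [List.length_take, List.length_drop]
    omega
  have hfst : l.map Prod.fst = p.support.take k := hl ▸ List.map_fst_zip hlen.le
  have hsnd : l.map Prod.snd = p.support.drop k := hl ▸ List.map_snd_zip hlen.ge
  have happ : l.map Prod.fst ++ l.map Prod.snd = p.support := by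
    rw [hfst, hsnd, List.take_append_drop]
  rw [← List.map_take, ← List.map_drop, ← hfst, ← hsnd, List.map_map, List.map_map,
    List.map_inj_left] at heq
  simp only [Function.comp_apply, Prod.mk.injEq] at heq
  have hchain : (l.map Prod.fst ++ l.map Prod.snd).IsChain G.Adj :=
    happ ▸ p.isChain_adj_support
  have hlevel := lineWord_boring_list level l
    (hchain.imp fun _ _ h => ⟨(hadj _ _ h).1, (hadj _ _ h.symm).1⟩) fun q hq => (heq q hq).2.1
  obtain ⟨q', hq', hpart⟩ := hφ (l.map (Prod.map part part))
    (by
      intro h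
      have := congrArg List.length h
      simp only [hl, List.length_map, List.length_zip, List.length_take, List.length_drop,
        List.length_nil] at this
      omega)
    (by
      have h := (List.isChain_map part).2 (hchain.imp fun _ _ h => (hadj _ _ h).2)
      simpa only [List.map_append, List.map_map, Function.comp_def,
        Prod.map_fst, Prod.map_snd] using h)
    (by
      simp only [List.mem_map]
      rintro _ ⟨q, hq, rfl⟩
      exact (heq q hq).1)
  obtain ⟨q, hq, rfl⟩ := List.mem_map.1 hq'
  have h1 : q.1 ∈ l.map Prod.fst := List.mem_map_of_mem hq
  have h2 : q.2 ∈ l.map Prod.snd := List.mem_map_of_mem hq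
  have hreach : ∀ w ∈ p.support, G.Reachable u w := by
    classical
    exact fun w hw => ⟨p.takeUntil w hw⟩
  have h12 : q.1 = q.2 := hindex q.1 q.2
    ((hreach _ (happ ▸ List.mem_append_left _ h1)).symm.trans
      (hreach _ (happ ▸ List.mem_append_right _ h2))) hpart (hlevel q hq) (heq q hq).2.2
  have hnodup := hp.support_nodup
  rw [← happ] at hnodup
  exact List.disjoint_of_nodup_append hnodup h1 (h12 ▸ h2)

theorem nonrepChromNum_le_card {α : Type*} [Fintype α] {φ : V → α}
    (hφ : G.IsNonrepetitiveColouring φ) {n : ℕ} (hn : Fintype.card α = n) :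
    G.nonrepChromNum ≤ n := by
  let e := Fintype.equivFinOfCardEq hn
  refine Nat.sInf_le ⟨e ∘ φ, fun u v p hp k hk h => hφ p hp k hk ?_⟩
  rw [← List.map_map, ← List.map_take, ← List.map_drop] at h
  exact List.map_injective_iff.2 e.injective h

end NonrepetitiveColouring

open NonrepetitiveColouring

/-- **Theorem 2.** Every graph `G` with Euler genus `g` satisfies
`π(G) ≤ 256 · max {2g, 3}`. -/
theorem nonrepChromNum_le_of_eulerGenus (V : Type) [Fintype V] (G : SimpleGraph V)
    (g : ℕ) (hg : G.eulerGenus = g) :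
    G.nonrepChromNum ≤ 256 * max (2 * g) 3 := by
  rcases isEmpty_or_nonempty G.Dart with hG | hG
  · have hφ : G.IsNonrepetitiveColouring fun _ => () := by
      rintro u v (_ | ⟨h, -⟩) - k hk
      · simp at hk
        omega
      · exact hG.elim ⟨(_, _), h⟩
    exact (nonrepChromNum_le_card hφ rfl).trans (by simp; omega)
  · obtain ⟨E, hE⟩ := exists_embeddingScheme_eq_eulerGenus (G := G)
    obtain ⟨level, part, H, hH, hadj, hcard⟩ :=
      (exists_layered_partition E).2 (max (2 * g) 3) (le_max_right _ _) (by
        rw [hE, hg]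
        exact_mod_cast le_max_left _ _)
    obtain ⟨index, hindex⟩ := exists_index (by omega) hcard
    obtain ⟨φ, hφ⟩ := hH.exists_isStronglyNonrepetitive
    refine nonrepChromNum_le_card (isNonrepetitiveColouring_of_layered hadj hφ hindex) ?_
    simp only [Fintype.card_prod, Fintype.card_fin]
    omega
end

section
/- Every path P has a 4-colouring φ such that every φ-repetitive lazy walk in P is boring. -/
/-- A *lazy walk* in `G` is a sequence of vertices in which any two consecutive vertices
are equal or adjacent. -/
def SimpleGraph.IsLazyWalk {V : Type*} (G : SimpleGraph V) (l : List V) : Prop :=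
  l.Chain' fun a b => a = b ∨ G.Adj a b

/-- A colouring `φ` of `G` is *strongly nonrepetitive* if every `φ`-repetitive lazy walk
`v₀, …, v₂ₖ₋₁` (with `k ≥ 1`, repetitive meaning the first half of the colour sequence
equals the second half) has `vᵢ = vᵢ₊ₖ` for some `i < k`. -/
def SimpleGraph.IsStronglyNonrepetitiveColouring {V α : Type*} (G : SimpleGraph V)
    (φ : V → α) : Prop :=
  ∀ (l : List V) (k : ℕ), G.IsLazyWalk l → 0 < k → l.length = 2 * k →
    (l.map φ).take k = (l.map φ).drop k → ∃ i < k, l[i]? = l[i + k]?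

/-- `π*(G)`: the least `n` such that `G` has a strongly nonrepetitive colouring with
`n` colours. -/
noncomputable def SimpleGraph.strongNonrepChromNum {V : Type*} (G : SimpleGraph V) : ℕ :=
  sInf {n : ℕ | ∃ φ : V → Fin n, G.IsStronglyNonrepetitiveColouring φ}

/-- `φ` is a colouring of `G` all of whose `φ`-repetitive lazy walks `v₀, …, v₂ₖ₋₁` are
*boring*, i.e. satisfy `vᵢ = vᵢ₊ₖ` for all `i < k`. -/
def SimpleGraph.LazyWalksBoring {V α : Type*} (G : SimpleGraph V) (φ : V → α) : Prop :=
  ∀ (l : List V) (k : ℕ), G.IsLazyWalk l → l.length = 2 * k →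
    (l.map φ).take k = (l.map φ).drop k → ∀ i < k, l[i]? = l[i + k]?

/-- The Thue–Morse sequence: the parity of the number of ones in the binary expansion. -/
def thueMorse (n : ℕ) : Bool :=
  if n = 0 then false else xor (decide (n % 2 = 1)) (thueMorse (n / 2))

theorem thueMorse_two_mul (n : ℕ) : thueMorse (2 * n) = thueMorse n := by
  rcases Nat.eq_zero_or_pos n with rfl | hn
  · rfl
  · rw [thueMorse, if_neg (by omega), show 2 * n / 2 = n by omega]
    simp

theorem thueMorse_two_mul_add_one (n : ℕ) : thueMorse (2 * n + 1) = !thueMorse n := by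
  rw [thueMorse, if_neg (by omega), show (2 * n + 1) / 2 = n by omega]
  simp

theorem thueMorse_ne_of_even {n : ℕ} (hn : n % 2 = 0) : thueMorse n ≠ thueMorse (n + 1) := by
  obtain ⟨m, rfl⟩ : ∃ m, n = 2 * m := ⟨n / 2, by omega⟩
  simp [thueMorse_two_mul, thueMorse_two_mul_add_one]

theorem not_thueMorse_cube (n : ℕ) :
    ¬(thueMorse n = thueMorse (n + 1) ∧ thueMorse (n + 1) = thueMorse (n + 2)) := by
  rintro ⟨h₁, h₂⟩
  rcases Nat.mod_two_eq_zero_or_one n with hn | hn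
  · exact thueMorse_ne_of_even hn h₁
  · exact thueMorse_ne_of_even (n := n + 1) (by omega) h₂

theorem thueMorse_eq_succ_of_odd_ne {n : ℕ}
    (h : thueMorse (2 * n + 1) ≠ thueMorse (2 * n + 2)) : thueMorse n = thueMorse (n + 1) := by
  rw [show 2 * n + 2 = 2 * (n + 1) by ring, thueMorse_two_mul, thueMorse_two_mul_add_one] at h
  simpa using h

/-- The Thue–Morse sequence is overlap-free. -/
theorem thueMorse_overlapFree (d : ℕ) (hd : 0 < d) (a : ℕ) :
    ¬∀ x, a ≤ x → x ≤ a + d → thueMorse x = thueMorse (x + d) := by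
  induction d using Nat.strong_induction_on generalizing a with
  | _ d ih =>
  intro h
  rcases Nat.mod_two_eq_zero_or_one d with hd2 | hd2
  · obtain ⟨e, rfl⟩ : ∃ e, d = 2 * e := ⟨d / 2, by omega⟩
    refine ih e (by omega) (by omega) (a / 2) fun y hy hy' => ?_
    rcases Nat.mod_two_eq_zero_or_one a with ha | ha
    · have := h (2 * y) (by omega) (by omega)
      rwa [← mul_add, thueMorse_two_mul, thueMorse_two_mul] at this
    · have := h (2 * y + 1) (by omega) (by omega)
      rw [show 2 * y + 1 + 2 * e = 2 * (y + e) + 1 by ring, thueMorse_two_mul_add_one,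
        thueMorse_two_mul_add_one] at this
      simpa using this
  · have alt : ∀ x, a ≤ x → x < a + d →
        thueMorse x ≠ thueMorse (x + 1) ∧ thueMorse (x + d) ≠ thueMorse (x + d + 1) := by
      intro x hx hx'
      have h₀ := h x hx (by omega)
      have h₁ := h (x + 1) (by omega) (by omega)
      rw [show x + 1 + d = x + d + 1 by ring] at h₁
      rcases Nat.mod_two_eq_zero_or_one x with hx2 | hx2
      · have := thueMorse_ne_of_even hx2
        exact ⟨this, by rwa [← h₀, ← h₁]⟩
      · have := thueMorse_ne_of_even (n := x + d) (by omega)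
        exact ⟨by rwa [h₀, h₁], this⟩
    have alt' : ∀ x, a ≤ x → x < a + 2 * d → thueMorse x ≠ thueMorse (x + 1) := by
      intro x hx hx'
      by_cases hxd : x < a + d
      · exact (alt x hx hxd).1
      · have := (alt (x - d) (by omega) (by omega)).2
        rwa [show x - d + d = x by omega] at this
    obtain rfl | hd3 : d = 1 ∨ 3 ≤ d := by omega
    · exact alt' a le_rfl (by omega) (h a le_rfl (by omega))
    · refine not_thueMorse_cube (a / 2) ⟨?_, ?_⟩
      · exact thueMorse_eq_succ_of_odd_ne (alt' _ (by omega) (by omega))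
      · exact thueMorse_eq_succ_of_odd_ne (alt' _ (by omega) (by omega))

/-- The sequence of differences of the Thue–Morse sequence, with three symbols `0`, `1`, `2`. -/
def ternaryThue (n : ℕ) : Fin 4 :=
  if thueMorse n = thueMorse (n + 1) then 0 else if thueMorse n then 1 else 2

theorem ternaryThue_ne_three (n : ℕ) : ternaryThue n ≠ 3 := by
  unfold ternaryThue
  split_ifs <;> decide

theorem thueMorse_eq_iff_of_ternaryThue_eq {m n : ℕ} (h : ternaryThue m = ternaryThue n) :
    thueMorse m = thueMorse n ↔ thueMorse (m + 1) = thueMorse (n + 1) := by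
  unfold ternaryThue at h
  revert h
  cases thueMorse m <;> cases thueMorse n <;> cases thueMorse (m + 1) <;>
    cases thueMorse (n + 1) <;> decide

theorem ternaryThue_eq_zero_of_thueMorse_ne {m n : ℕ} (h : ternaryThue m = ternaryThue n)
    (hne : thueMorse m ≠ thueMorse n) : thueMorse m = thueMorse (m + 1) := by
  unfold ternaryThue at h
  revert h hne
  cases thueMorse m <;> cases thueMorse n <;> cases thueMorse (m + 1) <;>
    cases thueMorse (n + 1) <;> decide

theorem ternaryThue_squareFree (d : ℕ) (hd : 0 < d) (a : ℕ) :
    ¬∀ x, a ≤ x → x < a + d → ternaryThue x = ternaryThue (x + d) := by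
  intro h
  have key : ∀ j ≤ d, (thueMorse (a + j) = thueMorse (a + j + d) ↔
      thueMorse a = thueMorse (a + d)) := by
    intro j hj
    induction j with
    | zero => rfl
    | succ j ih =>
      rw [← ih (by omega), thueMorse_eq_iff_of_ternaryThue_eq (h (a + j) (by omega) (by omega))]
      rw [show a + j + d + 1 = a + (j + 1) + d by ring, add_assoc a j 1]
  by_cases h₀ : thueMorse a = thueMorse (a + d)
  · refine thueMorse_overlapFree d hd a fun x hx hx' => ?_
    have := (key (x - a) (by omega)).2 h₀
    rwa [show a + (x - a) = x by omega] at this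
  · have const : ∀ j ≤ d, thueMorse (a + j) = thueMorse a := by
      intro j hj
      induction j with
      | zero => rfl
      | succ j ih =>
        rw [← ih (by omega), ← add_assoc]
        exact (ternaryThue_eq_zero_of_thueMorse_ne (h (a + j) (by omega) (by omega))
          (mt (key j (by omega)).1 h₀)).symm
    exact h₀ (const d le_rfl).symm

/-- The ternary Thue word with the symbol `3` inserted after every second letter. -/
def palindromeFreeWord (n : ℕ) : Fin 4 :=
  if n % 3 = 2 then 3 else ternaryThue (2 * (n / 3) + n % 3)

theorem palindromeFreeWord_eq_three_iff {n : ℕ} : palindromeFreeWord n = 3 ↔ n % 3 = 2 := by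
  unfold palindromeFreeWord
  split_ifs with h <;> simp [h, ternaryThue_ne_three]

theorem palindromeFreeWord_apply (i : ℕ) :
    palindromeFreeWord (3 * (i / 2) + i % 2) = ternaryThue i := by
  rw [palindromeFreeWord, if_neg (by omega)]
  congr 1
  omega

theorem ternaryThue_ne_succ (i : ℕ) : ternaryThue i ≠ ternaryThue (i + 1) := fun h =>
  ternaryThue_squareFree 1 one_pos i fun x hx hx' => by
    obtain rfl : x = i := by omega
    exact h

theorem palindromeFreeWord_injective_of_close {x y : ℕ} (hxy : x ≤ y + 2) (hyx : y ≤ x + 2)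
    (h : palindromeFreeWord x = palindromeFreeWord y) : x = y := by
  wlog hle : x ≤ y generalizing x y
  · exact (this hyx hxy h.symm (by omega)).symm
  by_contra hne
  have h₃ : x % 3 = 2 ↔ y % 3 = 2 := by
    rw [← palindromeFreeWord_eq_three_iff, ← palindromeFreeWord_eq_three_iff, h]
  unfold palindromeFreeWord at h
  rw [if_neg (by omega), if_neg (by omega),
    show 2 * (y / 3) + y % 3 = 2 * (x / 3) + x % 3 + 1 by omega] at h
  exact ternaryThue_ne_succ _ h

theorem palindromeFreeWord_squareFree (d : ℕ) (hd : 0 < d) (a : ℕ) :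
    ¬∀ x, a ≤ x → x < a + d → palindromeFreeWord x = palindromeFreeWord (x + d) := by
  intro h
  by_cases hd3 : d < 3
  · have := palindromeFreeWord_injective_of_close (by omega) (by omega) (h a le_rfl (by omega))
    omega
  have hmod : d % 3 = 0 := by
    obtain ⟨x, hx, hx', hx3⟩ : ∃ x, a ≤ x ∧ x < a + 3 ∧ x % 3 = 2 :=
      ⟨3 * (a / 3) + 2, by omega⟩
    have := h x hx (by omega)
    rw [palindromeFreeWord_eq_three_iff.2 hx3, eq_comm, palindromeFreeWord_eq_three_iff] at this
    omega
  obtain ⟨e, rfl⟩ : ∃ e, d = 3 * e := ⟨d / 3, by omega⟩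
  refine ternaryThue_squareFree (2 * e) (by omega) (2 * (a / 3) + a % 3) fun i hi hi' => ?_
  rw [← palindromeFreeWord_apply, ← palindromeFreeWord_apply,
    h _ (by omega) (by omega)]
  congr 1
  omega

theorem exists_eq_of_step_le_one {f : ℕ → ℕ} {m : ℕ}
    (hf : ∀ i < m, f (i + 1) ≤ f i + 1 ∧ f i ≤ f (i + 1) + 1) {x : ℕ}
    (hx : f 0 ≤ x ∧ x ≤ f m ∨ f m ≤ x ∧ x ≤ f 0) : ∃ i ≤ m, f i = x := by
  induction m with
  | zero => exact ⟨0, le_rfl, by omega⟩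
  | succ m ih =>
    by_cases hm : f (m + 1) = x
    · exact ⟨m + 1, le_rfl, hm⟩
    · have := hf m (by omega)
      obtain ⟨i, hi, rfl⟩ := ih (fun i hi => hf i (by omega)) (by omega)
      exact ⟨i, by omega, rfl⟩

/-- If `c` is injective on windows of length three, two lazy walks in `ℕ` with the same colours
differ by a translation or by a reflection. -/
theorem translate_or_reflect {α : Type*} {c : ℕ → α}
    (hc : ∀ {x y : ℕ}, x ≤ y + 2 → y ≤ x + 2 → c x = c y → x = y) {u w : ℕ → ℕ} {m : ℕ}
    (hu : ∀ i < m, u (i + 1) ≤ u i + 1 ∧ u i ≤ u (i + 1) + 1)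
    (hw : ∀ i < m, w (i + 1) ≤ w i + 1 ∧ w i ≤ w (i + 1) + 1)
    (huw : ∀ i ≤ m, c (u i) = c (w i)) :
    (∀ i ≤ m, w i + u 0 = w 0 + u i) ∨ (∀ i ≤ m, w i + u i = w 0 + u 0) := by
  have key : ∀ i ≤ m, (∀ j ≤ i, u j = u 0 ∧ w j = w 0) ∨
      (∃ p q, c p = c q ∧ (p = u i + 1 ∨ u i = p + 1) ∧
        ((q + u i = w i + p ∧ ∀ j ≤ i, w j + u 0 = w 0 + u j) ∨
          (q + p = w i + u i ∧ ∀ j ≤ i, w j + u j = w 0 + u 0))) := by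
    intro i hi
    induction i with
    | zero =>
      left
      intro j hj
      obtain rfl : j = 0 := by omega
      exact ⟨rfl, rfl⟩
    | succ i ih =>
      have hu' := hu i hi
      have hw' := hw i hi
      have e₀ := huw i (by omega)
      have e₁ := huw (i + 1) hi
      have lazy_iff : u i = u (i + 1) ↔ w i = w (i + 1) :=
        ⟨fun h => hc (by omega) (by omega) (by rw [← e₀, ← e₁, h]),
          fun h => hc (by omega) (by omega) (by rw [e₀, e₁, h])⟩
      rcases ih (by omega) with h | ⟨p, q, hpq, hp, h⟩
      · have hi' := h i le_rfl
        by_cases hlazy : u i = u (i + 1)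
        · left
          intro j hj
          rcases Nat.le_add_one_iff.1 hj with hj | rfl
          · exact h j hj
          · have := lazy_iff.1 hlazy
            omega
        · have := mt lazy_iff.2 hlazy
          refine Or.inr ⟨u i, w i, e₀, by omega, ?_⟩
          by_cases hs : w i + u (i + 1) = w (i + 1) + u i
          · refine Or.inl ⟨hs, fun j hj => ?_⟩
            rcases Nat.le_add_one_iff.1 hj with hj | rfl
            · have := h j hj
              omega
            · omega
          · refine Or.inr ⟨by omega, fun j hj => ?_⟩
            rcases Nat.le_add_one_iff.1 hj with hj | rfl
            · have := h j hj
              omega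
            · omega
      · right
        have hback : p = u (i + 1) ↔ q = w (i + 1) :=
          ⟨fun h' => hc (by omega) (by omega) (by rw [← hpq, ← e₁, h']),
            fun h' => hc (by omega) (by omega) (by rw [hpq, e₁, h'])⟩
        have ext₁ : (∀ j ≤ i, w j + u 0 = w 0 + u j) → w (i + 1) + u 0 = w 0 + u (i + 1) →
            ∀ j ≤ i + 1, w j + u 0 = w 0 + u j := fun h h' j hj => by
          rcases Nat.le_add_one_iff.1 hj with hj | rfl
          exacts [h j hj, h']
        have ext₂ : (∀ j ≤ i, w j + u j = w 0 + u 0) → w (i + 1) + u (i + 1) = w 0 + u 0 →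
            ∀ j ≤ i + 1, w j + u j = w 0 + u 0 := fun h h' j hj => by
          rcases Nat.le_add_one_iff.1 hj with hj | rfl
          exacts [h j hj, h']
        by_cases hlazy : u i = u (i + 1)
        · have hlazy' := lazy_iff.1 hlazy
          refine ⟨p, q, hpq, by omega, ?_⟩
          rcases h with ⟨h, h'⟩ | ⟨h, h'⟩
          · have := h' i le_rfl
            exact Or.inl ⟨by omega, ext₁ h' (by omega)⟩
          · have := h' i le_rfl
            exact Or.inr ⟨by omega, ext₂ h' (by omega)⟩
        · have hlazy' := mt lazy_iff.2 hlazy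
          refine ⟨u i, w i, e₀, by omega, ?_⟩
          rcases h with ⟨h, h'⟩ | ⟨h, h'⟩
          · have := h' i le_rfl
            exact Or.inl ⟨by omega, ext₁ h' (by omega)⟩
          · have := h' i le_rfl
            exact Or.inr ⟨by omega, ext₂ h' (by omega)⟩
  rcases key m le_rfl with h | ⟨-, -, -, -, ⟨-, h⟩ | ⟨-, h⟩⟩
  · left
    intro i hi
    have := h i hi
    omega
  · exact Or.inl h
  · exact Or.inr h

/-- If `c` is square-free and injective on windows of length three, then every `c`-repetitive
lazy walk in `ℕ` is boring. -/
theorem eq_of_repetitive_of_squareFree {α : Type*} {c : ℕ → α}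
    (hc : ∀ {x y : ℕ}, x ≤ y + 2 → y ≤ x + 2 → c x = c y → x = y)
    (hsq : ∀ d, 0 < d → ∀ a, ¬∀ x, a ≤ x → x < a + d → c x = c (x + d)) {f : ℕ → ℕ} {k : ℕ}
    (hf : ∀ i, i + 1 < 2 * k → f (i + 1) ≤ f i + 1 ∧ f i ≤ f (i + 1) + 1)
    (hrep : ∀ i < k, c (f i) = c (f (i + k))) : ∀ i < k, f i = f (i + k) := by
  rcases k with _ | m
  · simp
  have step : ∀ i < m, (f i = f (i + (m + 1)) ↔ f (i + 1) = f (i + 1 + (m + 1))) := by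
    intro i hi
    have h₁ := hf i (by omega)
    have h₂ := hf (i + (m + 1)) (by omega)
    rw [show i + (m + 1) + 1 = i + 1 + (m + 1) by ring] at h₂
    exact ⟨fun h => hc (by omega) (by omega) (hrep (i + 1) (by omega)),
      fun h => hc (by omega) (by omega) (hrep i (by omega))⟩
  have all : ∀ i ≤ m, (f i = f (i + (m + 1)) ↔ f 0 = f (0 + (m + 1))) := by
    intro i hi
    induction i with
    | zero => rfl
    | succ i ih => rw [← ih (by omega), step i (by omega)]
  by_contra! hne
  obtain ⟨i₀, hi₀, hne⟩ := hne
  have hne : ∀ i ≤ m, f i ≠ f (i + (m + 1)) := fun i hi h =>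
    hne ((all i₀ (by omega)).2 ((all i hi).1 h))
  have far : ∀ i ≤ m, ¬(f i ≤ f (i + (m + 1)) + 2 ∧ f (i + (m + 1)) ≤ f i + 2) :=
    fun i hi h => hne i hi (hc h.1 h.2 (hrep i (by omega)))
  have hu : ∀ i < m, f (i + 1) ≤ f i + 1 ∧ f i ≤ f (i + 1) + 1 := fun i hi => hf i (by omega)
  have hw : ∀ i < m, f (i + 1 + (m + 1)) ≤ f (i + (m + 1)) + 1 ∧
      f (i + (m + 1)) ≤ f (i + 1 + (m + 1)) + 1 := fun i hi => by
    have := hf (i + (m + 1)) (by omega)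
    rwa [show i + (m + 1) + 1 = i + 1 + (m + 1) by ring] at this
  have join := hf m (by omega)
  have h₀ := far 0 (by omega)
  rcases translate_or_reflect hc (w := fun i => f (i + (m + 1))) hu hw
    (fun i hi => hrep i (by omega)) with h | h
  · simp only [Nat.zero_add] at h h₀
    rcases le_total (f 0) (f (m + 1)) with hle | hle
    · refine hsq (f (m + 1) - f 0) (by omega) (f 0) fun x hx hx' => ?_
      obtain ⟨i, hi, rfl⟩ := exists_eq_of_step_le_one hu (x := x) (by omega)
      rw [hrep i (by omega)]
      congr 1
      have := h i hi
      omega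
    · obtain ⟨j, hj, hj'⟩ := exists_eq_of_step_le_one hu (x := f (m + 1) + 1) (by omega)
      have hj := h j hj
      refine hsq (f 0 - f (m + 1)) (by omega) (f (m + 1) + 1 - (f 0 - f (m + 1)))
        fun x hx hx' => ?_
      obtain ⟨i, hi, hxi⟩ :=
        exists_eq_of_step_le_one hu (x := x + (f 0 - f (m + 1))) (by omega)
      rw [← hxi, hrep i (by omega)]
      congr 1
      have := h i hi
      omega
  · have side : ∀ i ≤ m, (f i < f (i + (m + 1)) ↔ f 0 < f (0 + (m + 1))) := by
      intro i hi
      induction i with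
      | zero => rfl
      | succ i ih =>
        rw [← ih (by omega)]
        have := hu i (by omega)
        have := hw i (by omega)
        have := far i (by omega)
        have := far (i + 1) (by omega)
        omega
    have := side m le_rfl
    have := far m le_rfl
    have := h m le_rfl
    simp only [Nat.zero_add] at *
    omega

/-- **Lemma (Kündgen–Pelsmajer).** Every path `P` has a `4`-colouring `φ` such that every
`φ`-repetitive lazy walk in `P` is boring. -/
theorem pathGraph_exists_four_colouring_lazyWalksBoring (n : ℕ) :
    ∃ φ : Fin n → Fin 4, (SimpleGraph.pathGraph n).LazyWalksBoring φ := by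
  refine ⟨fun x => palindromeFreeWord x, fun l k hl hlen hrep i hi => ?_⟩
  have hget : ∀ j (hj : j < l.length), (l.map Fin.val).getD j 0 = l[j] := fun j hj => by
    simp [hj]
  have key := eq_of_repetitive_of_squareFree palindromeFreeWord_injective_of_close
    palindromeFreeWord_squareFree (f := fun j => (l.map Fin.val).getD j 0) (k := k)
    (fun j hj => by
      have := List.isChain_iff_getElem.1 hl j (by omega)
      rw [SimpleGraph.pathGraph_adj, Fin.ext_iff] at this
      simp only [hget j (by omega), hget (j + 1) (by omega)]
      omega)
    (fun j hj => by
      have := congrArg (fun s => s[j]?) hrep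
      simp only [hget j (by omega), hget (j + k) (by omega)]
      simpa [List.getElem?_take, hj, List.getElem?_drop, add_comm k j,
        show j < l.length by omega, show j + k < l.length by omega] using this)
    i hi
  simp only [hget i (by omega), hget (i + k) (by omega)] at key
  rw [List.getElem?_eq_getElem (by omega), List.getElem?_eq_getElem (by omega), Fin.ext key]
end
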